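/- arXiv:2410.17091 — 7 statements merged into one kernel-verified Lean document; each statement's English description precedes it below -/
import Mathlib

section
/- Let A be an m×n real matrix with singular values σ₁ ≥ σ₂ ≥ … (the square roots of the eigenvalues of AᵀA arranged in non-increasing order). Choose a target rank r ≥ 2 and an oversampling parameter p ≥ 2 with r + p ≤ min{m, n}, and fix an integer q ≥ 0. Let Ω be an n×(r+p) random matrix with independent standard Gaussian N(0,1) entries, and let P_Ω denote the orthogonal projection of ℝᵐ onto the column space of (AAᵀ)^q A Ω. Then the expected spectral-norm error satisfies E‖A − P_Ω A‖₂ ≤ [ (1 + √(r/(p−1))) σ_{r+1}^{2q+1} + (e√(r+p)/p) (Σ_{j>r} σ_j^{2(2q+1)})^{1/2} ]^{1/(2q+1)}, where the expectation is over the Gaussian matrix Ω. -/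
open Matrix MeasureTheory ProbabilityTheory

/-- The product σ-algebra on matrices, viewing a matrix as the function of its entries. -/
instance matrixMeasurableSpace {m n α : Type*} [MeasurableSpace α] :
    MeasurableSpace (Matrix m n α) :=
  inferInstanceAs (MeasurableSpace (m → n → α))

/-- The spectral norm of a real matrix: the operator norm of the induced linear map
between Euclidean spaces. -/
noncomputable def specNorm {m n : ℕ} (A : Matrix (Fin m) (Fin n) ℝ) : ℝ :=
  ‖LinearMap.toContinuousLinearMap (Matrix.toEuclideanLin A)‖

section

open scoped ENNReal NNReal RealInnerProductSpace
open scoped Matrix.Norms.L2Operator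

/-- The standard Gaussian measure on `κ → ℝ`. -/
noncomputable abbrev gaussVec (κ : Type*) [Fintype κ] : Measure (κ → ℝ) :=
  Measure.pi fun _ => gaussianReal 0 1

instance matrixBorelSpace {ι κ : Type*} [Fintype ι] [Fintype κ] : BorelSpace (Matrix ι κ ℝ) :=
  inferInstanceAs (BorelSpace (ι → κ → ℝ))

/-- The standard Gaussian measure on `ι × κ` matrices. -/
noncomputable def gaussMat (ι κ : Type*) [Fintype ι] [Fintype κ] : Measure (Matrix ι κ ℝ) :=
  (Measure.pi fun _ => gaussVec κ : Measure (ι → κ → ℝ))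

instance isProbabilityMeasure_gaussMat {ι κ : Type*} [Fintype ι] [Fintype κ] :
    IsProbabilityMeasure (gaussMat ι κ) :=
  inferInstanceAs (IsProbabilityMeasure
    (Measure.pi fun _ => gaussVec κ : Measure (ι → κ → ℝ)))

theorem measurable_matrix_of {ι κ Ω : Type*} [MeasurableSpace Ω] {f : Ω → Matrix ι κ ℝ}
    (h : ∀ i j, Measurable fun ω => f ω i j) : Measurable f :=
  measurable_pi_lambda _ fun i => measurable_pi_lambda _ fun j => h i j

theorem measurable_matrix_entry {ι κ : Type*} (i : ι) (j : κ) :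
    Measurable fun G : Matrix ι κ ℝ => G i j :=
  (measurable_pi_apply (X := fun _ => ℝ) j).comp (measurable_pi_apply (X := fun _ => κ → ℝ) i)

section GaussianBasics

variable {ι κ κ' : Type*} [Fintype ι] [Fintype κ] [Fintype κ']

theorem charFunDual_gaussVec [DecidableEq κ] (L : StrongDual ℝ (κ → ℝ)) :
    charFunDual (gaussVec κ) L = Complex.exp (-((∑ i, L (Pi.single i 1) ^ 2 : ℝ) : ℂ) / 2) := by
  rw [charFunDual_pi]
  have : ∀ i, charFunDual (gaussianReal 0 1) (L.comp (.single ℝ (fun _ => ℝ) i))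
      = Complex.exp (-((L (Pi.single i 1) ^ 2 : ℝ) : ℂ) / 2) := by
    intro i
    rw [charFunDual_eq_charFun_map_one, charFun_apply_real,
      integral_map (by fun_prop) (by fun_prop)]
    have h : ∀ x : ℝ, (L.comp (.single ℝ (fun _ => ℝ) i)) x = x * L (Pi.single i 1) := by
      intro x
      have : (Pi.single i x : κ → ℝ) = x • Pi.single i 1 := by
        rw [← Pi.single_smul]; simp
      simp [this]
    simp_rw [h]
    have := charFun_gaussianReal (μ := 0) (v := 1) (L (Pi.single i 1))
    rw [charFun_apply_real] at this
    simp only [Complex.ofReal_one, one_mul, Complex.ofReal_mul]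
    rw [show (fun x : ℝ => Complex.exp ((x : ℂ) * (L (Pi.single i 1) : ℂ) * Complex.I)) =
      fun x : ℝ => Complex.exp ((L (Pi.single i 1) : ℂ) * x * Complex.I) by
        ext x; ring_nf, this]
    congr 1
    push_cast
    simp
    ring
  simp_rw [this]
  rw [← Complex.exp_sum]
  congr 1
  push_cast
  rw [← Finset.sum_div, Finset.sum_neg_distrib]

theorem gaussVec_map_mulVec [DecidableEq κ'] (M : Matrix κ' κ ℝ) (hM : M * Mᵀ = 1) :
    (gaussVec κ).map (fun x => M *ᵥ x) = gaussVec κ' := by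
  classical
  apply Measure.ext_of_charFunDual
  ext L
  have hM' : (fun x => M *ᵥ x) = (M.mulVecLin.toContinuousLinearMap : (κ → ℝ) →L[ℝ] (κ' → ℝ)) := by
    ext x; simp
  rw [hM', charFunDual_map, charFunDual_gaussVec, charFunDual_gaussVec]
  congr 4
  have h1 : ∀ v : κ' → ℝ, L v = ∑ j, v j * L (Pi.single j 1) := by
    intro v
    conv_lhs => rw [← Finset.univ_sum_single v]
    rw [map_sum]
    refine Finset.sum_congr rfl fun j _ => ?_
    have : (Pi.single j (v j) : κ' → ℝ) = v j • Pi.single j 1 := by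
      rw [← Pi.single_smul]; simp
    rw [this, map_smul, smul_eq_mul]
  set c : κ' → ℝ := fun j => L (Pi.single j 1)
  have h2 : ∀ i, (L.comp M.mulVecLin.toContinuousLinearMap) (Pi.single i 1) = (c ᵥ* M) i := by
    intro i
    simp only [ContinuousLinearMap.comp_apply, LinearMap.coe_toContinuousLinearMap',
      Matrix.mulVecLin_apply, Matrix.mulVec_single_one]
    rw [h1]
    simp [Matrix.vecMul, dotProduct, c, mul_comm]
  simp_rw [h2]
  have h3 : (c ᵥ* M) ⬝ᵥ (c ᵥ* M) = c ⬝ᵥ c := by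
    rw [← Matrix.mulVec_transpose, Matrix.dotProduct_mulVec, Matrix.vecMul_mulVec,
      Matrix.transpose_transpose, hM, Matrix.vecMul_one]
  simpa [dotProduct, sq] using h3

theorem measurePreserving_curry_gaussVec :
    MeasurePreserving (fun x : ι × κ → ℝ => (Matrix.of fun i j => x (i, j)))
      (gaussVec (ι × κ)) (gaussMat ι κ) := by
  refine ⟨measurable_matrix_of fun i j => by simpa using measurable_pi_apply (i, j), ?_⟩
  have := Measure.infinitePi_map_curry (X := ℝ) (fun (_ : ι) (_ : κ) => gaussianReal 0 1)
  simp only [Measure.infinitePi_eq_pi] at this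
  exact this

/-- Left multiplication by a matrix with orthonormal rows preserves the Gaussian measure on
matrices. -/
theorem measurePreserving_mul_gaussMat {ι' : Type*} [Fintype ι'] [DecidableEq ι']
    (U : Matrix ι' ι ℝ) (hU : U * Uᵀ = 1) :
    MeasurePreserving (fun G : Matrix ι κ ℝ => U * G) (gaussMat ι κ) (gaussMat ι' κ) := by
  classical
  have hmeas : Measurable (fun G : Matrix ι κ ℝ => U * G) := by
    refine measurable_matrix_of fun i j => ?_
    simp only [Matrix.mul_apply]
    exact Finset.measurable_sum _ fun k _ => (measurable_matrix_entry _ _).const_mul _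
  refine ⟨hmeas, ?_⟩
  have hcm := (measurePreserving_curry_gaussVec (ι := ι) (κ := κ)).measurable
  conv_lhs => rw [← measurePreserving_curry_gaussVec.map_eq, Measure.map_map hmeas hcm]
  have hK : (Matrix.kroneckerMap (· * ·) U (1 : Matrix κ κ ℝ)) *
      (Matrix.kroneckerMap (· * ·) U (1 : Matrix κ κ ℝ))ᵀ = 1 := by
    rw [← Matrix.kroneckerMap_transpose, Matrix.transpose_one, ← Matrix.mul_kronecker_mul, hU]
    simp
  conv_rhs => rw [← measurePreserving_curry_gaussVec.map_eq, ← gaussVec_map_mulVec _ hK,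
    Measure.map_map measurePreserving_curry_gaussVec.measurable (by fun_prop)]
  congr 1
  ext x i j
  simp [Matrix.mul_apply, Matrix.mulVec, dotProduct, Fintype.sum_prod_type, Matrix.one_apply]

/-- Resampling one coordinate preserves the Gaussian measure. -/
theorem measurePreserving_update_gaussVec [DecidableEq κ] (a : κ) :
    MeasurePreserving (fun z : (κ → ℝ) × ℝ => Function.update z.1 a z.2)
      ((gaussVec κ).prod (gaussianReal 0 1)) (gaussVec κ) := by
  have hm : Measurable (fun z : (κ → ℝ) × ℝ => Function.update z.1 a z.2) := by
    refine measurable_pi_lambda _ fun i => ?_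
    by_cases h : i = a
    · subst h; simpa using measurable_snd
    · simp only [Function.update_of_ne h]; fun_prop
  refine ⟨hm, ?_⟩
  refine (Measure.pi_eq fun s hs => ?_).symm
  rw [Measure.map_apply hm (MeasurableSet.univ_pi hs)]
  have : (fun z : (κ → ℝ) × ℝ => Function.update z.1 a z.2) ⁻¹' (Set.univ.pi s)
      = (Set.univ.pi (Function.update s a Set.univ)) ×ˢ s a := by
    ext z
    simp only [Set.mem_preimage, Set.mem_pi, Set.mem_univ, true_implies, Set.mem_prod]
    constructor
    · intro h
      refine ⟨fun i => ?_, by simpa using h a⟩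
      by_cases hi : i = a
      · subst hi; simp
      · simpa [hi] using h i
    · rintro ⟨h, h'⟩ i
      by_cases hi : i = a
      · subst hi; simpa
      · simpa [hi] using h i
  rw [this, Measure.prod_prod, Measure.pi_pi, ← Finset.mul_prod_erase _ _ (Finset.mem_univ a),
    ← Finset.mul_prod_erase _ (fun i => gaussianReal 0 1 (s i)) (Finset.mem_univ a)]
  simp only [Function.update_self, measure_univ, one_mul]
  rw [mul_comm]
  congr 1
  refine Finset.prod_congr rfl fun i hi => ?_
  rw [Function.update_of_ne (Finset.ne_of_mem_erase hi)]

end GaussianBasics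

section Stein

theorem hasDerivAt_gaussianPDFReal_zero_one (x : ℝ) :
    HasDerivAt (gaussianPDFReal 0 1) (-(x * gaussianPDFReal 0 1 x)) x := by
  have h : gaussianPDFReal 0 1 = fun x : ℝ => (√(2 * Real.pi))⁻¹ * Real.exp (-x ^ 2 / 2) := by
    ext x; simp [gaussianPDFReal]
  rw [h]
  have := (((hasDerivAt_pow 2 x).neg.div_const 2).exp).const_mul (√(2 * Real.pi))⁻¹
  convert! this using 1
  simp
  ring

/-- Gaussian integration by parts in one variable. -/
theorem integral_id_mul_gaussianReal {f f' : ℝ → ℝ} (hf : ∀ x, HasDerivAt f (f' x) x)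
    (hf' : Measurable f') {C : ℝ} (hC : ∀ x, |f x| ≤ C) (hC' : ∀ x, |f' x| ≤ C) :
    ∫ x, x * f x ∂(gaussianReal 0 1) = ∫ x, f' x ∂(gaussianReal 0 1) := by
  have hfm : Measurable f :=
    (continuous_iff_continuousAt.2 fun x => (hf x).continuousAt).measurable
  rw [integral_gaussianReal_eq_integral_smul one_ne_zero,
    integral_gaussianReal_eq_integral_smul one_ne_zero]
  have hi : Integrable (fun x => x * gaussianPDFReal 0 1 x) := by
    have h1 : Integrable (fun x : ℝ => x) (gaussianReal 0 1) := IsGaussian.integrable_id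
    rw [gaussianReal_of_var_ne_zero _ one_ne_zero] at h1
    rw [integrable_withDensity_iff (measurable_gaussianPDF _ _)
      (by simp [gaussianPDF])] at h1
    simpa using h1
  have hb : ∀ {u v : ℝ → ℝ}, Measurable u → (∀ x, |u x| ≤ C) → Integrable v →
      Integrable (fun x => u x * v x) := by
    intro u v hu hub hv
    exact hv.bdd_mul hu.aestronglyMeasurable (Filter.Eventually.of_forall hub)
  have key := integral_mul_deriv_eq_deriv_mul_of_integrable (u := f) (v := gaussianPDFReal 0 1)
    (u' := f') (v' := fun x => -(x * gaussianPDFReal 0 1 x)) (fun x _ => hf x)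
    (fun x _ => hasDerivAt_gaussianPDFReal_zero_one x)
    (hb hfm hC hi.neg) (hb hf' hC' (integrable_gaussianPDFReal 0 1))
    (hb hfm hC (integrable_gaussianPDFReal 0 1))
  have e1 : ∀ x, gaussianPDFReal 0 1 x • (x * f x) = -(f x * -(x * gaussianPDFReal 0 1 x)) := by
    intro x; simp; ring
  have e2 : ∀ x, gaussianPDFReal 0 1 x • f' x = f' x * gaussianPDFReal 0 1 x := by
    intro x; simp; ring
  simp_rw [e1, e2]
  rw [integral_neg, key, neg_neg]

variable {κ : Type*} [Fintype κ]

theorem integrable_eval_gaussVec (a : κ) : Integrable (fun g : κ → ℝ => g a) (gaussVec κ) :=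
  integrable_eval (μ := fun _ : κ => gaussianReal 0 1) IsGaussian.integrable_id

/-- Gaussian integration by parts in one coordinate. -/
theorem integral_eval_mul_gaussVec [DecidableEq κ] {f f' : (κ → ℝ) → ℝ} (a : κ)
    (hf : ∀ g x, HasDerivAt (fun y => f (Function.update g a y)) (f' (Function.update g a x)) x)
    (hfm : Measurable f) (hfm' : Measurable f') {C : ℝ} (hC : ∀ x, |f x| ≤ C)
    (hC' : ∀ x, |f' x| ≤ C) :
    ∫ g, g a * f g ∂(gaussVec κ) = ∫ g, f' g ∂(gaussVec κ) := by
  have hu := measurePreserving_update_gaussVec (κ := κ) a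
  have i1 : Integrable (fun g => g a * f g) (gaussVec κ) := by
    have := (integrable_eval_gaussVec a).bdd_mul hfm.aestronglyMeasurable
      (Filter.Eventually.of_forall hC)
    simpa [mul_comm] using this
  have i2 : Integrable f' (gaussVec κ) :=
    (integrable_const C).mono' hfm'.aestronglyMeasurable (Filter.Eventually.of_forall hC')
  rw [← hu.map_eq] at i1 i2 ⊢
  rw [integral_map hu.measurable.aemeasurable i1.aestronglyMeasurable,
    integral_map hu.measurable.aemeasurable i2.aestronglyMeasurable]
  have i1' := i1.comp_measurable hu.measurable
  have i2' := i2.comp_measurable hu.measurable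
  simp only [Function.comp_def] at i1' i2'
  rw [integral_prod _ i1', integral_prod _ i2']
  congr 1
  ext g
  simp only [Function.update_self]
  exact integral_id_mul_gaussianReal (hf g)
    (hfm'.comp (measurable_update g)) (fun x => hC _) (fun x => hC' _)

end Stein

section Comparison

variable {ι κ : Type*} [Fintype ι] [Fintype κ]

/-- The smooth maximum `log ∑ exp xᵢ`. -/
noncomputable def logSumExp (x : ι → ℝ) : ℝ := Real.log (∑ i, Real.exp (x i))

/-- The softmax weights, i.e. the gradient of `logSumExp`. -/
noncomputable def softmax (x : ι → ℝ) (i : ι) : ℝ := Real.exp (x i) / ∑ j, Real.exp (x j)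

theorem measurable_softmax (i : ι) : Measurable fun x : ι → ℝ => softmax x i := by
  unfold softmax; fun_prop

theorem measurable_logSumExp : Measurable fun x : ι → ℝ => logSumExp x := by
  unfold logSumExp; fun_prop

variable [Nonempty ι]

theorem sum_exp_pos (x : ι → ℝ) : 0 < ∑ i, Real.exp (x i) :=
  Finset.sum_pos (fun _ _ => Real.exp_pos _) Finset.univ_nonempty

theorem softmax_nonneg (x : ι → ℝ) (i : ι) : 0 ≤ softmax x i :=
  div_nonneg (Real.exp_pos _).le (sum_exp_pos x).le

theorem sum_softmax (x : ι → ℝ) : ∑ i, softmax x i = 1 := by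
  simp only [softmax, ← Finset.sum_div]
  exact div_self (sum_exp_pos x).ne'

theorem softmax_le_one (x : ι → ℝ) (i : ι) : softmax x i ≤ 1 := by
  rw [← sum_softmax x]
  exact Finset.single_le_sum (fun j _ => softmax_nonneg x j) (Finset.mem_univ i)

theorem le_logSumExp (x : ι → ℝ) (i : ι) : x i ≤ logSumExp x := by
  rw [logSumExp, Real.le_log_iff_exp_le (sum_exp_pos x)]
  exact Finset.single_le_sum (f := fun i => Real.exp (x i)) (fun j _ => (Real.exp_pos _).le)
    (Finset.mem_univ i)

theorem logSumExp_le {x : ι → ℝ} {c : ℝ} (h : ∀ i, x i ≤ c) :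
    logSumExp x ≤ c + Real.log (Fintype.card ι) := by
  rw [logSumExp, Real.log_le_iff_le_exp (sum_exp_pos x), Real.exp_add,
    Real.exp_log (by exact_mod_cast Fintype.card_pos)]
  calc ∑ i, Real.exp (x i) ≤ ∑ _i : ι, Real.exp c :=
        Finset.sum_le_sum fun i _ => Real.exp_le_exp.2 (h i)
    _ = _ := by simp [mul_comm]

theorem hasDerivAt_logSumExp {x : ℝ → ι → ℝ} {x' : ι → ℝ} {t : ℝ}
    (h : ∀ i, HasDerivAt (fun s => x s i) (x' i) t) :
    HasDerivAt (fun s => logSumExp (x s)) (∑ i, softmax (x t) i * x' i) t := by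
  have h1 := (HasDerivAt.fun_sum (u := Finset.univ) fun i _ => (h i).exp).log (sum_exp_pos _).ne'
  convert! h1 using 1
  simp only [softmax, Finset.sum_div]
  exact Finset.sum_congr rfl fun i _ => by ring

theorem hasDerivAt_softmax {x : ℝ → ι → ℝ} {x' : ι → ℝ} {t : ℝ}
    (h : ∀ i, HasDerivAt (fun s => x s i) (x' i) t) (i : ι) :
    HasDerivAt (fun s => softmax (x s) i)
      (softmax (x t) i * (x' i - ∑ j, softmax (x t) j * x' j)) t := by
  have h1 := (h i).exp.div (HasDerivAt.fun_sum (u := Finset.univ) fun i _ => (h i).exp)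
    (sum_exp_pos (x t)).ne'
  convert! h1 using 1
  have hp := (sum_exp_pos (x t)).ne'
  simp only [softmax]
  have e : ∑ j, Real.exp (x t j) / (∑ j, Real.exp (x t j)) * x' j =
      (∑ j, Real.exp (x t j) * x' j) / ∑ j, Real.exp (x t j) := by
    rw [Finset.sum_div]; exact Finset.sum_congr rfl fun i _ => by ring
  rw [e]
  field_simp

theorem abs_logSumExp_le (x : ι → ℝ) :
    |logSumExp x| ≤ ∑ i, |x i| + Real.log (Fintype.card ι) := by
  have hc : 0 ≤ Real.log (Fintype.card ι) := Real.log_natCast_nonneg _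
  have hle : ∀ i, |x i| ≤ ∑ i, |x i| := fun i =>
    Finset.single_le_sum (f := fun i => |x i|) (fun j _ => abs_nonneg _) (Finset.mem_univ i)
  rw [abs_le]
  constructor
  · obtain ⟨i⟩ := ‹Nonempty ι›
    have h1 := le_logSumExp x i
    have h2 := hle i
    have h3 := neg_abs_le (x i)
    linarith
  · exact logSumExp_le fun i => (le_abs_self _).trans (hle i)

theorem integrable_logSumExp_mulVec (L : Matrix ι κ ℝ) :
    Integrable (fun g => logSumExp (L *ᵥ g)) (gaussVec κ) := by
  have hm : Measurable fun g : κ → ℝ => L *ᵥ g := by fun_prop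
  refine Integrable.mono' (g := fun g => ∑ i, ∑ a, |L i a| * |g a| + Real.log (Fintype.card ι)) ?_
    (measurable_logSumExp.comp hm).aestronglyMeasurable ?_
  · refine Integrable.add ?_ (integrable_const _)
    exact integrable_finsetSum _ fun i _ => integrable_finsetSum _ fun a _ =>
      (integrable_eval_gaussVec a).abs.const_mul _
  · refine Filter.Eventually.of_forall fun g => (abs_logSumExp_le _).trans ?_
    gcongr with i
    simp only [mulVec, dotProduct, ← abs_mul]
    exact Finset.abs_sum_le_sum_abs _ _

/-- Derivative of the expected smooth maximum along a path, after integration by parts. -/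
theorem integral_softmax_mul_eq (L L' : Matrix ι κ ℝ) :
    ∫ g, ∑ i, softmax (L *ᵥ g) i * (L' *ᵥ g) i ∂(gaussVec κ) =
      ∫ g, (1 / 2) * ∑ i, ∑ j, softmax (L *ᵥ g) i * softmax (L *ᵥ g) j *
        ∑ a, (L i a - L j a) * (L' i a - L' j a) ∂(gaussVec κ) := by
  classical
  have hm : Measurable fun g : κ → ℝ => L *ᵥ g := by fun_prop
  have hsm : ∀ i, Measurable fun g : κ → ℝ => softmax (L *ᵥ g) i :=
    fun i => (measurable_softmax i).comp hm
  set D : ι → κ → (κ → ℝ) → ℝ := fun i a g =>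
    softmax (L *ᵥ g) i * (L i a - ∑ j, softmax (L *ᵥ g) j * L j a) with hD
  have hDm : ∀ i a, Measurable (D i a) := fun i a => by
    simp only [hD]
    exact (hsm i).mul (measurable_const.sub
      (Finset.measurable_sum _ fun j _ => (hsm j).mul_const _))
  have habs : ∀ g i, |softmax (L *ᵥ g) i| ≤ 1 := fun g i => by
    rw [abs_of_nonneg (softmax_nonneg _ _)]; exact softmax_le_one _ _
  have hDb : ∀ i a g, |D i a g| ≤ |L i a| + ∑ j, |L j a| := fun i a g => by
    simp only [hD, abs_mul]
    refine (mul_le_of_le_one_left (abs_nonneg _) (habs g i)).trans ?_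
    refine (abs_sub _ _).trans ?_
    gcongr
    refine (Finset.abs_sum_le_sum_abs _ _).trans (Finset.sum_le_sum fun j _ => ?_)
    rw [abs_mul]
    exact mul_le_of_le_one_left (abs_nonneg _) (habs g j)
  have hDi : ∀ i a, Integrable (D i a) (gaussVec κ) := fun i a =>
    (integrable_const _).mono' (hDm i a).aestronglyMeasurable
      (Filter.Eventually.of_forall (hDb i a))
  have stein : ∀ i a, ∫ g, g a * softmax (L *ᵥ g) i ∂(gaussVec κ) =
      ∫ g, D i a g ∂(gaussVec κ) := by
    intro i a
    refine integral_eval_mul_gaussVec (C := 1 + (|L i a| + ∑ j, |L j a|)) a ?_ (hsm i)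
      (hDm i a) (fun g => (habs g i).trans ?_) (fun g => (hDb i a g).trans (by linarith))
    · intro g x
      have hd : ∀ j, HasDerivAt (fun s => (L *ᵥ Function.update g a s) j) (L j a) x := by
        intro j
        have h1 : ∀ s, (L *ᵥ Function.update g a s) j = L j a * s + ∑ b ∈ Finset.univ.erase a,
            L j b * g b := by
          intro s
          simp only [mulVec, dotProduct]
          rw [← Finset.add_sum_erase _ _ (Finset.mem_univ a)]
          simp only [Function.update_self]
          congr 1
          exact Finset.sum_congr rfl fun b hb => by
            rw [Function.update_of_ne (Finset.ne_of_mem_erase hb)]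
        simp only [h1]
        simpa using ((hasDerivAt_id x).const_mul (L j a)).add_const
          (∑ b ∈ Finset.univ.erase a, L j b * g b)
      exact hasDerivAt_softmax hd i
    · have : 0 ≤ ∑ j, |L j a| := Finset.sum_nonneg fun _ _ => abs_nonneg _
      have := abs_nonneg (L i a)
      linarith
  have hgi : ∀ i a, Integrable (fun g => g a * softmax (L *ᵥ g) i) (gaussVec κ) := fun i a => by
    have := (integrable_eval_gaussVec a).bdd_mul (hsm i).aestronglyMeasurable
      (Filter.Eventually.of_forall fun g => habs g i)
    simpa [mul_comm] using this
  have lhs : ∀ g, ∑ i, softmax (L *ᵥ g) i * (L' *ᵥ g) i =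
      ∑ i, ∑ a, L' i a * (g a * softmax (L *ᵥ g) i) := by
    intro g
    refine Finset.sum_congr rfl fun i _ => ?_
    simp only [mulVec, dotProduct, Finset.mul_sum]
    exact Finset.sum_congr rfl fun a _ => by ring
  have step : ∀ i, ∫ g, ∑ a, L' i a * (g a * softmax (L *ᵥ g) i) ∂(gaussVec κ) =
      ∫ g, ∑ a, L' i a * D i a g ∂(gaussVec κ) := by
    intro i
    rw [integral_finsetSum _ fun a _ => (hgi i a).const_mul _,
      integral_finsetSum _ fun a _ => (hDi i a).const_mul _]
    exact Finset.sum_congr rfl fun a _ => by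
      rw [integral_const_mul, integral_const_mul, stein]
  have key : ∫ g, ∑ i, softmax (L *ᵥ g) i * (L' *ᵥ g) i ∂(gaussVec κ) =
      ∫ g, ∑ i, ∑ a, L' i a * D i a g ∂(gaussVec κ) := by
    rw [integral_congr_ae (Filter.Eventually.of_forall lhs),
      integral_finsetSum _ fun i _ => integrable_finsetSum _ fun a _ =>
        (hgi i a).const_mul (L' i a),
      integral_finsetSum _ fun i _ => integrable_finsetSum _ fun a _ =>
        (hDi i a).const_mul (L' i a)]
    exact Finset.sum_congr rfl fun i _ => step i
  rw [key]
  congr 1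
  ext g
  set p := softmax (L *ᵥ g) with hp
  have hp1 : ∑ i, p i = 1 := sum_softmax _
  have e1 : ∑ i, ∑ a, L' i a * D i a g =
      ∑ i, ∑ j, ∑ a, p i * p j * (L' i a * L i a - L' i a * L j a) := by
    refine Finset.sum_congr rfl fun i _ => ?_
    rw [Finset.sum_comm]
    refine Finset.sum_congr rfl fun a _ => ?_
    simp only [hD, ← hp]
    calc L' i a * (p i * (L i a - ∑ j, p j * L j a))
        = L' i a * (p i * ((∑ j, p j) * L i a - ∑ j, p j * L j a)) := by rw [hp1, one_mul]
      _ = _ := by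
        rw [Finset.sum_mul, ← Finset.sum_sub_distrib, Finset.mul_sum, Finset.mul_sum]
        exact Finset.sum_congr rfl fun j _ => by ring
  have e2 : ∑ i, ∑ j, ∑ a, p i * p j * (L' i a * L i a - L' i a * L j a) =
      ∑ i, ∑ j, ∑ a, p i * p j * (L' j a * L j a - L' j a * L i a) := by
    rw [Finset.sum_comm]
    refine Finset.sum_congr rfl fun i _ => Finset.sum_congr rfl fun j _ =>
      Finset.sum_congr rfl fun a _ => by ring
  have e3 : ∑ i, ∑ j, p i * p j * ∑ a, (L i a - L j a) * (L' i a - L' j a) =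
      ∑ i, ∑ j, ∑ a, p i * p j * (L' i a * L i a - L' i a * L j a) +
      ∑ i, ∑ j, ∑ a, p i * p j * (L' j a * L j a - L' j a * L i a) := by
    simp_rw [← Finset.sum_add_distrib, Finset.mul_sum]
    refine Finset.sum_congr rfl fun i _ => Finset.sum_congr rfl fun j _ =>
      Finset.sum_congr rfl fun a _ => by ring
  rw [e3, ← e2, e1]
  ring

/-- Sudakov–Fernique comparison for the smooth maximum, for two Gaussian families
that are independent of each other. -/
theorem integral_logSumExp_mono_of_orthogonal (L M : Matrix ι κ ℝ) (horth : L * Mᵀ = 0)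
    (h : ∀ i j, ∑ a, (L i a - L j a) ^ 2 ≤ ∑ a, (M i a - M j a) ^ 2) :
    ∫ g, logSumExp (L *ᵥ g) ∂(gaussVec κ) ≤ ∫ g, logSumExp (M *ᵥ g) ∂(gaussVec κ) := by
  set N : ℝ → Matrix ι κ ℝ := fun θ => Real.cos θ • L + Real.sin θ • M with hN
  set N' : ℝ → Matrix ι κ ℝ := fun θ => -Real.sin θ • L + Real.cos θ • M with hN'
  have hNapp : ∀ θ g i, (N θ *ᵥ g) i = Real.cos θ * (L *ᵥ g) i + Real.sin θ * (M *ᵥ g) i := by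
    intro θ g i; simp [hN, Matrix.add_mulVec, Matrix.smul_mulVec]
  have hN'app : ∀ θ g i, (N' θ *ᵥ g) i = -Real.sin θ * (L *ᵥ g) i + Real.cos θ * (M *ᵥ g) i := by
    intro θ g i; simp [hN', Matrix.add_mulVec, Matrix.smul_mulVec, Matrix.neg_mulVec]
  have hderiv : ∀ θ, HasDerivAt (fun t => ∫ g, logSumExp (N t *ᵥ g) ∂(gaussVec κ))
      (∫ g, ∑ i, softmax (N θ *ᵥ g) i * (N' θ *ᵥ g) i ∂(gaussVec κ)) θ := by
    intro θ
    have hmV : ∀ A : Matrix ι κ ℝ, Measurable fun g : κ → ℝ => A *ᵥ g := fun A => by fun_prop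
    refine (hasDerivAt_integral_of_dominated_loc_of_deriv_le (s := Set.univ)
      (bound := fun g => ∑ i, (|(L *ᵥ g) i| + |(M *ᵥ g) i|)) Filter.univ_mem
      (F' := fun t g => ∑ i, softmax (N t *ᵥ g) i * (N' t *ᵥ g) i)
      ?_ ?_ ?_ ?_ ?_ ?_).2
    · exact Filter.Eventually.of_forall fun t =>
        (integrable_logSumExp_mulVec (N t)).aestronglyMeasurable
    · exact integrable_logSumExp_mulVec (N θ)
    · refine (Finset.measurable_sum _ fun i _ => ?_).aestronglyMeasurable
      exact ((measurable_softmax i).comp (hmV _)).mul ((measurable_pi_apply i).comp (hmV _))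
    · refine Filter.Eventually.of_forall fun g t _ => ?_
      rw [Real.norm_eq_abs]
      refine (Finset.abs_sum_le_sum_abs _ _).trans ?_
      gcongr with i
      rw [abs_mul, abs_of_nonneg (softmax_nonneg _ _)]
      refine (mul_le_of_le_one_left (abs_nonneg _) (softmax_le_one _ _)).trans ?_
      rw [hN'app]
      refine (abs_add_le _ _).trans ?_
      rw [abs_mul, abs_mul, abs_neg]
      gcongr
      · exact mul_le_of_le_one_left (abs_nonneg _) (Real.abs_sin_le_one t)
      · exact mul_le_of_le_one_left (abs_nonneg _) (Real.abs_cos_le_one t)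
    · have hlin : ∀ (A : Matrix ι κ ℝ) i, Integrable (fun g => (A *ᵥ g) i) (gaussVec κ) := by
        intro A i
        simp only [mulVec, dotProduct]
        exact integrable_finsetSum _ fun a _ => (integrable_eval_gaussVec a).const_mul _
      exact integrable_finsetSum _ fun i _ => (hlin L i).abs.add (hlin M i).abs
    · refine Filter.Eventually.of_forall fun g t _ => hasDerivAt_logSumExp fun i => ?_
      simp only [hNapp, hN'app]
      exact ((Real.hasDerivAt_cos t).mul_const _).add ((Real.hasDerivAt_sin t).mul_const _)
  have hmono : MonotoneOn (fun t => ∫ g, logSumExp (N t *ᵥ g) ∂(gaussVec κ))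
      (Set.Icc 0 (Real.pi / 2)) := by
    refine monotoneOn_of_deriv_nonneg (convex_Icc _ _)
      (fun t _ => (hderiv t).continuousAt.continuousWithinAt)
      (fun t _ => (hderiv t).differentiableAt.differentiableWithinAt) ?_
    intro t ht
    rw [interior_Icc] at ht
    rw [(hderiv t).deriv, integral_softmax_mul_eq]
    refine integral_nonneg fun g => ?_
    refine mul_nonneg (by norm_num) (Finset.sum_nonneg fun i _ => Finset.sum_nonneg fun j _ =>
      mul_nonneg (mul_nonneg (softmax_nonneg _ _) (softmax_nonneg _ _)) ?_)
    have ho : ∀ i j, ∑ a, L i a * M j a = 0 := fun i j => by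
      have := congrFun (congrFun horth i) j
      simpa [Matrix.mul_apply] using this
    have e : ∑ a, (N t i a - N t j a) * (N' t i a - N' t j a) =
        Real.cos t * Real.sin t *
          (∑ a, (M i a - M j a) ^ 2 - ∑ a, (L i a - L j a) ^ 2) +
        (Real.cos t ^ 2 - Real.sin t ^ 2) * (∑ a, L i a * M i a - ∑ a, L i a * M j a
          - ∑ a, L j a * M i a + ∑ a, L j a * M j a) := by
      simp only [← Finset.sum_sub_distrib, ← Finset.sum_add_distrib, Finset.mul_sum]
      refine Finset.sum_congr rfl fun a _ => ?_
      simp only [hN, hN', Matrix.add_apply, Matrix.smul_apply, smul_eq_mul]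
      ring
    rw [e]
    simp only [ho, sub_zero, add_zero, mul_zero]
    have hc := Real.cos_pos_of_mem_Ioo ⟨by linarith [ht.1, Real.pi_pos], ht.2⟩
    have hs := Real.sin_pos_of_pos_of_lt_pi ht.1 (by linarith [ht.2, Real.pi_pos])
    exact mul_nonneg (mul_nonneg hc.le hs.le) (sub_nonneg.2 (h i j))
  have := hmono (Set.left_mem_Icc.2 (by positivity)) (Set.right_mem_Icc.2 (by positivity))
    (by positivity)
  simpa [hN] using this

end Comparison

section EuclideanNorm

variable {ι κ : Type*} [Fintype ι] [Fintype κ]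

/-- The Euclidean norm of a vector given as a plain function. -/
noncomputable def euclNorm (x : κ → ℝ) : ℝ := ‖WithLp.toLp 2 x‖

theorem euclNorm_nonneg (x : κ → ℝ) : 0 ≤ euclNorm x := norm_nonneg _

theorem euclNorm_sq (x : κ → ℝ) : euclNorm x ^ 2 = x ⬝ᵥ x := by
  rw [euclNorm, EuclideanSpace.norm_sq_eq]
  simp [dotProduct, sq]

theorem euclNorm_eq_sqrt (x : κ → ℝ) : euclNorm x = √(x ⬝ᵥ x) := by
  rw [← euclNorm_sq, Real.sqrt_sq (euclNorm_nonneg x)]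

theorem euclNorm_smul (c : ℝ) (x : κ → ℝ) : euclNorm (c • x) = |c| * euclNorm x := by
  simp [euclNorm, WithLp.toLp_smul, norm_smul]

theorem euclNorm_neg (x : κ → ℝ) : euclNorm (-x) = euclNorm x := by
  simp [euclNorm, WithLp.toLp_neg]

theorem euclNorm_zero : euclNorm (0 : κ → ℝ) = 0 := by simp [euclNorm]

theorem euclNorm_eq_zero {x : κ → ℝ} : euclNorm x = 0 ↔ x = 0 := by
  simp [euclNorm]

theorem euclNorm_add_le (x y : κ → ℝ) : euclNorm (x + y) ≤ euclNorm x + euclNorm y := by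
  simpa [euclNorm, WithLp.toLp_add] using norm_add_le (WithLp.toLp 2 x) (WithLp.toLp 2 y)

theorem dotProduct_le_euclNorm_mul (x y : κ → ℝ) : x ⬝ᵥ y ≤ euclNorm x * euclNorm y := by
  have := real_inner_le_norm (WithLp.toLp 2 y) (WithLp.toLp 2 x)
  rw [EuclideanSpace.inner_toLp_toLp] at this
  simpa [euclNorm, mul_comm] using this

theorem continuous_euclNorm : Continuous fun x : κ → ℝ => euclNorm x := by
  unfold euclNorm; fun_prop

theorem euclNorm_mulVec_le [DecidableEq κ] (M : Matrix ι κ ℝ) (x : κ → ℝ) :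
    euclNorm (M *ᵥ x) ≤ ‖M‖ * euclNorm x :=
  l2_opNorm_mulVec M (WithLp.toLp 2 x)

theorem opNorm_transpose [DecidableEq κ] [DecidableEq ι] (M : Matrix ι κ ℝ) : ‖Mᵀ‖ = ‖M‖ := by
  rw [← conjTranspose_eq_transpose_of_trivial, l2_opNorm_conjTranspose]

theorem opNorm_le_of_euclNorm [DecidableEq κ] {M : Matrix ι κ ℝ} {c : ℝ} (hc : 0 ≤ c)
    (h : ∀ x, euclNorm (M *ᵥ x) ≤ c * euclNorm x) : ‖M‖ ≤ c := by
  rw [l2_opNorm_def]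
  exact ContinuousLinearMap.opNorm_le_bound _ hc fun x => h x

theorem opNorm_le_of_dotProduct [DecidableEq κ] {M : Matrix ι κ ℝ} {c : ℝ}
    (h : ∀ x y, euclNorm x ≤ 1 → euclNorm y ≤ 1 → x ⬝ᵥ M *ᵥ y ≤ c) : ‖M‖ ≤ c := by
  have hc : 0 ≤ c := by simpa using h 0 0 (by simp [euclNorm_zero]) (by simp [euclNorm_zero])
  refine opNorm_le_of_euclNorm hc fun x => ?_
  rcases (euclNorm_nonneg (M *ᵥ x)).eq_or_lt with h0 | h0
  · rw [← h0]; exact mul_nonneg hc (euclNorm_nonneg _)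
  rcases (euclNorm_nonneg x).eq_or_lt with h1 | h1
  · rw [euclNorm_eq_zero.1 h1.symm] at h0
    simp [euclNorm_zero] at h0
  have := h ((euclNorm (M *ᵥ x))⁻¹ • (M *ᵥ x)) ((euclNorm x)⁻¹ • x)
    (by rw [euclNorm_smul, abs_of_pos (inv_pos.2 h0), inv_mul_cancel₀ h0.ne'])
    (by rw [euclNorm_smul, abs_of_pos (inv_pos.2 h1), inv_mul_cancel₀ h1.ne'])
  rw [mulVec_smul, smul_dotProduct, dotProduct_smul, ← euclNorm_sq, smul_eq_mul,
    smul_eq_mul] at this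
  field_simp at this
  linarith

theorem exists_finset_net (κ : Type*) [Fintype κ] {ε : ℝ} (hε : 0 < ε) :
    ∃ F : Finset (κ → ℝ), F.Nonempty ∧ (∀ x ∈ F, euclNorm x ≤ 1) ∧
      ∀ x, euclNorm x ≤ 1 → ∃ y ∈ F, euclNorm (x - y) ≤ ε := by
  classical
  obtain ⟨t, hts, htf, ht⟩ :=
    (isCompact_closedBall (0 : EuclideanSpace ℝ κ) 1).finite_cover_balls hε
  refine ⟨htf.toFinset.image WithLp.ofLp, ?_, ?_, ?_⟩
  · have h0 := ht (Metric.mem_closedBall_self zero_le_one)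
    simp only [Set.mem_iUnion] at h0
    obtain ⟨y, hy, -⟩ := h0
    exact ⟨_, Finset.mem_image_of_mem _ (htf.mem_toFinset.2 hy)⟩
  · intro x hx
    obtain ⟨y, hy, rfl⟩ := Finset.mem_image.1 hx
    simpa [euclNorm] using hts (htf.mem_toFinset.1 hy)
  · intro x hx
    have h0 := ht (show WithLp.toLp 2 x ∈ Metric.closedBall 0 1 by simpa [euclNorm] using hx)
    simp only [Set.mem_iUnion] at h0
    obtain ⟨y, hy, hxy⟩ := h0
    refine ⟨_, Finset.mem_image_of_mem _ (htf.mem_toFinset.2 hy), ?_⟩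
    rw [Metric.mem_ball, dist_eq_norm] at hxy
    exact hxy.le

theorem measurable_opNorm [DecidableEq κ] : Measurable fun M : Matrix ι κ ℝ => ‖M‖ := by
  have : Continuous fun M : Matrix ι κ ℝ => ‖M‖ := continuous_norm
  exact this.measurable

/-- The squared Frobenius norm. -/
def frobSq (M : Matrix ι κ ℝ) : ℝ := ∑ i, ∑ j, M i j ^ 2

theorem frobSq_nonneg (M : Matrix ι κ ℝ) : 0 ≤ frobSq M :=
  Finset.sum_nonneg fun _ _ => Finset.sum_nonneg fun _ _ => sq_nonneg _

theorem frobSq_transpose (M : Matrix ι κ ℝ) : frobSq Mᵀ = frobSq M := Finset.sum_comm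

theorem opNorm_le_sqrt_frobSq [DecidableEq κ] (M : Matrix ι κ ℝ) : ‖M‖ ≤ √(frobSq M) := by
  refine opNorm_le_of_euclNorm (Real.sqrt_nonneg _) fun x => ?_
  rw [euclNorm_eq_sqrt, euclNorm_eq_sqrt, ← Real.sqrt_mul (frobSq_nonneg M)]
  refine Real.sqrt_le_sqrt ?_
  rw [frobSq, Finset.sum_mul]
  refine Finset.sum_le_sum fun i _ => ?_
  rw [← sq]
  simpa [mulVec, dotProduct, sq] using Finset.sum_mul_sq_le_sq_mul_sq Finset.univ (M i) x

end EuclideanNorm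

section GaussianLinear

variable {ι κ κ' : Type*} [Fintype ι] [Fintype κ] [Fintype κ']

theorem measurable_dotProduct_left (w : κ → ℝ) : Measurable fun g : κ → ℝ => w ⬝ᵥ g :=
  Finset.measurable_sum _ fun i _ => (measurable_pi_apply i).const_mul _

theorem map_dotProduct_gaussVec (w : κ → ℝ) :
    (gaussVec κ).map (fun g => w ⬝ᵥ g) = (gaussianReal 0 1).map (fun x => euclNorm w * x) := by
  rcases eq_or_ne w 0 with rfl | hw
  · simp [euclNorm_zero, Measure.map_const]
  have hc : 0 < euclNorm w := (euclNorm_nonneg w).lt_of_ne' fun h => hw (euclNorm_eq_zero.1 h)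
  set U : Matrix Unit κ ℝ := Matrix.of fun _ j => (euclNorm w)⁻¹ * w j with hU
  have hUU : U * Uᵀ = 1 := by
    ext i j
    have : ∑ x, (euclNorm w)⁻¹ * w x * ((euclNorm w)⁻¹ * w x) =
        ((euclNorm w) ^ 2)⁻¹ * (w ⬝ᵥ w) := by
      rw [dotProduct, Finset.mul_sum]; exact Finset.sum_congr rfl fun x _ => by ring
    simp only [hU, Matrix.mul_apply, Matrix.transpose_apply, Matrix.of_apply, this]
    rw [← euclNorm_sq, inv_mul_cancel₀ (pow_pos hc 2).ne']
    simp
  have h1 := gaussVec_map_mulVec U hUU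
  have h2 : (gaussVec Unit).map (fun x => x ()) = gaussianReal 0 1 :=
    (measurePreserving_eval (fun _ : Unit => gaussianReal 0 1) ()).map_eq
  rw [← h2, ← h1, Measure.map_map (by fun_prop) (by fun_prop),
    Measure.map_map (by fun_prop) (by fun_prop)]
  congr 1
  ext g
  simp only [Function.comp_apply, hU, mulVec, dotProduct, Matrix.of_apply, Finset.mul_sum]
  exact Finset.sum_congr rfl fun j _ => by field_simp

theorem measurePreserving_comp_gaussVec {f : κ' → κ} (hf : Function.Injective f) :
    MeasurePreserving (fun g => g ∘ f) (gaussVec κ) (gaussVec κ') := by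
  classical
  have hM := gaussVec_map_mulVec (Matrix.of fun i j => if f i = j then 1 else 0 : Matrix κ' κ ℝ)
    (by ext i j; simp [Matrix.mul_apply, Matrix.one_apply, hf.eq_iff])
  have : (fun x : κ → ℝ => (Matrix.of fun i j => if f i = j then 1 else 0 : Matrix κ' κ ℝ) *ᵥ x)
      = fun g => g ∘ f := by
    ext x i; simp [mulVec, dotProduct]
  rw [this] at hM
  exact ⟨by fun_prop, hM⟩

theorem integrable_sq_gaussianReal : Integrable (fun x : ℝ => x ^ 2) (gaussianReal 0 1) :=
  (memLp_id_gaussianReal (μ := 0) (v := 1) 2).integrable_sq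

theorem integral_sq_gaussianReal : ∫ x, x ^ 2 ∂(gaussianReal 0 1) = 1 := by
  have := variance_fun_id_gaussianReal (μ := 0) (v := 1)
  rwa [variance_of_integral_eq_zero (by fun_prop) (by simp)] at this

theorem integrable_dotProduct_sq_gaussVec (w : κ → ℝ) :
    Integrable (fun g => (w ⬝ᵥ g) ^ 2) (gaussVec κ) := by
  have hm : AEMeasurable (fun g : κ → ℝ => w ⬝ᵥ g) (gaussVec κ) :=
    (measurable_dotProduct_left w).aemeasurable
  have h : Integrable (fun x : ℝ => x ^ 2) ((gaussVec κ).map (fun g => w ⬝ᵥ g)) := by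
    rw [map_dotProduct_gaussVec, integrable_map_measure (by fun_prop) (by fun_prop)]
    simp only [Function.comp_def, mul_pow]
    exact integrable_sq_gaussianReal.const_mul _
  exact h.comp_aemeasurable hm

theorem integral_dotProduct_sq_gaussVec (w : κ → ℝ) :
    ∫ g, (w ⬝ᵥ g) ^ 2 ∂(gaussVec κ) = ∑ i, w i ^ 2 := by
  have hm : AEMeasurable (fun g : κ → ℝ => w ⬝ᵥ g) (gaussVec κ) :=
    (measurable_dotProduct_left w).aemeasurable
  rw [← integral_map (f := fun x : ℝ => x ^ 2) hm (by fun_prop), map_dotProduct_gaussVec,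
    integral_map (by fun_prop) (by fun_prop)]
  simp only [mul_pow]
  rw [integral_const_mul, integral_sq_gaussianReal, mul_one, euclNorm_sq]
  simp [dotProduct, sq]

theorem integrable_euclNorm_sq_mulVec (M : Matrix ι κ ℝ) :
    Integrable (fun g => euclNorm (M *ᵥ g) ^ 2) (gaussVec κ) := by
  have e : ∀ g, euclNorm (M *ᵥ g) ^ 2 = ∑ i, (M i ⬝ᵥ g) ^ 2 := fun g => by
    rw [euclNorm_sq]; simp [dotProduct, mulVec, sq]
  simp only [e]
  exact integrable_finsetSum _ fun i _ => integrable_dotProduct_sq_gaussVec (M i)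

theorem integral_euclNorm_sq_mulVec (M : Matrix ι κ ℝ) :
    ∫ g, euclNorm (M *ᵥ g) ^ 2 ∂(gaussVec κ) = frobSq M := by
  have e : ∀ g, euclNorm (M *ᵥ g) ^ 2 = ∑ i, (M i ⬝ᵥ g) ^ 2 := fun g => by
    rw [euclNorm_sq]; simp [dotProduct, mulVec, sq]
  simp only [e]
  rw [integral_finsetSum _ fun i _ => integrable_dotProduct_sq_gaussVec (M i)]
  simp [integral_dotProduct_sq_gaussVec, frobSq]

theorem measurable_mulVec (M : Matrix ι κ ℝ) : Measurable fun g : κ → ℝ => M *ᵥ g := by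
  fun_prop

theorem integrable_euclNorm_mulVec (M : Matrix ι κ ℝ) :
    Integrable (fun g => euclNorm (M *ᵥ g)) (gaussVec κ) := by
  refine Integrable.mono' (g := fun g => (1 + euclNorm (M *ᵥ g) ^ 2) / 2)
    (((integrable_const _).add (integrable_euclNorm_sq_mulVec M)).div_const 2)
    (continuous_euclNorm.measurable.comp (measurable_mulVec M)).aestronglyMeasurable
    (Filter.Eventually.of_forall fun g => ?_)
  rw [Real.norm_eq_abs, abs_of_nonneg (euclNorm_nonneg _)]
  nlinarith [sq_nonneg (euclNorm (M *ᵥ g) - 1)]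

theorem integral_euclNorm_mulVec_le (M : Matrix ι κ ℝ) :
    ∫ g, euclNorm (M *ᵥ g) ∂(gaussVec κ) ≤ √(frobSq M) := by
  have h := variance_nonneg (fun g => euclNorm (M *ᵥ g)) (gaussVec κ)
  rw [variance_eq_sub ((memLp_two_iff_integrable_sq
    (integrable_euclNorm_mulVec M).aestronglyMeasurable).2 (integrable_euclNorm_sq_mulVec M))] at h
  refine Real.le_sqrt_of_sq_le ?_
  have e := integral_euclNorm_sq_mulVec M
  simp only [Pi.pow_apply] at h
  linarith

end GaussianLinear

section Chevet

variable {ι κ ν ρ : Type*} [Fintype ι] [Fintype κ] [Fintype ν] [Fintype ρ]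

theorem opNorm_mul_le_of_net [DecidableEq κ] {ε c : ℝ} (hε : 0 ≤ ε) {F₁ : Finset (ι → ℝ)}
    {F₂ : Finset (κ → ℝ)}
    (hF₁ : ∀ x, euclNorm x ≤ 1 → ∃ y ∈ F₁, euclNorm (x - y) ≤ ε)
    (hF₂ : ∀ x, euclNorm x ≤ 1 → ∃ y ∈ F₂, euclNorm (x - y) ≤ ε)
    (hF₁' : ∀ x ∈ F₁, euclNorm x ≤ 1) {M : Matrix ι κ ℝ}
    (h : ∀ x ∈ F₁, ∀ y ∈ F₂, x ⬝ᵥ M *ᵥ y ≤ c) : (1 - 2 * ε) * ‖M‖ ≤ c := by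
  suffices ‖M‖ ≤ c + 2 * ε * ‖M‖ by linarith
  refine opNorm_le_of_dotProduct fun x y hx hy => ?_
  obtain ⟨x', hx', hxx⟩ := hF₁ x hx
  obtain ⟨y', hy', hyy⟩ := hF₂ y hy
  have e : x ⬝ᵥ M *ᵥ y = x' ⬝ᵥ M *ᵥ y' + (x - x') ⬝ᵥ M *ᵥ y + x' ⬝ᵥ M *ᵥ (y - y') := by
    simp only [sub_dotProduct, mulVec_sub, dotProduct_sub]; ring
  have h1 : (x - x') ⬝ᵥ M *ᵥ y ≤ ε * ‖M‖ := by
    refine (dotProduct_le_euclNorm_mul _ _).trans ?_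
    have := euclNorm_mulVec_le M y
    have h3 := euclNorm_nonneg (M *ᵥ y)
    have : euclNorm (M *ᵥ y) ≤ ‖M‖ :=
      this.trans (mul_le_of_le_one_right (norm_nonneg _) hy)
    exact mul_le_mul hxx this h3 hε
  have h2 : x' ⬝ᵥ M *ᵥ (y - y') ≤ ε * ‖M‖ := by
    refine (dotProduct_le_euclNorm_mul _ _).trans ?_
    have h3 := euclNorm_mulVec_le M (y - y')
    have h4 : euclNorm (M *ᵥ (y - y')) ≤ ‖M‖ * ε :=
      h3.trans (mul_le_mul_of_nonneg_left hyy (norm_nonneg _))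
    calc euclNorm x' * euclNorm (M *ᵥ (y - y')) ≤ 1 * (‖M‖ * ε) :=
          mul_le_mul (hF₁' _ hx') h4 (euclNorm_nonneg _) zero_le_one
      _ = _ := by ring
  have := h x' hx' y' hy'
  linarith

/-- Increment comparison behind Chevet's inequality. -/
theorem sum_mul_sub_mul_sq_le {a a' : ν → ℝ} {b b' : κ → ℝ} {s : ℝ}
    (ha : euclNorm a ≤ s) (ha' : euclNorm a' ≤ s) :
    ∑ i, ∑ j, (a i * b j - a' i * b' j) ^ 2 ≤
      ∑ j, (s * b j - s * b' j) ^ 2 +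
        ∑ i, (euclNorm b * a i - euclNorm b' * a' i) ^ 2 := by
  have e1 : ∑ i, ∑ j, (a i * b j - a' i * b' j) ^ 2 =
      euclNorm a ^ 2 * euclNorm b ^ 2 + euclNorm a' ^ 2 * euclNorm b' ^ 2
        - 2 * (a ⬝ᵥ a') * (b ⬝ᵥ b') := by
    rw [mul_assoc]
    simp only [euclNorm_sq, dotProduct, Finset.sum_mul_sum]
    simp only [Finset.mul_sum, ← Finset.sum_add_distrib, ← Finset.sum_sub_distrib]
    exact Finset.sum_congr rfl fun i _ => Finset.sum_congr rfl fun j _ => by ring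
  have e2 : ∑ j, (s * b j - s * b' j) ^ 2 =
      s ^ 2 * (euclNorm b ^ 2 + euclNorm b' ^ 2 - 2 * (b ⬝ᵥ b')) := by
    simp only [euclNorm_sq, dotProduct, Finset.mul_sum, ← Finset.sum_add_distrib,
      ← Finset.sum_sub_distrib]
    exact Finset.sum_congr rfl fun j _ => by ring
  have e3 : ∑ i, (euclNorm b * a i - euclNorm b' * a' i) ^ 2 =
      euclNorm b ^ 2 * euclNorm a ^ 2 + euclNorm b' ^ 2 * euclNorm a' ^ 2
        - 2 * (euclNorm b * euclNorm b') * (a ⬝ᵥ a') := by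
    rw [euclNorm_sq a, euclNorm_sq a']
    simp only [dotProduct, Finset.mul_sum, ← Finset.sum_add_distrib,
      ← Finset.sum_sub_distrib]
    exact Finset.sum_congr rfl fun j _ => by ring
  rw [e1, e2, e3]
  have h1 := dotProduct_le_euclNorm_mul b b'
  have hs : 0 ≤ s := (euclNorm_nonneg a).trans ha
  have h2 : a ⬝ᵥ a' ≤ s ^ 2 := (dotProduct_le_euclNorm_mul a a').trans
    ((mul_le_mul ha ha' (euclNorm_nonneg _) hs).trans_eq (sq s).symm)
  nlinarith [mul_nonneg (sub_nonneg.2 h1) (sub_nonneg.2 h2),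
    mul_nonneg (sq_nonneg s) (sq_nonneg (euclNorm b - euclNorm b'))]

theorem integrable_frobSq_gaussMat :
    Integrable (fun G : Matrix ν κ ℝ => frobSq G) (gaussMat ν κ) := by
  rw [← measurePreserving_curry_gaussVec.map_eq]
  have hm : Measurable fun G : Matrix ν κ ℝ => frobSq G :=
    Finset.measurable_sum _ fun i _ => Finset.measurable_sum _ fun j _ =>
      (measurable_matrix_entry i j).pow_const 2
  rw [integrable_map_measure hm.aestronglyMeasurable
    measurePreserving_curry_gaussVec.measurable.aemeasurable]
  refine integrable_finsetSum _ fun i _ => integrable_finsetSum _ fun j _ => ?_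
  exact (measurePreserving_eval (fun _ : ν × κ => gaussianReal 0 1)
    (i, j)).integrable_comp_of_integrable integrable_sq_gaussianReal

theorem integrable_opNorm_mul_mul [DecidableEq κ] [DecidableEq ρ] [DecidableEq ν]
    (S : Matrix ι ν ℝ) (T : Matrix κ ρ ℝ) :
    Integrable (fun G : Matrix ν κ ℝ => ‖S * G * T‖) (gaussMat ν κ) := by
  refine Integrable.mono' (g := fun G => ‖S‖ * ((1 + frobSq G) / 2) * ‖T‖)
    (((((integrable_const _).add integrable_frobSq_gaussMat).div_const 2).const_mul _).mul_const _)
    (by fun_prop) (Filter.Eventually.of_forall fun G => ?_)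
  rw [norm_norm]
  refine (l2_opNorm_mul _ _).trans ?_
  gcongr
  refine (l2_opNorm_mul _ _).trans ?_
  gcongr
  refine (opNorm_le_sqrt_frobSq G).trans ?_
  nlinarith [sq_nonneg (√(frobSq G) - 1), Real.sq_sqrt (frobSq_nonneg G)]

/-- Chevet's inequality. -/
theorem integral_opNorm_mul_mul_le [DecidableEq κ] [DecidableEq ρ] [DecidableEq ν]
    [DecidableEq ι] (S : Matrix ι ν ℝ) (T : Matrix κ ρ ℝ) :
    ∫ G, ‖S * G * T‖ ∂(gaussMat ν κ) ≤ ‖S‖ * √(frobSq T) + √(frobSq S) * ‖T‖ := by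
  have hG : MeasurePreserving
      (fun g : (ν × κ) ⊕ κ ⊕ ν → ℝ => (Matrix.of fun i j => g (Sum.inl (i, j)) : Matrix ν κ ℝ))
      (gaussVec ((ν × κ) ⊕ κ ⊕ ν)) (gaussMat ν κ) :=
    measurePreserving_curry_gaussVec.comp (measurePreserving_comp_gaussVec Sum.inl_injective)
  have hi := integrable_opNorm_mul_mul S T
  have hh : MeasurePreserving (fun g : (ν × κ) ⊕ κ ⊕ ν → ℝ => fun j => g (Sum.inr (Sum.inl j)))
      (gaussVec ((ν × κ) ⊕ κ ⊕ ν)) (gaussVec κ) := measurePreserving_comp_gaussVec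
    (f := fun j => Sum.inr (Sum.inl j)) (fun i j h => by simpa using h)
  have hh' : MeasurePreserving (fun g : (ν × κ) ⊕ κ ⊕ ν → ℝ => fun j => g (Sum.inr (Sum.inr j)))
      (gaussVec ((ν × κ) ⊕ κ ⊕ ν)) (gaussVec ν) := measurePreserving_comp_gaussVec
    (f := fun j => Sum.inr (Sum.inr j)) (fun i j h => by simpa using h)
  have hi' := hi
  rw [← hG.map_eq] at hi' ⊢
  have hi2 := hi'.comp_measurable hG.measurable
  rw [integral_map hG.measurable.aemeasurable hi'.aestronglyMeasurable]
  set I := ∫ g : (ν × κ) ⊕ κ ⊕ ν → ℝ, ‖S * (Matrix.of fun i j => g (Sum.inl (i, j))) * T‖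
    ∂(gaussVec ((ν × κ) ⊕ κ ⊕ ν))
    with hI
  set B := ‖S‖ * √(frobSq T) + √(frobSq S) * ‖T‖ with hB
  have main : ∀ ε > 0, (1 - 2 * ε) * I ≤ B := by
    intro ε hε
    obtain ⟨F₁, hF₁n, hF₁, hF₁'⟩ := exists_finset_net ι hε
    obtain ⟨F₂, hF₂n, hF₂, hF₂'⟩ := exists_finset_net ρ hε
    have : Nonempty F₁ := hF₁n.to_subtype
    have : Nonempty F₂ := hF₂n.to_subtype
    have hbound : ∀ β > 0, β * ((1 - 2 * ε) * I) ≤ β * B + Real.log (Fintype.card (F₁ × F₂)) := by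
      intro β hβ
      set L : Matrix (F₁ × F₂) ((ν × κ) ⊕ κ ⊕ ν) ℝ := Matrix.of fun uv => Sum.elim
        (fun ij => β * ((Sᵀ *ᵥ uv.1.1) ij.1 * (T *ᵥ uv.2.1) ij.2)) 0 with hL
      set M : Matrix (F₁ × F₂) ((ν × κ) ⊕ κ ⊕ ν) ℝ := Matrix.of fun uv => Sum.elim 0
        (Sum.elim (fun j => β * (‖S‖ * (T *ᵥ uv.2.1) j))
          (fun i => β * (euclNorm (T *ᵥ uv.2.1) * (Sᵀ *ᵥ uv.1.1) i))) with hM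
      have hcmp := integral_logSumExp_mono_of_orthogonal L M ?_ ?_
      · have h1 : β * ((1 - 2 * ε) * I) ≤ ∫ g, logSumExp (L *ᵥ g)
            ∂(gaussVec ((ν × κ) ⊕ κ ⊕ ν)) := by
          rw [hI, ← mul_assoc, ← integral_const_mul]
          refine integral_mono (hi2.const_mul _) (integrable_logSumExp_mulVec L) fun g => ?_
          rw [mul_assoc, mul_comm, ← le_div_iff₀ hβ]
          refine opNorm_mul_le_of_net hε.le hF₁' hF₂' hF₁ fun x hx y hy => ?_
          rw [le_div_iff₀ hβ]
          have e : (L *ᵥ g) (⟨x, hx⟩, ⟨y, hy⟩) =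
              ∑ i, ∑ j, β * ((Sᵀ *ᵥ x) i * (T *ᵥ y) j) * g (Sum.inl (i, j)) := by
            rw [mulVec, dotProduct]
            simp only [hL, Matrix.of_apply, Fintype.sum_sum_type, Sum.elim_inl, Sum.elim_inr,
              Pi.zero_apply, zero_mul, Finset.sum_const_zero, add_zero, Fintype.sum_prod_type]
          refine le_trans (le_of_eq ?_) (le_logSumExp _ (⟨x, hx⟩, ⟨y, hy⟩))
          rw [e, ← Matrix.mulVec_mulVec, ← Matrix.mulVec_mulVec, Matrix.dotProduct_mulVec,
            ← Matrix.mulVec_transpose]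
          generalize Sᵀ *ᵥ x = a
          generalize T *ᵥ y = b
          simp only [mulVec, dotProduct, Finset.mul_sum, Finset.sum_mul, Matrix.of_apply]
          exact Finset.sum_congr rfl fun i _ => Finset.sum_congr rfl fun j _ => by ring
        have h2 : ∫ g, logSumExp (M *ᵥ g) ∂(gaussVec ((ν × κ) ⊕ κ ⊕ ν)) ≤
            β * B + Real.log (Fintype.card (F₁ × F₂)) := by
          have i1 := hh.integrable_comp_of_integrable (integrable_euclNorm_mulVec Tᵀ)
          have i2 := hh'.integrable_comp_of_integrable (integrable_euclNorm_mulVec S)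
          simp only [Function.comp_def] at i1 i2
          have i3 : Integrable (fun g : (ν × κ) ⊕ κ ⊕ ν → ℝ =>
              ‖S‖ * euclNorm (Tᵀ *ᵥ fun j => g (Sum.inr (Sum.inl j))) +
                euclNorm (S *ᵥ fun j => g (Sum.inr (Sum.inr j))) * ‖T‖)
              (gaussVec ((ν × κ) ⊕ κ ⊕ ν)) := (i1.const_mul _).add (i2.mul_const _)
          have e1 : ∫ g : (ν × κ) ⊕ κ ⊕ ν → ℝ, euclNorm (Tᵀ *ᵥ fun j => g (Sum.inr (Sum.inl j)))
                ∂(gaussVec ((ν × κ) ⊕ κ ⊕ ν)) ≤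
              √(frobSq T) := by
            rw [← frobSq_transpose]
            refine le_trans (le_of_eq ?_) (integral_euclNorm_mulVec_le Tᵀ)
            rw [← hh.map_eq, integral_map hh.measurable.aemeasurable]
            exact (continuous_euclNorm.measurable.comp (measurable_mulVec _)).aestronglyMeasurable
          have e2 : ∫ g : (ν × κ) ⊕ κ ⊕ ν → ℝ, euclNorm (S *ᵥ fun j => g (Sum.inr (Sum.inr j)))
                ∂(gaussVec ((ν × κ) ⊕ κ ⊕ ν)) ≤
              √(frobSq S) := by
            refine le_trans (le_of_eq ?_) (integral_euclNorm_mulVec_le S)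
            rw [← hh'.map_eq, integral_map hh'.measurable.aemeasurable]
            exact (continuous_euclNorm.measurable.comp (measurable_mulVec _)).aestronglyMeasurable
          calc ∫ g, logSumExp (M *ᵥ g) ∂(gaussVec ((ν × κ) ⊕ κ ⊕ ν)) ≤ ∫ g : (ν × κ) ⊕ κ ⊕ ν → ℝ,
                (β * (‖S‖ * euclNorm (Tᵀ *ᵥ fun j => g (Sum.inr (Sum.inl j))) +
                  euclNorm (S *ᵥ fun j => g (Sum.inr (Sum.inr j))) * ‖T‖) +
                  Real.log (Fintype.card (F₁ × F₂))) ∂(gaussVec ((ν × κ) ⊕ κ ⊕ ν)) := by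
                refine integral_mono (integrable_logSumExp_mulVec M)
                  ((i3.const_mul _).add (integrable_const _)) fun g => ?_
                refine logSumExp_le fun uv => ?_
                have e3 : (M *ᵥ g) uv =
                    β * (‖S‖ * ((T *ᵥ uv.2.1) ⬝ᵥ fun j => g (Sum.inr (Sum.inl j)))
                    + ((Sᵀ *ᵥ uv.1.1) ⬝ᵥ fun j => g (Sum.inr (Sum.inr j))) *
                      euclNorm (T *ᵥ uv.2.1)) := by
                  rw [mulVec, dotProduct]
                  simp only [hM, Matrix.of_apply, Fintype.sum_sum_type,
                    Sum.elim_inl, Sum.elim_inr, Pi.zero_apply, zero_mul, Finset.sum_const_zero,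
                    zero_add, dotProduct, mul_add, Finset.mul_sum, Finset.sum_mul]
                  congr 1 <;> exact Finset.sum_congr rfl fun j _ => by ring
                rw [e3]
                have b1 : (T *ᵥ uv.2.1) ⬝ᵥ (fun j => g (Sum.inr (Sum.inl j))) ≤
                    euclNorm (Tᵀ *ᵥ fun j => g (Sum.inr (Sum.inl j))) := by
                  rw [dotProduct_comm, Matrix.dotProduct_mulVec, ← Matrix.mulVec_transpose]
                  exact (dotProduct_le_euclNorm_mul _ _).trans
                    (mul_le_of_le_one_right (euclNorm_nonneg _) (hF₂ _ uv.2.2))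
                have b2 : (Sᵀ *ᵥ uv.1.1) ⬝ᵥ (fun j => g (Sum.inr (Sum.inr j))) ≤
                    euclNorm (S *ᵥ fun j => g (Sum.inr (Sum.inr j))) := by
                  rw [dotProduct_comm, Matrix.dotProduct_mulVec, ← Matrix.mulVec_transpose,
                    Matrix.transpose_transpose]
                  exact (dotProduct_le_euclNorm_mul _ _).trans
                    (mul_le_of_le_one_right (euclNorm_nonneg _) (hF₁ _ uv.1.2))
                have b3 : euclNorm (T *ᵥ uv.2.1) ≤ ‖T‖ := (euclNorm_mulVec_le _ _).trans
                    (mul_le_of_le_one_right (norm_nonneg _) (hF₂ _ uv.2.2))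
                have b4 := mul_le_mul b2 b3 (euclNorm_nonneg _) (euclNorm_nonneg _)
                have b5 := mul_le_mul_of_nonneg_left b1 (norm_nonneg S)
                gcongr
            _ = β * (‖S‖ * ∫ g : (ν × κ) ⊕ κ ⊕ ν → ℝ,
                    euclNorm (Tᵀ *ᵥ fun j => g (Sum.inr (Sum.inl j)))
                ∂(gaussVec ((ν × κ) ⊕ κ ⊕ ν)) +
                  (∫ g : (ν × κ) ⊕ κ ⊕ ν → ℝ,
                    euclNorm (S *ᵥ fun j => g (Sum.inr (Sum.inr j)))
                ∂(gaussVec ((ν × κ) ⊕ κ ⊕ ν))) * ‖T‖) +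
                  Real.log (Fintype.card (F₁ × F₂)) := by
                rw [integral_add (i3.const_mul _) (integrable_const _), integral_const_mul,
                  integral_add (i1.const_mul _)
                  (i2.mul_const _), integral_const_mul, integral_mul_const]
                simp
            _ ≤ _ := by
                rw [hB]
                gcongr
        linarith
      · ext x y
        simp [hL, hM, Matrix.mul_apply]
      · intro x y
        have hu : ∀ u : F₁, euclNorm (Sᵀ *ᵥ u.1) ≤ ‖S‖ := fun u => by
          rw [← opNorm_transpose S]
          exact (euclNorm_mulVec_le _ _).trans
            (mul_le_of_le_one_right (norm_nonneg _) (hF₁ _ u.2))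
        have := mul_le_mul_of_nonneg_left (sum_mul_sub_mul_sq_le (b := T *ᵥ x.2.1)
          (b' := T *ᵥ y.2.1) (hu x.1) (hu y.1)) (sq_nonneg β)
        simp only [hL, hM, Matrix.of_apply, Fintype.sum_sum_type, Sum.elim_inl, Sum.elim_inr,
          Pi.zero_apply, sub_zero, ne_eq, OfNat.ofNat_ne_zero, not_false_eq_true, zero_pow,
          Finset.sum_const_zero, add_zero, zero_add, Fintype.sum_prod_type, ← mul_sub, mul_pow,
          ← Finset.mul_sum, ← mul_add]
        simpa only [← mul_sub, mul_pow, ← Finset.mul_sum] using this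
    by_contra! hlt
    have h := hbound ((Real.log (Fintype.card (F₁ × F₂)) + 1) / ((1 - 2 * ε) * I - B))
      (div_pos (by have := Real.log_natCast_nonneg (Fintype.card (F₁ × F₂)); linarith)
        (by linarith))
    have hne : (1 - 2 * ε) * I - B ≠ 0 := by linarith
    have := div_mul_cancel₀ (Real.log (Fintype.card (F₁ × F₂)) + 1) hne
    linarith
  have hlim : Filter.Tendsto (fun ε : ℝ => (1 - 2 * ε) * I) (nhdsWithin 0 (Set.Ioi 0))
      (nhds ((1 - 2 * 0) * I)) :=
    ((continuous_const.sub (continuous_const.mul continuous_id)).mul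
      continuous_const).continuousAt.tendsto.mono_left nhdsWithin_le_nhds
  have := le_of_tendsto hlim (eventually_nhdsWithin_of_forall fun ε hε => main ε hε)
  simpa using this

end Chevet

section Deterministic

variable {ι κ μ ν ρ : Type*} [Fintype ι] [Fintype κ] [Fintype μ] [Fintype ν] [Fintype ρ]

theorem opNorm_le_one_of_projection [DecidableEq μ] {Q : Matrix μ μ ℝ} (h1 : Q * Q = Q)
    (h2 : Qᵀ = Q) : ‖Q‖ ≤ 1 := by
  refine opNorm_le_of_euclNorm zero_le_one fun x => ?_
  have h : euclNorm (Q *ᵥ x) ^ 2 ≤ euclNorm x * euclNorm (Q *ᵥ x) := by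
    refine le_trans (le_of_eq ?_) (dotProduct_le_euclNorm_mul _ _)
    rw [euclNorm_sq]
    conv_lhs => rw [Matrix.dotProduct_mulVec, ← Matrix.mulVec_transpose, h2,
      Matrix.mulVec_mulVec, h1, dotProduct_comm]
  rcases (euclNorm_nonneg (Q *ᵥ x)).eq_or_lt with h0 | h0
  · rw [← h0, one_mul]; exact euclNorm_nonneg x
  · nlinarith

/-- Power method inequality for quadratic forms of a positive semidefinite matrix. -/
theorem pow_dotProduct_mulVec_le [DecidableEq μ] {M : Matrix μ μ ℝ} (hM : M.PosSemidef) {y : μ → ℝ}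
    (hy : euclNorm y ≤ 1) (j : ℕ) :
    (y ⬝ᵥ M *ᵥ y) ^ (j + 1) ≤ y ⬝ᵥ M ^ (j + 1) *ᵥ y := by
  set a : ℕ → ℝ := fun j => y ⬝ᵥ M ^ j *ᵥ y with ha
  have hpos : ∀ j, 0 ≤ a j := fun j => by simpa using (hM.pow j).dotProduct_mulVec_nonneg y
  have ha0 : a 0 ≤ 1 := by
    simp only [ha, pow_zero, one_mulVec, ← euclNorm_sq]
    exact pow_le_one₀ (euclNorm_nonneg y) hy
  have hMt : Mᵀ = M := by simpa using hM.isHermitian.eq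
  have hlc : ∀ j, a (j + 1) ^ 2 ≤ a j * a (j + 2) := by
    intro j
    have hq : ∀ t : ℝ, 0 ≤ a (j + 2) * (t * t) + (-2 * a (j + 1)) * t + a j := by
      intro t
      have h := (hM.pow j).dotProduct_mulVec_nonneg (y - t • M *ᵥ y)
      have e1 : ∀ z, (M *ᵥ y) ⬝ᵥ z = y ⬝ᵥ M *ᵥ z := fun z => by
        rw [Matrix.dotProduct_mulVec, ← Matrix.mulVec_transpose, hMt]
      simp only [star_trivial, mulVec_sub, mulVec_smul, sub_dotProduct, dotProduct_sub,
        smul_dotProduct, dotProduct_smul, smul_eq_mul, Matrix.mulVec_mulVec, e1, ← pow_succ,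
        ← pow_succ'] at h
      simp only [ha]
      linarith
    have := discrim_le_zero hq
    rw [discrim] at this
    nlinarith
  have hstep : ∀ j, a 1 * a j ≤ a (j + 1) := by
    intro j
    induction j with
    | zero => exact mul_le_of_le_one_right (hpos 1) ha0
    | succ j ih =>
      rcases (hpos (j + 1)).eq_or_lt with h0 | h0
      · rw [← h0, mul_zero]; exact hpos _
      · have h1 := hlc j
        have h2 := mul_le_mul_of_nonneg_right ih (hpos (j + 2))
        have h3 := mul_le_mul_of_nonneg_left h1 (hpos 1)
        have : (a 1 * a (j + 1)) * a (j + 1) ≤ a (j + 2) * a (j + 1) := by nlinarith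
        exact le_of_mul_le_mul_right this h0
  have hfin : ∀ j, a 1 ^ (j + 1) ≤ a (j + 1) := by
    intro j
    induction j with
    | zero => simp
    | succ j ih =>
      calc a 1 ^ (j + 1 + 1) = a 1 * a 1 ^ (j + 1) := pow_succ' _ _
        _ ≤ a 1 * a (j + 1) := mul_le_mul_of_nonneg_left ih (hpos 1)
        _ ≤ _ := hstep (j + 1)
  simpa [ha] using hfin j

/-- Power iterations reduce the projection error. -/
theorem opNorm_projection_mul_le_rpow [DecidableEq μ] [DecidableEq ι] (A : Matrix μ ι ℝ)
    {Q : Matrix μ μ ℝ} (h1 : Q * Q = Q) (h2 : Qᵀ = Q) (q : ℕ) :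
    ‖Q * A‖ ≤ ‖Q * ((A * Aᵀ) ^ q * A)‖ ^ ((1 : ℝ) / (2 * (q : ℝ) + 1)) := by
  set B := (A * Aᵀ) ^ q * A with hB
  have hMt : (A * Aᵀ)ᵀ = A * Aᵀ := by simp
  have hBB : B * Bᵀ = (A * Aᵀ) ^ (2 * q + 1) := by
    rw [hB, Matrix.transpose_mul, Matrix.transpose_pow, hMt, Matrix.mul_assoc,
      ← Matrix.mul_assoc A, ← pow_succ', ← pow_add]
    congr 1; omega
  have hM : (A * Aᵀ).PosSemidef := by
    simpa using posSemidef_self_mul_conjTranspose A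
  rw [← opNorm_transpose]
  refine opNorm_le_of_dotProduct fun z x hz hx => ?_
  have hq0 : (0 : ℝ) < 2 * (q : ℝ) + 1 := by positivity
  have e : (Q * A)ᵀ *ᵥ x = Aᵀ *ᵥ (Q *ᵥ x) := by
    rw [Matrix.transpose_mul, h2, Matrix.mulVec_mulVec]
  refine (dotProduct_le_euclNorm_mul _ _).trans
    ((mul_le_of_le_one_left (euclNorm_nonneg _) hz).trans ?_)
  rw [one_div, Real.le_rpow_inv_iff_of_pos (euclNorm_nonneg _) (norm_nonneg _) hq0]
  rw [show 2 * (q : ℝ) + 1 = ((2 * q + 1 : ℕ) : ℝ) by push_cast; ring, Real.rpow_natCast, e]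
  set y := Q *ᵥ x with hy
  have hy1 : euclNorm y ≤ 1 :=
    (euclNorm_mulVec_le Q x).trans
      (mul_le_one₀ (opNorm_le_one_of_projection h1 h2) (euclNorm_nonneg _) hx)
  have key := pow_dotProduct_mulVec_le hM hy1 (2 * q)
  have e1 : ∀ {ι : Type _} [Fintype ι] (C : Matrix μ ι ℝ),
      y ⬝ᵥ (C * Cᵀ) *ᵥ y = euclNorm (Cᵀ *ᵥ y) ^ 2 := by
    intro ι _ C
    rw [euclNorm_sq, ← Matrix.mulVec_mulVec, Matrix.dotProduct_mulVec, ← Matrix.mulVec_transpose]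
  rw [e1, ← hBB, e1, ← pow_mul, mul_comm 2, pow_mul] at key
  have h3 := le_of_sq_le_sq key (euclNorm_nonneg _)
  refine h3.trans ?_
  have e2 : Bᵀ *ᵥ y = (Q * B)ᵀ *ᵥ x := by
    rw [Matrix.transpose_mul Q B, h2, Matrix.mulVec_mulVec]
  rw [e2, ← opNorm_transpose (Q * B)]
  exact (euclNorm_mulVec_le _ _).trans (mul_le_of_le_one_right (norm_nonneg _) hx)

/-- Deterministic error bound for the range finder. -/
theorem opNorm_projection_mul_le [DecidableEq μ] [DecidableEq ρ] [DecidableEq ν]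
    (W : Matrix μ (ρ ⊕ ν) ℝ)
    (s : ρ ⊕ ν → ℝ) (hW : Wᵀ * W = diagonal fun i => s i ^ 2) {Q : Matrix μ μ ℝ} (hQ : ‖Q‖ ≤ 1)
    (Ω₁ : Matrix ρ κ ℝ) (Ω₂ : Matrix ν κ ℝ) (hQW : Q * W * fromRows Ω₁ Ω₂ = 0) (T : Matrix κ ρ ℝ)
    (hT : Ω₁ * T = 1) :
    ‖Q * W‖ ≤ ‖diagonal fun j => s (Sum.inr j)‖ + ‖(diagonal fun j => s (Sum.inr j)) * Ω₂ * T‖ := by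
  set S := diagonal fun j => s (Sum.inr j) with hS
  refine opNorm_le_of_euclNorm (by positivity) fun x => ?_
  set x₁ : ρ → ℝ := fun i => x (Sum.inl i)
  set x₂ : ν → ℝ := fun i => x (Sum.inr i)
  set z := x₂ - Ω₂ *ᵥ T *ᵥ x₁ with hz
  have hx : x = Sum.elim x₁ x₂ := by ext i; cases i <;> rfl
  have e0 : (Q * W) *ᵥ x = Q *ᵥ W *ᵥ Sum.elim 0 z := by
    have h0 : (Q * W * fromRows Ω₁ Ω₂) *ᵥ (T *ᵥ x₁) = 0 := by rw [hQW, zero_mulVec]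
    rw [← Matrix.mulVec_mulVec, fromRows_mulVec, Matrix.mulVec_mulVec, hT, one_mulVec] at h0
    rw [Matrix.mulVec_mulVec, ← sub_zero ((Q * W) *ᵥ x), ← h0, ← mulVec_sub]
    congr 1
    rw [hx]
    ext i; cases i <;> simp [hz]
  have e1 : euclNorm (W *ᵥ Sum.elim 0 z) = euclNorm (S *ᵥ z) := by
    rw [euclNorm_eq_sqrt, euclNorm_eq_sqrt]
    congr 1
    rw [Matrix.dotProduct_mulVec, ← Matrix.mulVec_transpose, Matrix.mulVec_mulVec, hW]
    simp only [dotProduct, mulVec_diagonal, Fintype.sum_sum_type, hS]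
    simp
    exact Finset.sum_congr rfl fun i _ => by ring
  have hn1 : euclNorm x₁ ≤ euclNorm x := by
    rw [euclNorm_eq_sqrt, euclNorm_eq_sqrt]
    refine Real.sqrt_le_sqrt ?_
    rw [dotProduct, dotProduct, Fintype.sum_sum_type]
    exact le_add_of_nonneg_right (Finset.sum_nonneg fun i _ => mul_self_nonneg _)
  have hn2 : euclNorm x₂ ≤ euclNorm x := by
    rw [euclNorm_eq_sqrt, euclNorm_eq_sqrt]
    refine Real.sqrt_le_sqrt ?_
    rw [dotProduct, dotProduct, Fintype.sum_sum_type]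
    exact le_add_of_nonneg_left (Finset.sum_nonneg fun i _ => mul_self_nonneg _)
  rw [e0]
  refine (euclNorm_mulVec_le _ _).trans
    ((mul_le_of_le_one_left (euclNorm_nonneg _) hQ).trans ?_)
  have e2 : S *ᵥ z = S *ᵥ x₂ + -((S * Ω₂ * T) *ᵥ x₁) := by
    rw [hz, mulVec_sub, sub_eq_add_neg, Matrix.mulVec_mulVec, Matrix.mulVec_mulVec,
      Matrix.mul_assoc]
  rw [e1, e2]
  refine (euclNorm_add_le _ _).trans ?_
  rw [euclNorm_neg, add_mul]
  gcongr
  · exact (euclNorm_mulVec_le _ _).trans (by gcongr)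
  · exact (euclNorm_mulVec_le _ _).trans (by gcongr)

end Deterministic

section GaussianMoments

variable {κ : Type*} [Fintype κ]

theorem gaussVec_eq_withDensity :
    gaussVec κ = volume.withDensity
      (fun x => ENNReal.ofReal (∏ i, gaussianPDFReal 0 1 (x i))) := by
  refine Measure.pi_eq fun s hs => ?_
  have hres : (volume : Measure (κ → ℝ)).restrict (Set.univ.pi s)
      = Measure.pi fun i => volume.restrict (s i) := Measure.restrict_pi_pi _ s
  rw [withDensity_apply _ (MeasurableSet.univ_pi hs), hres,
    ← ofReal_integral_eq_lintegral_ofReal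
      (Integrable.fintype_prod fun i => (integrable_gaussianPDFReal 0 1).restrict)
      (ae_of_all _ fun x => Finset.prod_nonneg fun i _ => gaussianPDFReal_nonneg 0 1 (x i)),
    integral_fintype_prod_eq_prod (fun _ => gaussianPDFReal 0 1),
    ENNReal.ofReal_prod_of_nonneg fun i _ =>
      integral_nonneg fun x => gaussianPDFReal_nonneg 0 1 x]
  exact Finset.prod_congr rfl fun i _ => (gaussianReal_apply_eq_integral 0 one_ne_zero (s i)).symm

theorem prod_gaussianPDFReal (x : κ → ℝ) :
    ∏ i, gaussianPDFReal 0 1 (x i)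
      = (√(2 * Real.pi))⁻¹ ^ Fintype.card κ * Real.exp (-(1 / 2) * euclNorm x ^ 2) := by
  simp only [gaussianPDFReal, Finset.prod_mul_distrib, Finset.prod_const, ← Real.exp_sum,
    euclNorm_sq, dotProduct, Finset.mul_sum, Finset.card_univ, NNReal.coe_one, mul_one, sub_zero]
  congr 2
  exact Finset.sum_congr rfl fun i _ => by ring

theorem gaussVec_radial [Nonempty κ] :
    ∃ C : ℝ, ∀ f : ℝ → ℝ,
      (Integrable (fun x => f (euclNorm x)) (gaussVec κ) ↔
        IntegrableOn (fun y : ℝ => y ^ (Fintype.card κ - 1) • (Real.exp (-(1 / 2) * y ^ 2) * f y))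
          (Set.Ioi 0)) ∧
      ∫ x, f (euclNorm x) ∂(gaussVec κ) =
        C * ∫ y in Set.Ioi (0 : ℝ),
          y ^ (Fintype.card κ - 1) • (Real.exp (-(1 / 2) * y ^ 2) * f y) := by
  have hc : (0 : ℝ) < (√(2 * Real.pi))⁻¹ ^ Fintype.card κ := by positivity
  set c := (√(2 * Real.pi))⁻¹ ^ Fintype.card κ with hcdef
  refine ⟨c * (Fintype.card κ *
    (volume : Measure (EuclideanSpace ℝ κ)).real (Metric.ball 0 1)), fun f => ?_⟩
  have hmeas : Measurable fun x : κ → ℝ => ENNReal.ofReal (∏ i, gaussianPDFReal 0 1 (x i)) :=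
    ENNReal.measurable_ofReal.comp (Finset.measurable_prod _ fun i _ =>
      (measurable_gaussianPDFReal 0 1).comp (measurable_pi_apply i))
  have htoReal : ∀ x : κ → ℝ, (ENNReal.ofReal (∏ i, gaussianPDFReal 0 1 (x i))).toReal
      = c * Real.exp (-(1 / 2) * euclNorm x ^ 2) := fun x => by
    rw [ENNReal.toReal_ofReal (Finset.prod_nonneg fun i _ => gaussianPDFReal_nonneg 0 1 (x i)),
      prod_gaussianPDFReal]
  have hmp := PiLp.volume_preserving_ofLp κ
  have hemb : MeasurableEmbedding (WithLp.ofLp : EuclideanSpace ℝ κ → κ → ℝ) :=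
    (MeasurableEquiv.toLp 2 (κ → ℝ)).symm.measurableEmbedding
  set F : ℝ → ℝ := fun y => Real.exp (-(1 / 2) * y ^ 2) * f y with hF
  constructor
  · have h1 := integrable_fun_norm_addHaar (volume : Measure (EuclideanSpace ℝ κ)) (f := F)
    rw [finrank_euclideanSpace] at h1
    rw [← h1, gaussVec_eq_withDensity,
      integrable_withDensity_iff_integrable_smul' hmeas
        (ae_of_all _ fun _ => ENNReal.ofReal_lt_top)]
    have h2 : (fun x : κ → ℝ => (ENNReal.ofReal (∏ i, gaussianPDFReal 0 1 (x i))).toReal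
        • f (euclNorm x)) = fun x => c * F (euclNorm x) := by
      funext x
      rw [htoReal, smul_eq_mul, hF, mul_assoc]
    rw [h2, integrable_const_mul_iff hc.ne'.isUnit, ← hmp.integrable_comp_emb hemb]
    rfl
  · have h1 := integral_fun_norm_addHaar (volume : Measure (EuclideanSpace ℝ κ)) F
    rw [finrank_euclideanSpace] at h1
    rw [gaussVec_eq_withDensity, integral_withDensity_eq_integral_toReal_smul hmeas
      (ae_of_all _ fun _ => ENNReal.ofReal_lt_top)]
    have h2 : ∀ x : κ → ℝ, (ENNReal.ofReal (∏ i, gaussianPDFReal 0 1 (x i))).toReal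
        • f (euclNorm x) = c * F (euclNorm x) := fun x => by
      rw [htoReal, smul_eq_mul, hF, mul_assoc]
    simp_rw [h2]
    rw [integral_const_mul, ← hmp.integral_comp hemb (fun x => F (euclNorm x))]
    change c * ∫ x : EuclideanSpace ℝ κ, F ‖x‖ = _
    rw [h1]
    simp only [nsmul_eq_mul, smul_eq_mul]
    ring

theorem integrable_euclNorm_rpow [Nonempty κ] {b : ℝ} (hb : -(Fintype.card κ : ℝ) < b) :
    Integrable (fun x => euclNorm x ^ b) (gaussVec κ) := by
  obtain ⟨C, hC⟩ := gaussVec_radial (κ := κ)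
  rw [(hC fun y => y ^ b).1]
  have h := integrableOn_rpow_mul_exp_neg_mul_sq (b := 1 / 2) (by norm_num)
    (s := (Fintype.card κ : ℝ) - 1 + b) (by linarith)
  refine h.congr_fun (fun y hy => ?_) measurableSet_Ioi
  have hy' : (0 : ℝ) < y := hy
  have hcard : 1 ≤ Fintype.card κ := Fintype.card_pos
  simp only [smul_eq_mul]
  rw [Real.rpow_add hy', ← Nat.cast_pred hcard, Real.rpow_natCast]
  ring

theorem integral_euclNorm_rpow_add_two [Nonempty κ] {b : ℝ} (hb : -(Fintype.card κ : ℝ) < b) :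
    ∫ x, euclNorm x ^ (b + 2) ∂(gaussVec κ)
      = (Fintype.card κ + b) * ∫ x, euclNorm x ^ b ∂(gaussVec κ) := by
  obtain ⟨C, hC⟩ := gaussVec_radial (κ := κ)
  have hcard : 1 ≤ Fintype.card κ := Fintype.card_pos
  have key : ∀ b : ℝ, -(Fintype.card κ : ℝ) < b →
      ∫ y in Set.Ioi (0 : ℝ), y ^ (Fintype.card κ - 1) • (Real.exp (-(1 / 2) * y ^ 2) * y ^ b)
        = (1 / 2 : ℝ) ^ (-((Fintype.card κ : ℝ) + b) / 2) * (1 / 2)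
          * Real.Gamma (((Fintype.card κ : ℝ) + b) / 2) := by
    intro b hb
    have h := integral_rpow_mul_exp_neg_mul_rpow (p := 2) (q := (Fintype.card κ : ℝ) - 1 + b)
      (b := 1 / 2) (by norm_num) (by linarith) (by norm_num)
    rw [show (Fintype.card κ : ℝ) - 1 + b + 1 = Fintype.card κ + b by ring] at h
    rw [← h]
    refine setIntegral_congr_fun measurableSet_Ioi fun y hy => ?_
    have hy' : (0 : ℝ) < y := hy
    simp only [smul_eq_mul]
    rw [Real.rpow_add hy', ← Nat.cast_pred hcard, Real.rpow_natCast, Real.rpow_two]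
    ring
  rw [(hC fun y => y ^ (b + 2)).2, (hC fun y => y ^ b).2, key b hb, key (b + 2) (by linarith),
    show ((Fintype.card κ : ℝ) + (b + 2)) / 2 = (Fintype.card κ + b) / 2 + 1 by ring,
    show -((Fintype.card κ : ℝ) + (b + 2)) / 2 = -(Fintype.card κ + b) / 2 - 1 by ring,
    Real.Gamma_add_one (by linarith), Real.rpow_sub_one (by norm_num)]
  ring

theorem integral_euclNorm_pow [Nonempty κ] (a : ℕ) :
    ∫ x, euclNorm x ^ (2 * (a : ℝ)) ∂(gaussVec κ)
      = ∏ i ∈ Finset.range a, ((Fintype.card κ : ℝ) + 2 * i) := by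
  have hcard : (0 : ℝ) < Fintype.card κ := by exact_mod_cast Fintype.card_pos
  induction a with
  | zero => simp
  | succ a ih =>
    rw [show 2 * ((a + 1 : ℕ) : ℝ) = 2 * (a : ℝ) + 2 by push_cast; ring,
      integral_euclNorm_rpow_add_two (by have := a.cast_nonneg (α := ℝ); linarith), ih,
      Finset.prod_range_succ, mul_comm]

theorem integral_euclNorm_pow_neg [Nonempty κ] (a : ℕ) (ha : 2 * a < Fintype.card κ) :
    ∫ x, euclNorm x ^ (-(2 * (a : ℝ))) ∂(gaussVec κ)
      = ∏ i ∈ Finset.range a, ((Fintype.card κ : ℝ) - 2 - 2 * i)⁻¹ := by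
  induction a with
  | zero => simp
  | succ a ih =>
    have h : 2 * ((a : ℝ) + 1) < Fintype.card κ := by exact_mod_cast ha
    have h2 := integral_euclNorm_rpow_add_two (κ := κ) (b := -(2 * ((a + 1 : ℕ) : ℝ)))
      (by push_cast; linarith)
    rw [show -(2 * ((a + 1 : ℕ) : ℝ)) + 2 = -(2 * (a : ℝ)) by push_cast; ring,
      ih (by omega)] at h2
    rw [Finset.prod_range_succ, h2]
    push_cast
    field_simp
    rw [eq_div_iff (by linarith)]
    ring

theorem measurable_euclNorm : Measurable (euclNorm : (κ → ℝ) → ℝ) :=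
  continuous_euclNorm.measurable

theorem lintegral_euclNorm_pow [Nonempty κ] (a : ℕ) :
    ∫⁻ x, ENNReal.ofReal (euclNorm x) ^ (2 * a) ∂(gaussVec κ)
      = ENNReal.ofReal (∏ i ∈ Finset.range a, ((Fintype.card κ : ℝ) + 2 * i)) := by
  rw [← integral_euclNorm_pow, ofReal_integral_eq_lintegral_ofReal]
  · refine lintegral_congr fun x => ?_
    rw [← ENNReal.ofReal_pow (euclNorm_nonneg x), ← Real.rpow_natCast]
    push_cast
    rfl
  · refine integrable_euclNorm_rpow ?_
    have : (0 : ℝ) < Fintype.card κ := by exact_mod_cast Fintype.card_pos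
    have := a.cast_nonneg (α := ℝ)
    linarith
  · exact ae_of_all _ fun x => Real.rpow_nonneg (euclNorm_nonneg x) _

theorem gaussVec_singleton [Nonempty κ] (v : κ → ℝ) : gaussVec κ {v} = 0 := by
  rw [← Set.univ_pi_singleton, Measure.pi_pi]
  have := nullSingletonClass_gaussianReal (μ := 0) (v := 1) one_ne_zero
  obtain ⟨i⟩ := ‹Nonempty κ›
  exact Finset.prod_eq_zero (Finset.mem_univ i) (measure_singleton _)

theorem lintegral_euclNorm_inv_pow [Nonempty κ] (a : ℕ) (ha : 2 * a < Fintype.card κ) :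
    ∫⁻ x, (ENNReal.ofReal (euclNorm x))⁻¹ ^ (2 * a) ∂(gaussVec κ)
      = ENNReal.ofReal (∏ i ∈ Finset.range a, ((Fintype.card κ : ℝ) - 2 - 2 * i)⁻¹) := by
  rw [← integral_euclNorm_pow_neg a ha, ofReal_integral_eq_lintegral_ofReal]
  · have h0 : ∀ᵐ x ∂(gaussVec κ), x ≠ 0 := by
      simpa [ae_iff] using gaussVec_singleton (0 : κ → ℝ)
    refine lintegral_congr_ae ?_
    filter_upwards [h0] with x hx
    have hpos : 0 < euclNorm x := lt_of_le_of_ne (euclNorm_nonneg x)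
      fun h => hx (euclNorm_eq_zero.1 h.symm)
    rw [← ENNReal.ofReal_inv_of_pos hpos, ← ENNReal.ofReal_pow (by positivity),
      Real.rpow_neg hpos.le, inv_pow, ← Real.rpow_natCast]
    push_cast
    rfl
  · refine integrable_euclNorm_rpow ?_
    have : 2 * (a : ℝ) < Fintype.card κ := by exact_mod_cast ha
    linarith
  · exact ae_of_all _ fun x => Real.rpow_nonneg (euclNorm_nonneg x) _

end GaussianMoments

section PseudoInverse

variable {ρ κ : Type*} [Fintype ρ] [Fintype κ] [DecidableEq ρ]

/-- The right pseudo-inverse `Gᵀ (G Gᵀ)⁻¹` of a matrix with linearly independent rows. -/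
noncomputable def rightPinv (G : Matrix ρ κ ℝ) : Matrix κ ρ ℝ := Gᵀ * (G * Gᵀ)⁻¹

theorem measurable_rightPinv : Measurable (rightPinv : Matrix ρ κ ℝ → Matrix κ ρ ℝ) := by
  have hc : Continuous fun G : Matrix ρ κ ℝ => G * Gᵀ :=
    continuous_id.matrix_mul continuous_id.matrix_transpose
  refine measurable_matrix_of fun i j => ?_
  simp only [rightPinv, Matrix.inv_def, Ring.inverse_eq_inv', mul_apply, transpose_apply,
    Matrix.smul_apply, smul_eq_mul]
  refine Finset.measurable_fun_sum _ fun l _ => ?_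
  refine (measurable_matrix_entry l i).mul (Measurable.mul ?_ ?_)
  · exact hc.matrix_det.measurable.inv
  · exact (measurable_matrix_entry l j).comp hc.matrix_adjugate.measurable

theorem rightPinv_mul_left (U : Matrix ρ ρ ℝ) (hU : Uᵀ * U = 1) (G : Matrix ρ κ ℝ) :
    rightPinv (U * G) = rightPinv G * Uᵀ := by
  have hU' : U * Uᵀ = 1 := mul_eq_one_comm.1 hU
  have hi : U⁻¹ = Uᵀ := inv_eq_left_inv hU
  have hi' : Uᵀ⁻¹ = U := inv_eq_left_inv hU'
  rw [rightPinv, rightPinv, transpose_mul,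
    show U * G * (Gᵀ * Uᵀ) = U * (G * Gᵀ) * Uᵀ by simp only [Matrix.mul_assoc],
    Matrix.mul_inv_rev, Matrix.mul_inv_rev, hi, hi', Matrix.mul_assoc Gᵀ, ← Matrix.mul_assoc Uᵀ U,
    hU, Matrix.one_mul, Matrix.mul_assoc]

theorem mul_rightPinv {G : Matrix ρ κ ℝ} (h : LinearIndependent ℝ G.row) :
    G * rightPinv G = 1 := by
  have hdet : IsUnit (G * Gᵀ) := by
    rw [← mulVec_injective_iff_isUnit]
    refine (injective_iff_map_eq_zero (G * Gᵀ).mulVecLin).2 fun x hx => ?_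
    have hx' : (G * Gᵀ) *ᵥ x = 0 := hx
    have h0 : (Gᵀ *ᵥ x) ⬝ᵥ (Gᵀ *ᵥ x) = 0 := by
      rw [dotProduct_mulVec, vecMul_transpose, mulVec_mulVec, hx', zero_dotProduct]
    have h1 := dotProduct_self_eq_zero.1 h0
    rw [mulVec_transpose] at h1
    exact vecMul_injective_iff.2 h (h1.trans (zero_vecMul G).symm)
  rw [rightPinv, ← Matrix.mul_assoc, mul_nonsing_inv _ ((isUnit_iff_isUnit_det _).1 hdet)]

theorem euclNorm_rightPinv_mulVec_le (G : Matrix ρ κ ℝ) (w : κ → ℝ) :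
    euclNorm (rightPinv G *ᵥ (G *ᵥ w)) ≤ euclNorm w := by
  classical
  by_cases hdet : IsUnit (G * Gᵀ).det
  · have hsq : (rightPinv G * G) * (rightPinv G * G) = rightPinv G * G := by
      rw [rightPinv, show Gᵀ * (G * Gᵀ)⁻¹ * G * (Gᵀ * (G * Gᵀ)⁻¹ * G)
        = Gᵀ * ((G * Gᵀ)⁻¹ * (G * Gᵀ)) * (G * Gᵀ)⁻¹ * G by simp only [Matrix.mul_assoc],
        nonsing_inv_mul _ hdet, Matrix.mul_one]
    have hsymm : (rightPinv G * G)ᵀ = rightPinv G * G := by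
      simp only [rightPinv, transpose_mul, transpose_nonsing_inv, transpose_transpose,
        Matrix.mul_assoc]
    have h1 : euclNorm ((rightPinv G * G) *ᵥ w) ^ 2 ≤
        euclNorm ((rightPinv G * G) *ᵥ w) * euclNorm w := by
      rw [euclNorm_sq]
      have : ((rightPinv G * G) *ᵥ w) ⬝ᵥ ((rightPinv G * G) *ᵥ w)
          = ((rightPinv G * G) *ᵥ w) ⬝ᵥ w := by
        rw [dotProduct_mulVec, ← mulVec_transpose, hsymm, mulVec_mulVec, hsq]
      rw [this]
      exact dotProduct_le_euclNorm_mul _ _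
    rw [mulVec_mulVec]
    by_contra! hlt
    have := euclNorm_nonneg w
    nlinarith
  · rw [rightPinv, nonsing_inv_apply_not_isUnit _ hdet, Matrix.mul_zero, zero_mulVec, euclNorm_zero]
    exact euclNorm_nonneg w

theorem gaussVec_submodule {s : Submodule ℝ (κ → ℝ)} (hs : s ≠ ⊤) : gaussVec κ s = 0 := by
  have h : gaussVec κ ≪ volume := by
    rw [gaussVec_eq_withDensity]
    exact withDensity_absolutelyContinuous _ _
  exact h (Measure.addHaar_submodule volume s hs)

theorem measurePreserving_vecCons_gaussMat (r : ℕ) :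
    MeasurePreserving (fun x : (κ → ℝ) × Matrix (Fin r) κ ℝ =>
        Matrix.of (vecCons x.1 (Matrix.of.symm x.2)))
      ((gaussVec κ).prod (gaussMat (Fin r) κ)) (gaussMat (Fin (r + 1)) κ) := by
  have h := (measurePreserving_piFinSuccAbove (α := fun _ => κ → ℝ) (fun _ => gaussVec κ)
    (0 : Fin (r + 1))).symm
  have hfun : ⇑(MeasurableEquiv.piFinSuccAbove (fun _ : Fin (r + 1) => κ → ℝ) 0).symm
      = fun x => vecCons x.1 x.2 := by
    funext x
    exact Fin.insertNth_zero' x.1 x.2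
  rw [hfun] at h
  exact h

theorem ae_linearIndependent_gaussMat (r : ℕ) (hr : r ≤ Fintype.card κ) :
    ∀ᵐ G ∂(gaussMat (Fin r) κ), LinearIndependent ℝ G.row := by
  induction r with
  | zero => exact ae_of_all _ fun G => linearIndependent_empty_type
  | succ r ih =>
    have hmp := measurePreserving_vecCons_gaussMat (κ := κ) r
    have hopen : ∀ r, MeasurableSet {G : Matrix (Fin r) κ ℝ | LinearIndependent ℝ G.row} :=
      fun r => (isOpen_setOfPred_linearIndependent (𝕜 := ℝ) (E := κ → ℝ) (ι := Fin r)).measurableSet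
    rw [← hmp.map_eq, ae_map_iff hmp.measurable.aemeasurable (hopen _)]
    have hset := hmp.measurable (hopen (r + 1))
    rw [← Measure.prod_swap]
    refine (ae_map_iff measurable_swap.aemeasurable hset).2 ?_
    refine (Measure.ae_prod_iff_ae_ae (measurable_swap hset)).2 ?_
    filter_upwards [ih (by omega)] with R hR
    have hspan : Submodule.span ℝ (Set.range R.row) ≠ ⊤ := by
      intro htop
      have h1 := finrank_span_eq_card hR
      rw [htop, finrank_top, Module.finrank_fintype_fun_eq_card, Fintype.card_fin] at h1
      omega
    have h0 : ∀ᵐ g ∂(gaussVec κ), g ∉ Submodule.span ℝ (Set.range R.row) := by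
      simpa [ae_iff] using gaussVec_submodule hspan
    filter_upwards [h0] with g hg
    exact linearIndependent_finCons.2 ⟨hR, hg⟩

theorem exists_orthonormal_rows_orthogonal {r d : ℕ} (hκ : Fintype.card κ = r + d)
    (R : Matrix (Fin r) κ ℝ) :
    ∃ Q : Matrix (Fin d) κ ℝ, Q * Qᵀ = 1 ∧ ∀ j, Q *ᵥ R j = 0 := by
  set S : Submodule ℝ (EuclideanSpace ℝ κ) :=
    Submodule.span ℝ (Set.range fun j => WithLp.toLp 2 (R j)) with hS
  have hd : d ≤ Module.finrank ℝ Sᗮ := by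
    have h1 := S.finrank_add_finrank_orthogonal
    rw [finrank_euclideanSpace, hκ] at h1
    have h2 : Module.finrank ℝ S ≤ r := by
      exact (finrank_range_le_card (R := ℝ) (fun j => WithLp.toLp 2 (R j))).trans_eq
        (Fintype.card_fin r)
    omega
  let b := stdOrthonormalBasis ℝ Sᗮ
  refine ⟨fun i => WithLp.ofLp (b (Fin.castLE hd i) : EuclideanSpace ℝ κ), ?_, fun j => ?_⟩
  · ext i j
    have h := orthonormal_iff_ite.1 b.orthonormal (Fin.castLE hd j) (Fin.castLE hd i)
    rw [Submodule.coe_inner, EuclideanSpace.inner_eq_star_dotProduct] at h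
    rw [one_apply]
    simp only [star_trivial] at h
    refine Eq.trans ?_ (h.trans ?_)
    · rfl
    · simp [eq_comm]
  · funext i
    have h := Submodule.inner_right_of_mem_orthogonal (𝕜 := ℝ) (K := S)
      (u := WithLp.toLp 2 (R j)) (Submodule.subset_span ⟨j, rfl⟩) (b (Fin.castLE hd i)).2
    rw [EuclideanSpace.inner_eq_star_dotProduct] at h
    exact h

theorem ofReal_euclNorm_rightPinv_cons_le {r d : ℕ} {R : Matrix (Fin r) κ ℝ}
    {Q : Matrix (Fin d) κ ℝ} (hQ : Q * Qᵀ = 1) (hQR : ∀ j, Q *ᵥ R j = 0) (g : κ → ℝ) :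
    ENNReal.ofReal (euclNorm (rightPinv (Matrix.of (vecCons g (Matrix.of.symm R))) *ᵥ Pi.single 0 1))
      ≤ (ENNReal.ofReal (euclNorm (Q *ᵥ g)))⁻¹ := by
  by_cases h0 : Q *ᵥ g = 0
  · simp [h0, euclNorm_zero]
  have hpos : 0 < euclNorm (Q *ᵥ g) := lt_of_le_of_ne (euclNorm_nonneg _)
    fun h => h0 (euclNorm_eq_zero.1 h.symm)
  set G : Matrix (Fin (r + 1)) κ ℝ := Matrix.of (vecCons g (Matrix.of.symm R)) with hG
  set w : κ → ℝ := (euclNorm (Q *ᵥ g) ^ 2)⁻¹ • (Qᵀ *ᵥ (Q *ᵥ g)) with hw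
  have hGw : G *ᵥ w = Pi.single 0 1 := by
    funext j
    rw [hw, mulVec_smul, Pi.smul_apply, smul_eq_mul]
    change _ * (G j ⬝ᵥ (Qᵀ *ᵥ (Q *ᵥ g))) = _
    rw [dotProduct_mulVec, vecMul_transpose]
    refine Fin.cases ?_ (fun j => ?_) j
    · rw [Pi.single_eq_same, show G 0 = g from rfl, ← euclNorm_sq, inv_mul_cancel₀ (by positivity)]
    · rw [Pi.single_eq_of_ne (Fin.succ_ne_zero j), show G j.succ = R j from rfl, hQR,
        zero_dotProduct, mul_zero]
  have hnw : euclNorm w = (euclNorm (Q *ᵥ g))⁻¹ := by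
    have h1 : euclNorm (Qᵀ *ᵥ (Q *ᵥ g)) = euclNorm (Q *ᵥ g) := by
      rw [euclNorm_eq_sqrt, euclNorm_eq_sqrt (Q *ᵥ g), dotProduct_mulVec, vecMul_transpose,
        mulVec_mulVec, hQ, one_mulVec]
    rw [hw, euclNorm_smul, h1, abs_of_nonneg (by positivity)]
    field_simp
  rw [← ENNReal.ofReal_inv_of_pos hpos, ← hnw, ← hGw]
  exact ENNReal.ofReal_le_ofReal (euclNorm_rightPinv_mulVec_le G w)

end PseudoInverse

section Jensen

variable {Ω : Type*} [MeasurableSpace Ω] {μ : Measure Ω} [IsProbabilityMeasure μ]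

theorem lintegral_rpow_le_lintegral_rpow {f : Ω → ℝ≥0∞} (hf : AEMeasurable f μ) {s : ℝ}
    (hs : 1 ≤ s) : (∫⁻ x, f x ∂μ) ^ s ≤ ∫⁻ x, f x ^ s ∂μ := by
  rcases hs.eq_or_lt with rfl | hs
  · simp
  have h := ENNReal.lintegral_mul_le_Lp_mul_Lq μ (Real.HolderConjugate.conjExponent hs) hf
    (aemeasurable_const (b := (1 : ℝ≥0∞)))
  simp only [Pi.mul_apply, mul_one, ENNReal.one_rpow, lintegral_const, measure_univ] at h
  calc (∫⁻ x, f x ∂μ) ^ s ≤ ((∫⁻ x, f x ^ s ∂μ) ^ (1 / s)) ^ s :=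
        ENNReal.rpow_le_rpow h (by linarith)
    _ = ∫⁻ x, f x ^ s ∂μ := by
        rw [← ENNReal.rpow_mul, one_div_mul_cancel (by linarith), ENNReal.rpow_one]

theorem lintegral_le_of_lintegral_pow_le {f : Ω → ℝ≥0∞} (hf : AEMeasurable f μ) {n : ℕ}
    (hn : n ≠ 0) {c : ℝ≥0∞} (h : ∫⁻ x, f x ^ n ∂μ ≤ c ^ n) : ∫⁻ x, f x ∂μ ≤ c := by
  have h1 := lintegral_rpow_le_lintegral_rpow hf (s := n)
    (by exact_mod_cast Nat.one_le_iff_ne_zero.2 hn)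
  simp only [ENNReal.rpow_natCast] at h1
  exact (ENNReal.pow_le_pow_left_iff hn).1 (h1.trans h)

theorem lintegral_rpow_le_rpow_lintegral {f : Ω → ℝ≥0∞} (hf : AEMeasurable f μ) {s : ℝ}
    (hs : 0 < s) (hs1 : s ≤ 1) : ∫⁻ x, f x ^ s ∂μ ≤ (∫⁻ x, f x ∂μ) ^ s := by
  have h := lintegral_rpow_le_lintegral_rpow (hf.pow_const s) (s := 1 / s)
    (by rw [le_div_iff₀ hs]; linarith)
  simp only [← ENNReal.rpow_mul, mul_one_div_cancel hs.ne', ENNReal.rpow_one] at h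
  calc ∫⁻ x, f x ^ s ∂μ = ((∫⁻ x, f x ^ s ∂μ) ^ (1 / s)) ^ s := by
        rw [← ENNReal.rpow_mul, one_div_mul_cancel hs.ne', ENNReal.rpow_one]
    _ ≤ _ := ENNReal.rpow_le_rpow h hs.le

end Jensen

section PseudoInverseMoments

variable {ρ κ : Type*} [Fintype ρ] [Fintype κ]

theorem measurable_rightPinv_mulVec [DecidableEq ρ] :
    Measurable fun x : Matrix ρ κ ℝ × (ρ → ℝ) => rightPinv x.1 *ᵥ x.2 := by
  refine measurable_pi_lambda _ fun i => ?_
  simp only [mulVec, dotProduct]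
  refine Finset.measurable_fun_sum _ fun j _ => Measurable.mul ?_ ?_
  · exact (measurable_matrix_entry i j).comp (measurable_rightPinv.comp measurable_fst)
  · exact (measurable_pi_apply j).comp measurable_snd

theorem lintegral_euclNorm_rightPinv_single_le {r p a : ℕ} (hκ : Fintype.card κ = r + 1 + p)
    (ha : 2 * a ≤ p) :
    ∫⁻ G, ENNReal.ofReal (euclNorm (rightPinv G *ᵥ Pi.single (0 : Fin (r + 1)) 1)) ^ (2 * a)
        ∂(gaussMat (Fin (r + 1)) κ)
      ≤ ENNReal.ofReal (∏ i ∈ Finset.range a, ((p : ℝ) - 1 - 2 * i)⁻¹) := by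
  have hF : Measurable fun G : Matrix (Fin (r + 1)) κ ℝ =>
      ENNReal.ofReal (euclNorm (rightPinv G *ᵥ Pi.single (0 : Fin (r + 1)) 1)) ^ (2 * a) :=
    (ENNReal.measurable_ofReal.comp (measurable_euclNorm.comp
      (measurable_rightPinv_mulVec.comp (measurable_id.prodMk measurable_const)))).pow_const _
  have hmp := measurePreserving_vecCons_gaussMat (κ := κ) r
  rw [← hmp.lintegral_comp hF]
  refine (lintegral_prod_symm' _ (hF.comp hmp.measurable)).trans_le ?_
  refine (lintegral_mono fun R => ?_).trans_eq (b := ∫⁻ _ : Matrix (Fin r) κ ℝ,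
    ENNReal.ofReal (∏ i ∈ Finset.range a, ((p : ℝ) - 1 - 2 * i)⁻¹) ∂(gaussMat (Fin r) κ)) (by simp)
  obtain ⟨Q, hQ, hQR⟩ := exists_orthonormal_rows_orthogonal (d := p + 1) (by omega) R
  have hQm : Measurable fun g : κ → ℝ => Q *ᵥ g := measurable_mulVec Q
  calc _ ≤ ∫⁻ g, (ENNReal.ofReal (euclNorm (Q *ᵥ g)))⁻¹ ^ (2 * a) ∂(gaussVec κ) :=
        lintegral_mono fun g =>
          pow_le_pow_left' (ofReal_euclNorm_rightPinv_cons_le hQ hQR g) (2 * a)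
    _ = ∫⁻ y, (ENNReal.ofReal (euclNorm y))⁻¹ ^ (2 * a) ∂(gaussVec (Fin (p + 1))) := by
        rw [← gaussVec_map_mulVec Q hQ, lintegral_map _ hQm]
        exact (ENNReal.measurable_ofReal.comp measurable_euclNorm).inv.pow_const _
    _ = _ := by
        rw [lintegral_euclNorm_inv_pow a (by simp; omega)]
        congr 1
        refine Finset.prod_congr rfl fun i _ => ?_
        rw [Fintype.card_fin]
        push_cast
        ring

theorem exists_orthogonal_mulVec_eq {r : ℕ} (v : Fin (r + 1) → ℝ) :
    ∃ U : Matrix (Fin (r + 1)) (Fin (r + 1)) ℝ, Uᵀ * U = 1 ∧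
      Uᵀ *ᵥ v = euclNorm v • Pi.single 0 1 := by
  obtain ⟨u, hu, hv⟩ : ∃ u : EuclideanSpace ℝ (Fin (r + 1)), ‖u‖ = 1 ∧
      WithLp.toLp 2 v = euclNorm v • u := by
    by_cases h : v = 0
    · exact ⟨EuclideanSpace.single 0 1, by simp, by simp [h, euclNorm_zero]⟩
    · have h0 : euclNorm v ≠ 0 := fun h' => h (euclNorm_eq_zero.1 h')
      refine ⟨(euclNorm v)⁻¹ • WithLp.toLp 2 v, ?_, ?_⟩
      · rw [norm_smul, norm_inv, Real.norm_of_nonneg (euclNorm_nonneg v)]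
        exact inv_mul_cancel₀ h0
      · rw [smul_smul, mul_inv_cancel₀ h0, one_smul]
  have hon : Orthonormal ℝ (({0} : Set (Fin (r + 1))).domRestrict fun _ => u) := by
    rw [orthonormal_iff_ite]
    intro i j
    rw [if_pos (Subsingleton.elim i j)]
    exact (real_inner_self_eq_norm_sq u).trans (by rw [hu, one_pow])
  obtain ⟨b, hb⟩ := hon.exists_orthonormalBasis_extension_of_card_eq
    (by simp)
  have hb0 : b 0 = u := hb 0 rfl
  refine ⟨Matrix.of fun i j => b j i, ?_, ?_⟩
  · ext i j
    have h := orthonormal_iff_ite.1 b.orthonormal j i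
    rw [EuclideanSpace.inner_eq_star_dotProduct] at h
    rw [one_apply]
    refine Eq.trans rfl (h.trans ?_)
    simp [eq_comm]
  · funext i
    have h : ⟪b i, WithLp.toLp 2 v⟫ = euclNorm v * if i = 0 then 1 else 0 := by
      rw [hv, inner_smul_right, ← hb0, orthonormal_iff_ite.1 b.orthonormal i 0]
    rw [EuclideanSpace.inner_eq_star_dotProduct, dotProduct_comm] at h
    refine Eq.trans rfl (h.trans ?_)
    simp [Pi.single_apply]

theorem lintegral_euclNorm_rightPinv_mulVec_le {r p a : ℕ} (hκ : Fintype.card κ = r + 1 + p)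
    (ha : 2 * a ≤ p) (v : Fin (r + 1) → ℝ) :
    ∫⁻ G, ENNReal.ofReal (euclNorm (rightPinv G *ᵥ v)) ^ (2 * a)
        ∂(gaussMat (Fin (r + 1)) κ)
      ≤ ENNReal.ofReal (euclNorm v) ^ (2 * a)
        * ENNReal.ofReal (∏ i ∈ Finset.range a, ((p : ℝ) - 1 - 2 * i)⁻¹) := by
  obtain ⟨U, hU, hUv⟩ := exists_orthogonal_mulVec_eq v
  have hF : ∀ v, Measurable fun G : Matrix (Fin (r + 1)) κ ℝ =>
      ENNReal.ofReal (euclNorm (rightPinv G *ᵥ v)) ^ (2 * a) := fun v =>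
    (ENNReal.measurable_ofReal.comp (measurable_euclNorm.comp
      (measurable_rightPinv_mulVec.comp (measurable_id.prodMk measurable_const)))).pow_const _
  rw [← (measurePreserving_mul_gaussMat (κ := κ) U (mul_eq_one_comm.1 hU)).lintegral_comp (hF v)]
  simp only [rightPinv_mul_left U hU, ← mulVec_mulVec, hUv, mulVec_smul, euclNorm_smul,
    abs_of_nonneg (euclNorm_nonneg v), ENNReal.ofReal_mul (euclNorm_nonneg v), mul_pow]
  rw [lintegral_const_mul _ (hF _)]
  gcongr
  exact lintegral_euclNorm_rightPinv_single_le hκ ha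

theorem lintegral_sqrt_frobSq_rightPinv_le {r p : ℕ} (hκ : Fintype.card κ = r + 1 + p)
    (hp : 2 ≤ p) :
    ∫⁻ G, ENNReal.ofReal (√(frobSq (rightPinv G))) ∂(gaussMat (Fin (r + 1)) κ)
      ≤ ENNReal.ofReal (√(((r + 1 : ℕ) : ℝ) / ((p : ℝ) - 1))) := by
  have hp' : (2 : ℝ) ≤ p := by exact_mod_cast hp
  have hent : ∀ i j, Measurable fun G : Matrix (Fin (r + 1)) κ ℝ => rightPinv G i j :=
    fun i j => (measurable_matrix_entry i j).comp measurable_rightPinv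
  have hmeas : Measurable fun G : Matrix (Fin (r + 1)) κ ℝ => frobSq (rightPinv G) :=
    Finset.measurable_fun_sum _ fun i _ => Finset.measurable_fun_sum _ fun j _ =>
      (hent i j).pow_const 2
  refine lintegral_le_of_lintegral_pow_le
    (ENNReal.measurable_ofReal.comp hmeas.sqrt).aemeasurable two_ne_zero ?_
  have hsq : ∀ G : Matrix (Fin (r + 1)) κ ℝ, ENNReal.ofReal (√(frobSq (rightPinv G))) ^ 2
      = ENNReal.ofReal (frobSq (rightPinv G)) := fun G => by
    rw [← ENNReal.ofReal_pow (Real.sqrt_nonneg _), Real.sq_sqrt (frobSq_nonneg _)]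
  refine (lintegral_congr hsq).trans_le ?_
  rw [← ENNReal.ofReal_pow (Real.sqrt_nonneg _),
    Real.sq_sqrt (div_nonneg (Nat.cast_nonneg _) (by linarith))]
  have hsum : ∀ G : Matrix (Fin (r + 1)) κ ℝ, ENNReal.ofReal (frobSq (rightPinv G))
      = ∑ j, ENNReal.ofReal (euclNorm (rightPinv G *ᵥ Pi.single j 1)) ^ (2 * 1) := fun G => by
    simp only [mul_one, ← ENNReal.ofReal_pow (euclNorm_nonneg _)]
    rw [← ENNReal.ofReal_sum_of_nonneg fun j _ => sq_nonneg _, frobSq, Finset.sum_comm]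
    congr 1
    refine Finset.sum_congr rfl fun j _ => ?_
    rw [euclNorm_sq, mulVec_single_one, dotProduct]
    exact Finset.sum_congr rfl fun i _ => sq _
  have hF : ∀ v, Measurable fun G : Matrix (Fin (r + 1)) κ ℝ =>
      ENNReal.ofReal (euclNorm (rightPinv G *ᵥ v)) ^ (2 * 1) := fun v =>
    (ENNReal.measurable_ofReal.comp (measurable_euclNorm.comp
      (measurable_rightPinv_mulVec.comp (measurable_id.prodMk measurable_const)))).pow_const _
  rw [lintegral_congr hsum, lintegral_finsetSum _ fun j _ => hF _]
  refine (Finset.sum_le_sum fun j _ =>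
    lintegral_euclNorm_rightPinv_mulVec_le hκ (a := 1) hp (Pi.single j 1)).trans_eq ?_
  have h1 : ∀ j : Fin (r + 1), euclNorm (Pi.single j (1 : ℝ)) = 1 := fun j => by
    rw [euclNorm_eq_sqrt]
    simp
  simp only [h1]
  simp only [ENNReal.ofReal_one, one_pow, one_mul, Finset.prod_range_one, Nat.cast_zero, mul_zero,
    sub_zero, Finset.sum_const, Finset.card_univ, Fintype.card_fin, nsmul_eq_mul]
  rw [div_eq_mul_inv, ENNReal.ofReal_mul (Nat.cast_nonneg _), ENNReal.ofReal_natCast]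

end PseudoInverseMoments

section DoubleFactorialBound

theorem mul_log_sub_le_two_mul_log {c : ℝ} (hc : 1 ≤ c) :
    ((c + 1) * Real.log (c + 1) - (c + 1)) - ((c - 1) * Real.log (c - 1) - (c - 1))
      ≤ 2 * Real.log c := by
  have hmono : ∫ t in (c - 1)..(c + 1), Real.log t
      ≤ ∫ t in (c - 1)..(c + 1), (Real.log c + (t / c - 1)) := by
    refine intervalIntegral.integral_mono_on_of_le_Ioo (by linarith)
      intervalIntegral.intervalIntegrable_log'
      (Continuous.intervalIntegrable (by fun_prop) _ _) fun t ht => ?_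
    have ht0 : 0 < t := by linarith [ht.1]
    have h := Real.log_le_sub_one_of_pos (show 0 < t / c by positivity)
    rw [Real.log_div ht0.ne' (by linarith)] at h
    linarith
  have hright : ∫ t in (c - 1)..(c + 1), (Real.log c + (t / c - 1)) = 2 * Real.log c := by
    have hF : ∀ t ∈ Set.uIcc (c - 1) (c + 1),
        HasDerivAt (fun t => t * Real.log c + (t ^ 2 / (2 * c) - t)) (Real.log c + (t / c - 1)) t :=
      fun t _ => by
        have h := ((hasDerivAt_id t).mul_const (Real.log c)).add
          ((((hasDerivAt_id t).pow 2).div_const (2 * c)).sub (hasDerivAt_id t))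
        refine h.congr_deriv ?_
        simp only [id]
        field_simp
        ring
    rw [intervalIntegral.integral_eq_sub_of_hasDerivAt hF
      (Continuous.intervalIntegrable (by fun_prop) _ _)]
    field_simp
    ring
  rw [integral_log, hright] at hmono
  linarith

theorem pow_le_exp_pow_mul_prod {p : ℕ} (hp : 2 ≤ p) :
    (p : ℝ) ^ (2 * (p / 2)) ≤ Real.exp 1 ^ (2 * (p / 2))
      * ((∏ i ∈ Finset.range (p / 2), (1 + 2 * (i : ℝ)))
        * ∏ i ∈ Finset.range (p / 2), ((p : ℝ) - 1 - 2 * i)) := by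
  set a := p / 2 with ha
  have hpR : (2 : ℝ) ≤ p := by exact_mod_cast hp
  have hi : ∀ i ∈ Finset.range a, 1 ≤ (p : ℝ) - 1 - 2 * i := fun i hi => by
    have h : 2 * i + 2 ≤ p := by have := Finset.mem_range.1 hi; omega
    have h' : 2 * (i : ℝ) + 2 ≤ p := by exact_mod_cast h
    linarith
  let F : ℝ → ℝ := fun t => t * Real.log t - t
  have hodd : F (2 * a) - F 0 ≤ ∑ i ∈ Finset.range a, 2 * Real.log (1 + 2 * (i : ℝ)) := by
    have h := Finset.sum_range_sub (fun i : ℕ => F (2 * i)) a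
    simp only [Nat.cast_zero, mul_zero] at h
    rw [← h]
    refine Finset.sum_le_sum fun i _ => ?_
    have h := mul_log_sub_le_two_mul_log (c := 1 + 2 * (i : ℝ))
      (by have := i.cast_nonneg (α := ℝ); linarith)
    rw [show 1 + 2 * (i : ℝ) + 1 = 2 * ((i + 1 : ℕ) : ℝ) by push_cast; ring,
      show 1 + 2 * (i : ℝ) - 1 = 2 * i by ring] at h
    exact h
  have heven : F p - F (p - 2 * a)
      ≤ ∑ i ∈ Finset.range a, 2 * Real.log ((p : ℝ) - 1 - 2 * i) := by
    have h := Finset.sum_range_sub' (fun i : ℕ => F (p - 2 * i)) a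
    simp only [Nat.cast_zero, mul_zero, sub_zero] at h
    rw [← h]
    refine Finset.sum_le_sum fun i hi' => ?_
    have h := mul_log_sub_le_two_mul_log (hi i hi')
    rw [show (p : ℝ) - 1 - 2 * i + 1 = p - 2 * i by ring,
      show (p : ℝ) - 1 - 2 * i - 1 = p - 2 * ((i + 1 : ℕ) : ℝ) by push_cast; ring] at h
    exact h
  have hpos1 : ∀ i ∈ Finset.range a, 0 < 1 + 2 * (i : ℝ) := fun i _ => by positivity
  have hpos2 : ∀ i ∈ Finset.range a, 0 < (p : ℝ) - 1 - 2 * i := fun i h => by linarith [hi i h]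
  have hmain : 2 * ((2 * a : ℕ) * Real.log p)
      ≤ 2 * ((2 * a : ℕ) * 1) + (F (2 * a) - F 0) + (F p - F (p - 2 * a)) := by
    simp only [F]
    rcases Nat.even_or_odd' p with ⟨b, hb | hb⟩
    · have hab : a = b := by omega
      rw [hab, show (p : ℝ) = 2 * b by rw [hb]; push_cast; ring]
      push_cast
      simp only [sub_self, zero_mul]
      linarith
    · have hab : a = b := by omega
      have hb1 : 1 ≤ b := by omega
      have hbR : (1 : ℝ) ≤ b := by exact_mod_cast hb1
      rw [hab, show (p : ℝ) = 2 * b + 1 by rw [hb]; push_cast; ring]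
      push_cast
      have h1 : Real.log (2 * b + 1) ≤ Real.log (2 * b) + 1 / (2 * b) := by
        have h := Real.log_le_sub_one_of_pos (show 0 < (2 * (b : ℝ) + 1) / (2 * b) by positivity)
        rw [Real.log_div (by positivity) (by positivity)] at h
        have h2 : (2 * (b : ℝ) + 1) / (2 * b) - 1 = 1 / (2 * b) := by field_simp; ring
        linarith
      have h2 : 2 * (b : ℝ) * Real.log (2 * b + 1) ≤ 2 * b * Real.log (2 * b) + 1 := by
        have h := mul_le_mul_of_nonneg_left h1 (show 0 ≤ 2 * (b : ℝ) by positivity)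
        have h3 : 2 * (b : ℝ) * (Real.log (2 * b) + 1 / (2 * b))
            = 2 * b * Real.log (2 * b) + 1 := by field_simp
        linarith
      have h3 : 1 ≤ Real.log (2 * b + 1) := by
        rw [Real.le_log_iff_exp_le (by positivity)]
        have := Real.exp_one_lt_d9
        linarith
      rw [show 2 * (b : ℝ) + 1 - 2 * b = 1 by ring, Real.log_one]
      linarith
  have hlog1 : ∑ i ∈ Finset.range a, 2 * Real.log (1 + 2 * (i : ℝ))
      = 2 * Real.log (∏ i ∈ Finset.range a, (1 + 2 * (i : ℝ))) := by
    rw [Real.log_prod fun i h => (hpos1 i h).ne', Finset.mul_sum]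
  have hlog2 : ∑ i ∈ Finset.range a, 2 * Real.log ((p : ℝ) - 1 - 2 * i)
      = 2 * Real.log (∏ i ∈ Finset.range a, ((p : ℝ) - 1 - 2 * i)) := by
    rw [Real.log_prod fun i h => (hpos2 i h).ne', Finset.mul_sum]
  have hP1 := Finset.prod_pos hpos1
  have hP2 := Finset.prod_pos hpos2
  refine (Real.log_le_log_iff (by positivity) (by positivity)).1 ?_
  rw [Real.log_pow, Real.log_mul (by positivity) (by positivity), Real.log_pow, Real.log_exp,
    Real.log_mul hP1.ne' hP2.ne']
  linarith

end DoubleFactorialBound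

section OperatorNormMoments

variable {ρ κ : Type*} [Fintype ρ] [Fintype κ]

theorem lintegral_abs_pow_gaussianReal (a : ℕ) :
    ∫⁻ x, ENNReal.ofReal |x| ^ (2 * a) ∂(gaussianReal 0 1)
      = ENNReal.ofReal (∏ i ∈ Finset.range a, (1 + 2 * (i : ℝ))) := by
  have h := lintegral_euclNorm_pow (κ := Unit) a
  rw [Fintype.card_unit, Nat.cast_one] at h
  have hm : Measurable fun x : ℝ => ENNReal.ofReal |x| ^ (2 * a) :=
    (ENNReal.measurable_ofReal.comp measurable_id.abs).pow_const _
  rw [← h, ← (measurePreserving_eval (fun _ : Unit => gaussianReal 0 1) ()).lintegral_comp hm]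
  refine lintegral_congr fun x => ?_
  rw [euclNorm_eq_sqrt]
  simp [dotProduct, Real.sqrt_mul_self_eq_abs]

theorem opNorm_pow_mul_le_lintegral [DecidableEq ρ] [DecidableEq κ] (M : Matrix κ ρ ℝ) {a : ℕ}
    (ha : a ≠ 0) :
    ENNReal.ofReal ‖M‖ ^ (2 * a) * ENNReal.ofReal (∏ i ∈ Finset.range a, (1 + 2 * (i : ℝ)))
      ≤ ∫⁻ v, ENNReal.ofReal (euclNorm (M *ᵥ v)) ^ (2 * a) ∂(gaussVec ρ) := by
  set X := ∫⁻ v, ENNReal.ofReal (euclNorm (M *ᵥ v)) ^ (2 * a) ∂(gaussVec ρ) with hX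
  set c := ENNReal.ofReal (∏ i ∈ Finset.range a, (1 + 2 * (i : ℝ))) with hc
  have hc0 : c ≠ 0 := (ENNReal.ofReal_pos.2 (Finset.prod_pos fun i _ => by positivity)).ne'
  have hct : c ≠ ⊤ := ENNReal.ofReal_ne_top
  by_cases hXt : X = ⊤
  · rw [hXt]
    exact le_top
  have h2a : 2 * a ≠ 0 := by omega
  have key : ∀ y : κ → ℝ, ENNReal.ofReal (euclNorm (Mᵀ *ᵥ y)) ^ (2 * a) * c
      ≤ ENNReal.ofReal (euclNorm y) ^ (2 * a) * X := fun y => by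
    have hm : Measurable fun x : ℝ => ENNReal.ofReal |x| ^ (2 * a) :=
      (ENNReal.measurable_ofReal.comp measurable_id.abs).pow_const _
    have h1 : ENNReal.ofReal (euclNorm (Mᵀ *ᵥ y)) ^ (2 * a) * c
        = ∫⁻ v, ENNReal.ofReal |(Mᵀ *ᵥ y) ⬝ᵥ v| ^ (2 * a) ∂(gaussVec ρ) := by
      rw [← lintegral_map hm (measurable_dotProduct_left (Mᵀ *ᵥ y)), map_dotProduct_gaussVec,
        lintegral_map hm (measurable_const_mul _)]
      simp only [abs_mul, abs_of_nonneg (euclNorm_nonneg _), ENNReal.ofReal_mul (euclNorm_nonneg _),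
        mul_pow]
      rw [lintegral_const_mul _ hm, lintegral_abs_pow_gaussianReal]
    rw [h1, ← lintegral_const_mul']
    · refine lintegral_mono fun v => ?_
      simp only [← mul_pow, ← ENNReal.ofReal_mul (euclNorm_nonneg y)]
      refine pow_le_pow_left' (ENNReal.ofReal_le_ofReal ?_) _
      rw [mulVec_transpose, ← dotProduct_mulVec]
      refine abs_le'.2 ⟨dotProduct_le_euclNorm_mul _ _, ?_⟩
      rw [← neg_dotProduct, ← euclNorm_neg y]
      exact dotProduct_le_euclNorm_mul _ _
    · exact ENNReal.pow_ne_top ENNReal.ofReal_ne_top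
  set D : ℝ≥0∞ := (X / c) ^ ((1 : ℝ) / (2 * a : ℕ)) with hD
  have hDpow : D ^ (2 * a) = X / c := by
    rw [hD, ← ENNReal.rpow_natCast, ← ENNReal.rpow_mul,
      one_div_mul_cancel (by exact_mod_cast h2a), ENNReal.rpow_one]
  have hDt : D ≠ ⊤ := ENNReal.rpow_ne_top_of_nonneg (by positivity) (ENNReal.div_ne_top hXt hc0)
  have hM : ‖M‖ ≤ D.toReal := by
    rw [← opNorm_transpose]
    refine opNorm_le_of_euclNorm ENNReal.toReal_nonneg fun y => ?_
    have h1 : ENNReal.ofReal (euclNorm (Mᵀ *ᵥ y)) ≤ D * ENNReal.ofReal (euclNorm y) := by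
      rw [← ENNReal.pow_le_pow_left_iff h2a, mul_pow, hDpow, mul_comm (X / c),
        ← mul_div_assoc, ENNReal.le_div_iff_mul_le (Or.inl hc0) (Or.inl hct)]
      exact key y
    rw [← ENNReal.ofReal_toReal hDt, ← ENNReal.ofReal_mul ENNReal.toReal_nonneg] at h1
    exact (ENNReal.ofReal_le_ofReal_iff
      (mul_nonneg ENNReal.toReal_nonneg (euclNorm_nonneg y))).1 h1
  calc _ ≤ D ^ (2 * a) * c := by
        refine mul_le_mul_left (pow_le_pow_left' ?_ _) _
        exact (ENNReal.ofReal_le_ofReal hM).trans_eq (ENNReal.ofReal_toReal hDt)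
    _ = X := by rw [hDpow, ENNReal.div_mul_cancel hc0 hct]

theorem lintegral_opNorm_rightPinv_le [DecidableEq κ] {r p : ℕ}
    (hκ : Fintype.card κ = r + 1 + p) (hp : 2 ≤ p) :
    ∫⁻ G, ENNReal.ofReal ‖rightPinv G‖ ∂(gaussMat (Fin (r + 1)) κ)
      ≤ ENNReal.ofReal (Real.exp 1 * √(((r + 1 : ℕ) : ℝ) + p) / p) := by
  have hpR : (2 : ℝ) ≤ p := by exact_mod_cast hp
  set a := p / 2 with ha
  have ha0 : a ≠ 0 := by omega
  have hap : 2 * a ≤ p := by omega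
  have hTm : Measurable fun G : Matrix (Fin (r + 1)) κ ℝ => ENNReal.ofReal ‖rightPinv G‖ :=
    ENNReal.measurable_ofReal.comp (measurable_opNorm.comp measurable_rightPinv)
  refine lintegral_le_of_lintegral_pow_le hTm.aemeasurable (n := 2 * a) (by omega) ?_
  set c := ∏ i ∈ Finset.range a, (1 + 2 * (i : ℝ)) with hc
  set d := ∏ i ∈ Finset.range a, ((p : ℝ) - 1 - 2 * i) with hd
  set M := ∏ i ∈ Finset.range a, (((r + 1 : ℕ) : ℝ) + 2 * i) with hMdef
  have hcpos : 0 < c := Finset.prod_pos fun i _ => by positivity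
  have hdpos : 0 < d := Finset.prod_pos fun i hi => by
    have h : 2 * i + 2 ≤ p := by have := Finset.mem_range.1 hi; omega
    have h' : 2 * (i : ℝ) + 2 ≤ p := by exact_mod_cast h
    linarith
  have hF : Measurable fun x : Matrix (Fin (r + 1)) κ ℝ × (Fin (r + 1) → ℝ) =>
      ENNReal.ofReal (euclNorm (rightPinv x.1 *ᵥ x.2)) ^ (2 * a) :=
    (ENNReal.measurable_ofReal.comp (measurable_euclNorm.comp
      measurable_rightPinv_mulVec)).pow_const _
  have hN : Measurable fun v : Fin (r + 1) → ℝ => ENNReal.ofReal (euclNorm v) ^ (2 * a) :=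
    (ENNReal.measurable_ofReal.comp measurable_euclNorm).pow_const _
  have h1 : (∫⁻ G, ENNReal.ofReal ‖rightPinv G‖ ^ (2 * a) ∂(gaussMat (Fin (r + 1)) κ))
      * ENNReal.ofReal c ≤ ENNReal.ofReal M * ENNReal.ofReal d⁻¹ := by
    calc _ = ∫⁻ G, ENNReal.ofReal ‖rightPinv G‖ ^ (2 * a) * ENNReal.ofReal c
          ∂(gaussMat (Fin (r + 1)) κ) := (lintegral_mul_const _ (hTm.pow_const _)).symm
      _ ≤ ∫⁻ G, ∫⁻ v, ENNReal.ofReal (euclNorm (rightPinv G *ᵥ v)) ^ (2 * a)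
          ∂(gaussVec (Fin (r + 1))) ∂(gaussMat (Fin (r + 1)) κ) :=
        lintegral_mono fun G => opNorm_pow_mul_le_lintegral _ ha0
      _ = ∫⁻ v, ∫⁻ G, ENNReal.ofReal (euclNorm (rightPinv G *ᵥ v)) ^ (2 * a)
          ∂(gaussMat (Fin (r + 1)) κ) ∂(gaussVec (Fin (r + 1))) :=
        lintegral_lintegral_swap hF.aemeasurable
      _ ≤ ∫⁻ v, ENNReal.ofReal (euclNorm v) ^ (2 * a) * ENNReal.ofReal d⁻¹
          ∂(gaussVec (Fin (r + 1))) := lintegral_mono fun v =>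
        (lintegral_euclNorm_rightPinv_mulVec_le hκ hap v).trans_eq
          (by rw [hd, Finset.prod_inv_distrib])
      _ = _ := by
        rw [lintegral_mul_const _ hN, lintegral_euclNorm_pow, Fintype.card_fin]
  have hk : 0 ≤ ((r + 1 : ℕ) : ℝ) + p := by positivity
  have hM : M ≤ (((r + 1 : ℕ) : ℝ) + p) ^ a := by
    refine (Finset.prod_le_prod (fun i _ => by positivity) fun i hi => ?_).trans_eq
      (b := ∏ _i ∈ Finset.range a, (((r + 1 : ℕ) : ℝ) + p)) (by simp)
    have h : 2 * i ≤ p := by have := Finset.mem_range.1 hi; omega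
    have h' : 2 * (i : ℝ) ≤ p := by exact_mod_cast h
    linarith
  have hnum : M * d⁻¹ ≤ (Real.exp 1 * √(((r + 1 : ℕ) : ℝ) + p) / p) ^ (2 * a) * c := by
    have hp0 : (0 : ℝ) < (p : ℝ) ^ (2 * a) := by positivity
    have hb := pow_le_exp_pow_mul_prod hp
    rw [← ha, ← hc, ← hd] at hb
    rw [div_pow, mul_pow, pow_mul √_, Real.sq_sqrt hk, ← div_eq_mul_inv, div_le_iff₀ hdpos]
    rw [show Real.exp 1 ^ (2 * a) * (((r + 1 : ℕ) : ℝ) + p) ^ a / (p : ℝ) ^ (2 * a) * c * d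
      = (((r + 1 : ℕ) : ℝ) + p) ^ a *
          ((Real.exp 1 ^ (2 * a) * (c * d)) / (p : ℝ) ^ (2 * a)) by ring]
    refine hM.trans (le_mul_of_one_le_right (by positivity) ?_)
    rwa [one_le_div hp0]
  have hcE0 : ENNReal.ofReal c ≠ 0 := (ENNReal.ofReal_pos.2 hcpos).ne'
  rw [← ENNReal.mul_le_mul_iff_left hcE0 ENNReal.ofReal_ne_top]
  refine h1.trans ?_
  rw [← ENNReal.ofReal_mul (Finset.prod_nonneg fun i _ => by positivity),
    ← ENNReal.ofReal_pow (by positivity), ← ENNReal.ofReal_mul (by positivity)]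
  exact ENNReal.ofReal_le_ofReal hnum

end OperatorNormMoments

section RangeFinder

theorem measurable_matrix_mul {α ι κ ν : Type*} [MeasurableSpace α] [Fintype ν]
    {f : α → Matrix ι ν ℝ} {g : α → Matrix ν κ ℝ} (hf : Measurable f) (hg : Measurable g) :
    Measurable fun x => f x * g x := by
  refine measurable_matrix_of fun i j => ?_
  simp only [Matrix.mul_apply]
  exact Finset.measurable_sum _ fun k _ =>
    ((measurable_matrix_entry i k).comp hf).mul ((measurable_matrix_entry k j).comp hg)

theorem measurable_opNorm_mul_mul_rightPinv {ρ ν ι κ : Type*} [Fintype ρ] [DecidableEq ρ]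
    [Fintype ν] [Fintype κ] [DecidableEq κ] [Fintype ι] (S : Matrix ι ν ℝ) :
    Measurable fun z : Matrix ρ κ ℝ × Matrix ν κ ℝ => ‖S * z.2 * rightPinv z.1‖ :=
  measurable_opNorm.comp (measurable_matrix_mul
    (measurable_matrix_mul measurable_const measurable_snd)
    (measurable_rightPinv.comp measurable_fst))

theorem lintegral_opNorm_mul_mul_rightPinv_le {κ ν ι : Type*} [Fintype κ] [DecidableEq κ]
    [Fintype ν] [DecidableEq ν] [Fintype ι] [DecidableEq ι] {r p : ℕ}
    (hκ : Fintype.card κ = r + 1 + p) (hp : 2 ≤ p) (S : Matrix ι ν ℝ) :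
    ∫⁻ z, ENNReal.ofReal ‖S * z.2 * rightPinv z.1‖
        ∂((gaussMat (Fin (r + 1)) κ).prod (gaussMat ν κ)) ≤
      ENNReal.ofReal (‖S‖ * √(((r + 1 : ℕ) : ℝ) / ((p : ℝ) - 1)) +
        Real.exp 1 * √(((r + 1 : ℕ) : ℝ) + p) / p * √(frobSq S)) := by
  have hmeas := (measurable_opNorm_mul_mul_rightPinv (ρ := Fin (r + 1)) (κ := κ) S).ennreal_ofReal
  have h1 : Measurable fun G : Matrix (Fin (r + 1)) κ ℝ =>
      ENNReal.ofReal (√(frobSq (rightPinv G))) := by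
    refine Measurable.ennreal_ofReal (Measurable.sqrt ?_)
    refine Finset.measurable_sum _ fun i _ => Finset.measurable_sum _ fun j _ => ?_
    exact ((measurable_matrix_entry i j).comp measurable_rightPinv).pow_const 2
  have hp0 : (0 : ℝ) < p := by exact_mod_cast (by omega : 0 < p)
  rw [lintegral_prod _ hmeas.aemeasurable]
  calc ∫⁻ G, ∫⁻ H, ENNReal.ofReal ‖S * H * rightPinv G‖ ∂(gaussMat ν κ)
        ∂(gaussMat (Fin (r + 1)) κ)
      ≤ ∫⁻ G, (ENNReal.ofReal ‖S‖ * ENNReal.ofReal (√(frobSq (rightPinv G))) +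
          ENNReal.ofReal (√(frobSq S)) * ENNReal.ofReal ‖rightPinv G‖)
          ∂(gaussMat (Fin (r + 1)) κ) := by
        refine lintegral_mono fun G => ?_
        rw [← ofReal_integral_eq_lintegral_ofReal (integrable_opNorm_mul_mul S _)
          (.of_forall fun _ => norm_nonneg _), ← ENNReal.ofReal_mul (norm_nonneg _),
          ← ENNReal.ofReal_mul (Real.sqrt_nonneg _), ← ENNReal.ofReal_add (by positivity)
            (by positivity)]
        exact ENNReal.ofReal_le_ofReal (integral_opNorm_mul_mul_le S _)
    _ = ENNReal.ofReal ‖S‖ * ∫⁻ G, ENNReal.ofReal (√(frobSq (rightPinv G)))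
            ∂(gaussMat (Fin (r + 1)) κ) +
          ENNReal.ofReal (√(frobSq S)) * ∫⁻ G, ENNReal.ofReal ‖rightPinv G‖
            ∂(gaussMat (Fin (r + 1)) κ) := by
        rw [lintegral_add_left (h1.const_mul _), lintegral_const_mul _ h1,
          lintegral_const_mul' _ _ ENNReal.ofReal_ne_top]
    _ ≤ ENNReal.ofReal ‖S‖ * ENNReal.ofReal (√(((r + 1 : ℕ) : ℝ) / ((p : ℝ) - 1))) +
          ENNReal.ofReal (√(frobSq S)) *
            ENNReal.ofReal (Real.exp 1 * √(((r + 1 : ℕ) : ℝ) + p) / p) := by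
        gcongr
        · exact lintegral_sqrt_frobSq_rightPinv_le hκ hp
        · exact lintegral_opNorm_rightPinv_le hκ hp
    _ = _ := by
        rw [← ENNReal.ofReal_mul (norm_nonneg _), ← ENNReal.ofReal_mul (Real.sqrt_nonneg _),
          ← ENNReal.ofReal_add (by positivity) (by positivity)]
        congr 1
        ring

theorem measurePreserving_toRows_gaussMat {ρ ν κ : Type*} [Fintype ρ] [Fintype ν] [Fintype κ] :
    MeasurePreserving (fun G : Matrix (ρ ⊕ ν) κ ℝ => (G.toRows₁, G.toRows₂))
      (gaussMat (ρ ⊕ ν) κ) ((gaussMat ρ κ).prod (gaussMat ν κ)) :=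
  measurePreserving_sumPiEquivProdPi (fun _ : ρ ⊕ ν => gaussVec κ)

end RangeFinder

section Truncation

variable {m n : ℕ} {ρ ν κ : Type*} [Fintype ρ] [Fintype ν] [Fintype κ] [DecidableEq ρ]
  [DecidableEq ν]

theorem gram_pow_mul (A : Matrix (Fin m) (Fin n) ℝ) (q : ℕ) :
    ((A * Aᵀ) ^ q * A)ᵀ * ((A * Aᵀ) ^ q * A) = (Aᵀ * A) ^ (2 * q + 1) := by
  have h1 : ∀ k, (A * Aᵀ) ^ k * A = A * (Aᵀ * A) ^ k := by
    intro k
    induction k with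
    | zero => simp
    | succ k ih => rw [pow_succ', Matrix.mul_assoc, ih, pow_succ']; simp only [Matrix.mul_assoc]
  have h2 : ((A * Aᵀ) ^ q)ᵀ = (A * Aᵀ) ^ q := by
    rw [Matrix.transpose_pow]; simp
  rw [Matrix.transpose_mul, h2, Matrix.mul_assoc, ← Matrix.mul_assoc ((A * Aᵀ) ^ q), ← pow_add, h1,
    ← Matrix.mul_assoc, pow_succ', ← two_mul]

theorem pow_mul_eq_mul_diagonal_pow {ι ι' : Type*} [Fintype ι] [DecidableEq ι] [Fintype ι']
    [DecidableEq ι'] {M : Matrix ι ι ℝ} {V : Matrix ι ι' ℝ} {d : ι' → ℝ}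
    (h : M * V = V * diagonal d) (k : ℕ) : M ^ k * V = V * diagonal (d ^ k) := by
  rw [← Matrix.diagonal_pow]
  induction k with
  | zero => simp
  | succ k ih => rw [pow_succ', Matrix.mul_assoc, ih, ← Matrix.mul_assoc, h, Matrix.mul_assoc,
      ← pow_succ']

theorem exists_orthogonal_diagonalization {M : Matrix (Fin n) (Fin n) ℝ} (hM : M.IsHermitian)
    (f : ρ ≃ Fin n) :
    ∃ V : Matrix (Fin n) ρ ℝ, Vᵀ * V = 1 ∧ V * Vᵀ = 1 ∧
      M * V = V * diagonal fun i => hM.eigenvalues (f i) := by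
  refine ⟨(hM.eigenvectorUnitary : Matrix (Fin n) (Fin n) ℝ).submatrix id f, ?_, ?_, ?_⟩
  · have h := Unitary.coe_star_mul_self hM.eigenvectorUnitary
    rw [star_eq_conjTranspose, conjTranspose_eq_transpose_of_trivial] at h
    rw [Matrix.transpose_submatrix, ← Matrix.submatrix_mul _ _ f id f Function.bijective_id, h,
      Matrix.submatrix_one_equiv]
  · have h := Unitary.coe_mul_star_self hM.eigenvectorUnitary
    rw [Unitary.coe_star, star_eq_conjTranspose, conjTranspose_eq_transpose_of_trivial] at h
    rw [Matrix.transpose_submatrix, ← Matrix.submatrix_mul _ _ id f id f.bijective, h,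
      Matrix.submatrix_id_id]
  · ext i j
    rw [Matrix.mul_diagonal]
    have h := congrFun (hM.mulVec_eigenvectorBasis (f j)) i
    simpa [Matrix.mul_apply, Matrix.mulVec, dotProduct, mul_comm] using h

theorem opNorm_sub_projection_mul_le [DecidableEq κ] {A : Matrix (Fin m) (Fin n) ℝ} {q : ℕ}
    {V : Matrix (Fin n) (ρ ⊕ ν) ℝ} (hV : V * Vᵀ = 1) (hV' : Vᵀ * V = 1) {s : ρ ⊕ ν → ℝ}
    (hAV : Aᵀ * A * V = V * diagonal fun i => s i ^ 2)
    {P : Matrix (Fin m) (Fin m) ℝ} {Ω : Matrix (Fin n) κ ℝ}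
    (h1 : P * P = P) (h2 : Pᵀ = P)
    (h3 : LinearMap.range P.mulVecLin = LinearMap.range ((A * Aᵀ) ^ q * A * Ω).mulVecLin)
    (hΩ : LinearIndependent ℝ (Vᵀ * Ω).toRows₁.row) :
    ‖A - P * A‖ ≤ (‖diagonal fun j => s (Sum.inr j) ^ (2 * q + 1)‖ +
      ‖(diagonal fun j => s (Sum.inr j) ^ (2 * q + 1)) * (Vᵀ * Ω).toRows₂ *
        rightPinv (Vᵀ * Ω).toRows₁‖) ^ ((1 : ℝ) / (2 * (q : ℝ) + 1)) := by
  set B := (A * Aᵀ) ^ q * A with hB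
  have hQ1 : (1 - P) * (1 - P) = 1 - P := by
    simp [Matrix.sub_mul, Matrix.mul_sub, h1]
  have hQ2 : (1 - P)ᵀ = 1 - P := by simp [h2]
  have hQn := opNorm_le_one_of_projection hQ1 hQ2
  have hPB : P * (B * Ω) = B * Ω := by
    refine Matrix.ext_of_mulVec_single fun i => ?_
    have hx : (B * Ω) *ᵥ Pi.single i 1 ∈ LinearMap.range P.mulVecLin := by
      rw [h3]; exact ⟨Pi.single i 1, rfl⟩
    obtain ⟨y, hy⟩ := hx
    rw [Matrix.mulVecLin_apply] at hy
    rw [← Matrix.mulVec_mulVec, ← hy, Matrix.mulVec_mulVec, h1]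
  have hQB : (1 - P) * (B * V) * (Vᵀ * Ω) = 0 := by
    have : (B * V) * (Vᵀ * Ω) = B * Ω := by
      rw [Matrix.mul_assoc, ← Matrix.mul_assoc V, hV, Matrix.one_mul]
    rw [Matrix.mul_assoc, this, Matrix.sub_mul, hPB, Matrix.one_mul, sub_self]
  have hW : (B * V)ᵀ * (B * V) = diagonal fun i => (s i ^ (2 * q + 1)) ^ 2 := by
    have hd := pow_mul_eq_mul_diagonal_pow hAV (2 * q + 1)
    rw [Matrix.transpose_mul, Matrix.mul_assoc, ← Matrix.mul_assoc Bᵀ, hB, gram_pow_mul, hd,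
      ← Matrix.mul_assoc, hV', Matrix.one_mul]
    congr 1
    ext i
    simp only [Pi.pow_apply]
    ring
  have hkey := opNorm_projection_mul_le (B * V) (fun i => s i ^ (2 * q + 1)) hW hQn
    (Vᵀ * Ω).toRows₁ (Vᵀ * Ω).toRows₂ (by rw [Matrix.fromRows_toRows]; exact hQB) _
    (mul_rightPinv hΩ)
  have hVn : ‖Vᵀ‖ ≤ 1 := by
    refine opNorm_le_of_euclNorm zero_le_one fun x => ?_
    rw [one_mul, euclNorm_eq_sqrt, euclNorm_eq_sqrt, Matrix.dotProduct_mulVec,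
      Matrix.vecMul_transpose, Matrix.mulVec_mulVec, hV, Matrix.one_mulVec]
  have hQBn : ‖(1 - P) * B‖ ≤ ‖(1 - P) * (B * V)‖ := by
    have : (1 - P) * B = (1 - P) * (B * V) * Vᵀ := by
      rw [Matrix.mul_assoc, Matrix.mul_assoc B, hV, Matrix.mul_one]
    calc ‖(1 - P) * B‖ = ‖(1 - P) * (B * V) * Vᵀ‖ := by rw [← this]
      _ ≤ ‖(1 - P) * (B * V)‖ * ‖Vᵀ‖ := Matrix.l2_opNorm_mul _ _
      _ ≤ ‖(1 - P) * (B * V)‖ * 1 := by gcongr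
      _ = _ := mul_one _
  have hA : A - P * A = (1 - P) * A := by rw [Matrix.sub_mul, Matrix.one_mul]
  rw [hA]
  refine (opNorm_projection_mul_le_rpow A hQ1 hQ2 q).trans ?_
  exact Real.rpow_le_rpow (norm_nonneg _) (hQBn.trans hkey) (by positivity)

end Truncation

theorem integral_le_of_lintegral_ofReal_le {α : Type*} [MeasurableSpace α] {μ : Measure α}
    {f : α → ℝ} {C : ℝ} (hf : ∀ x, 0 ≤ f x) (hC : 0 ≤ C)
    (h : ∫⁻ x, ENNReal.ofReal (f x) ∂μ ≤ ENNReal.ofReal C) : ∫ x, f x ∂μ ≤ C := by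
  by_cases hm : AEStronglyMeasurable f μ
  · rw [integral_eq_lintegral_of_nonneg_ae (.of_forall hf) hm]
    exact ENNReal.toReal_le_of_le_ofReal hC h
  · rwa [integral_undef fun hi => hm hi.aestronglyMeasurable]

theorem opNorm_diagonal_le {ν : Type*} [Fintype ν] [DecidableEq ν] {d : ν → ℝ} {c : ℝ}
    (hc : 0 ≤ c) (h0 : ∀ j, 0 ≤ d j) (h : ∀ j, d j ≤ c) : ‖diagonal d‖ ≤ c := by
  rw [Matrix.l2_opNorm_diagonal, pi_norm_le_iff_of_nonneg hc]
  exact fun j => by rw [Real.norm_of_nonneg (h0 j)]; exact h j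

theorem frobSq_diagonal {ν : Type*} [Fintype ν] [DecidableEq ν] (d : ν → ℝ) :
    frobSq (diagonal d) = ∑ j, d j ^ 2 := by
  refine Finset.sum_congr rfl fun i _ => ?_
  rw [Finset.sum_eq_single i]
  · simp
  · intro j _ hj; simp [Matrix.diagonal_apply_ne _ hj.symm]
  · simp

theorem sum_filter_le_fin {r N : ℕ} (f : Fin (r + N) → ℝ) :
    ∑ j ∈ Finset.univ.filter (fun j : Fin (r + N) => r ≤ (j : ℕ)), f j =
      ∑ j, f (Fin.natAdd r j) := by
  rw [Finset.sum_filter, Fin.sum_univ_add,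
    Finset.sum_eq_zero fun x _ => if_neg (by simp)]
  simp

/-- Average error of the randomized rangefinder for target rank `r + 1`; the projections
`P Ω` need not depend measurably on `Ω`. -/
theorem integral_specNorm_sub_projection_mul_le {m r N p q : ℕ}
    (A : Matrix (Fin m) (Fin (r + 1 + N)) ℝ) (hp : 2 ≤ p) (hN : 0 < N)
    (hH : (Aᵀ * A).IsHermitian)
    (σ : Fin (r + 1 + N) → ℝ) (hσ_nonneg : ∀ i, 0 ≤ σ i) (hσ_anti : Antitone σ)
    (e : Equiv.Perm (Fin (r + 1 + N))) (hσ : ∀ i, σ i ^ 2 = hH.eigenvalues (e i))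
    (P : Matrix (Fin (r + 1 + N)) (Fin (r + 1 + p)) ℝ → Matrix (Fin m) (Fin m) ℝ)
    (hProj : ∀ Ω, P Ω * P Ω = P Ω ∧ (P Ω)ᵀ = P Ω ∧
      LinearMap.range (P Ω).mulVecLin =
        LinearMap.range ((A * Aᵀ) ^ q * A * Ω).mulVecLin) :
    ∫ Ω, specNorm (A - P Ω * A) ∂(gaussMat (Fin (r + 1 + N)) (Fin (r + 1 + p))) ≤
      ((1 + √(((r + 1 : ℕ) : ℝ) / ((p : ℝ) - 1))) *
          σ ⟨r + 1, by omega⟩ ^ (2 * q + 1) +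
        Real.exp 1 * √(((r + 1 : ℕ) : ℝ) + (p : ℝ)) / (p : ℝ) *
          √(∑ j ∈ Finset.univ.filter (fun j : Fin (r + 1 + N) => r + 1 ≤ (j : ℕ)),
            σ j ^ (2 * (2 * q + 1)))) ^ ((1 : ℝ) / (2 * (q : ℝ) + 1)) := by
  set s : Fin (r + 1) ⊕ Fin N → ℝ := fun i => σ (finSumFinEquiv i)
  set S : Matrix (Fin N) (Fin N) ℝ := diagonal fun j => s (Sum.inr j) ^ (2 * q + 1)
  set C : ℝ := (1 + √(((r + 1 : ℕ) : ℝ) / ((p : ℝ) - 1))) * σ ⟨r + 1, by omega⟩ ^ (2 * q + 1) +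
    Real.exp 1 * √(((r + 1 : ℕ) : ℝ) + (p : ℝ)) / (p : ℝ) *
      √(∑ j ∈ Finset.univ.filter (fun j : Fin (r + 1 + N) => r + 1 ≤ (j : ℕ)),
        σ j ^ (2 * (2 * q + 1))) with hC
  obtain ⟨V, hV', hV, hAV⟩ := exists_orthogonal_diagonalization hH (finSumFinEquiv.trans e)
  have hAV' : Aᵀ * A * V = V * diagonal fun i => s i ^ 2 := by
    rw [hAV]
    congr 2
    ext i
    exact (hσ _).symm
  have hσ0 := hσ_nonneg ⟨r + 1, by omega⟩
  have hC0 : 0 ≤ C := by positivity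
  have hSn : ‖S‖ ≤ σ ⟨r + 1, by omega⟩ ^ (2 * q + 1) := by
    refine opNorm_diagonal_le (by positivity) (fun j => pow_nonneg (hσ_nonneg _) _) fun j => ?_
    refine pow_le_pow_left₀ (hσ_nonneg _) (hσ_anti ?_) _
    simp [Fin.le_def]
  have hSf : frobSq S = ∑ j ∈ Finset.univ.filter
      (fun j : Fin (r + 1 + N) => r + 1 ≤ (j : ℕ)), σ j ^ (2 * (2 * q + 1)) := by
    rw [sum_filter_le_fin, frobSq_diagonal]
    refine Finset.sum_congr rfl fun j _ => ?_
    simp only [s, finSumFinEquiv_apply_right]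
    ring
  set K : ℝ := (1 : ℝ) / (2 * (q : ℝ) + 1)
  have hK : 0 < K := by positivity
  have hK1 : K ≤ 1 := by
    refine (div_le_one (by positivity)).2 ?_
    linarith [Nat.cast_nonneg (α := ℝ) q]
  set Φ : Matrix (Fin (r + 1 + N)) (Fin (r + 1 + p)) ℝ →
      Matrix (Fin (r + 1)) (Fin (r + 1 + p)) ℝ × Matrix (Fin N) (Fin (r + 1 + p)) ℝ :=
    fun Ω => ((Vᵀ * Ω).toRows₁, (Vᵀ * Ω).toRows₂)
  have hΦ : MeasurePreserving Φ (gaussMat (Fin (r + 1 + N)) (Fin (r + 1 + p)))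
      ((gaussMat (Fin (r + 1)) (Fin (r + 1 + p))).prod (gaussMat (Fin N) (Fin (r + 1 + p)))) :=
    measurePreserving_toRows_gaussMat.comp
      (measurePreserving_mul_gaussMat Vᵀ (by rw [Matrix.transpose_transpose, hV']))
  set g : Matrix (Fin (r + 1)) (Fin (r + 1 + p)) ℝ × Matrix (Fin N) (Fin (r + 1 + p)) ℝ → ℝ :=
    fun z => ‖S‖ + ‖S * z.2 * rightPinv z.1‖
  have hg : Measurable g := measurable_const.add (measurable_opNorm_mul_mul_rightPinv S)
  have hg0 : ∀ z, 0 ≤ g z := fun z => by positivity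
  have hLI : ∀ᵐ Ω ∂(gaussMat (Fin (r + 1 + N)) (Fin (r + 1 + p))),
      LinearIndependent ℝ (Φ Ω).1.row :=
    (measurePreserving_fst.comp hΦ).quasiMeasurePreserving.ae
      (ae_linearIndependent_gaussMat (r + 1) (by simp))
  refine integral_le_of_lintegral_ofReal_le (fun _ => norm_nonneg _) (by positivity) ?_
  calc ∫⁻ Ω, ENNReal.ofReal (specNorm (A - P Ω * A))
        ∂(gaussMat (Fin (r + 1 + N)) (Fin (r + 1 + p)))
      ≤ ∫⁻ Ω, ENNReal.ofReal (g (Φ Ω)) ^ K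
          ∂(gaussMat (Fin (r + 1 + N)) (Fin (r + 1 + p))) := by
        refine lintegral_mono_ae ?_
        filter_upwards [hLI] with Ω hΩ
        rw [ENNReal.ofReal_rpow_of_nonneg (hg0 _) hK.le]
        obtain ⟨h1, h2, h3⟩ := hProj Ω
        exact ENNReal.ofReal_le_ofReal (opNorm_sub_projection_mul_le hV hV' hAV' h1 h2 h3 hΩ)
    _ = ∫⁻ z, ENNReal.ofReal (g z) ^ K ∂((gaussMat (Fin (r + 1)) (Fin (r + 1 + p))).prod
          (gaussMat (Fin N) (Fin (r + 1 + p)))) :=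
        hΦ.lintegral_comp (hg.ennreal_ofReal.pow_const K)
    _ ≤ (∫⁻ z, ENNReal.ofReal (g z) ∂((gaussMat (Fin (r + 1)) (Fin (r + 1 + p))).prod
          (gaussMat (Fin N) (Fin (r + 1 + p))))) ^ K :=
        lintegral_rpow_le_rpow_lintegral hg.ennreal_ofReal.aemeasurable hK hK1
    _ ≤ ENNReal.ofReal C ^ K := by
        refine ENNReal.rpow_le_rpow ?_ hK.le
        simp only [g, ENNReal.ofReal_add (norm_nonneg _) (norm_nonneg _)]
        rw [lintegral_add_left measurable_const, lintegral_const, measure_univ, mul_one]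
        refine (add_le_add_right (lintegral_opNorm_mul_mul_rightPinv_le (by simp) hp S) _).trans ?_
        rw [← ENNReal.ofReal_add (norm_nonneg _) (by positivity), hSf, hC]
        refine ENNReal.ofReal_le_ofReal ?_
        rw [← add_assoc]
        have := mul_le_mul_of_nonneg_left hSn
          (by positivity : 0 ≤ 1 + √(((r + 1 : ℕ) : ℝ) / ((p : ℝ) - 1)))
        linarith
    _ = ENNReal.ofReal (C ^ K) := ENNReal.ofReal_rpow_of_nonneg hC0 hK.le

end

/-- Average spectral error of the randomized rangefinder (Halko–Martinsson–Tropp).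
`σ : Fin n → ℝ` lists the singular values of `A` (the square roots of the eigenvalues
of `AᵀA`, up to a permutation `e`) in non-increasing order, `σ 0` being `σ₁`. For a
target rank `r ≥ 2`, oversampling `p ≥ 2` with `r + p ≤ min m n`, `q ≥ 0` power
iterations, a standard Gaussian `n × (r+p)` matrix `Ω` and `P Ω` the orthogonal
projection onto the column space of `(AAᵀ)^q A Ω`,
`E ‖A − P_Ω A‖₂ ≤ [ (1 + √(r/(p−1))) σ_{r+1}^{2q+1}
    + (e √(r+p)/p) (∑_{j>r} σ_j^{2(2q+1)})^{1/2} ]^{1/(2q+1)}`. -/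
theorem stmt_0 {m n : ℕ} (A : Matrix (Fin m) (Fin n) ℝ)
    (r p q : ℕ) (hr : 2 ≤ r) (hp : 2 ≤ p) (hrp : r + p ≤ min m n)
    (hH : (Aᵀ * A).IsHermitian)
    (σ : Fin n → ℝ) (hσ_nonneg : ∀ i, 0 ≤ σ i) (hσ_anti : Antitone σ)
    (e : Equiv.Perm (Fin n)) (hσ : ∀ i, σ i ^ 2 = hH.eigenvalues (e i))
    (P : Matrix (Fin n) (Fin (r + p)) ℝ → Matrix (Fin m) (Fin m) ℝ)
    (hProj : ∀ Ω, P Ω * P Ω = P Ω ∧ (P Ω)ᵀ = P Ω ∧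
      LinearMap.range (P Ω).mulVecLin =
        LinearMap.range ((A * Aᵀ) ^ q * A * Ω).mulVecLin) :
    (∫ Ω : Matrix (Fin n) (Fin (r + p)) ℝ,
        specNorm (A - P Ω * A)
        ∂(Measure.pi fun _ : Fin n => Measure.pi fun _ : Fin (r + p) =>
            gaussianReal 0 1)) ≤
      ((1 + Real.sqrt ((r : ℝ) / ((p : ℝ) - 1))) *
          σ ⟨r, by omega⟩ ^ (2 * q + 1) +
        Real.exp 1 * Real.sqrt ((r : ℝ) + (p : ℝ)) / (p : ℝ) *
          Real.sqrt (∑ j ∈ Finset.univ.filter (fun j : Fin n => r ≤ (j : ℕ)),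
            σ j ^ (2 * (2 * q + 1)))) ^
        ((1 : ℝ) / (2 * (q : ℝ) + 1)) := by
  obtain ⟨r, rfl⟩ : ∃ k, r = k + 1 := ⟨r - 1, by omega⟩
  obtain ⟨N, rfl⟩ : ∃ N, n = r + 1 + N := Nat.exists_eq_add_of_le (by omega)
  exact integral_specNorm_sub_projection_mul_le A hp (by omega) hH σ hσ_nonneg hσ_anti e hσ P hProj
end

section
/- Let A ∈ ℝ^{m×n} have rank R and admit a factorization A = U S Vᵀ where U ∈ ℝ^{m×R} and V ∈ ℝ^{n×R} have orthonormal columns (UᵀU = I_R, VᵀV = I_R) and S ∈ ℝ^{R×R} is invertible. Let Ω ∈ ℝ^{n×k} be such that Vᵀ Ω ∈ ℝ^{R×k} has full row rank R. Then the column space of A Ω equals the column space of A (both equal the column space of U). -/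
open Matrix

namespace Matrix

variable {K l p q : Type*} [Field K] [Fintype p] [Fintype q]

/-- Right multiplication by a matrix with surjective action preserves the column space. -/
theorem range_mulVecLin_mul_of_range_eq_top (M : Matrix l p K) {N : Matrix p q K}
    (hN : LinearMap.range N.mulVecLin = ⊤) :
    LinearMap.range (M * N).mulVecLin = LinearMap.range M.mulVecLin := by
  rw [mulVecLin_mul, LinearMap.range_comp_of_range_eq_top _ hN]

theorem range_mulVecLin_eq_top_of_mul_eq_one [DecidableEq p] {N : Matrix p q K}
    {M : Matrix q p K} (h : N * M = 1) : LinearMap.range N.mulVecLin = ⊤ :=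
  LinearMap.range_eq_top.2 fun y => ⟨M *ᵥ y, by simp [h]⟩

theorem range_mulVecLin_eq_top_of_rank_eq_card {N : Matrix p q K}
    (h : N.rank = Fintype.card p) : LinearMap.range N.mulVecLin = ⊤ :=
  Submodule.eq_top_of_finrank_eq (by rw [Module.finrank_fintype_fun_eq_card, ← h, rank])

end Matrix

/-- If `A = U S Vᵀ` with `U, V` having orthonormal columns and `S` invertible
(so `rank A = R`), and `Vᵀ Ω` has full row rank `R`, then the column space of
`A Ω` equals the column space of `A` (both equal the column space of `U`). -/
theorem stmt_4 {m n R k : ℕ}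
    (A : Matrix (Fin m) (Fin n) ℝ) (U : Matrix (Fin m) (Fin R) ℝ)
    (S : Matrix (Fin R) (Fin R) ℝ) (V : Matrix (Fin n) (Fin R) ℝ)
    (Ω : Matrix (Fin n) (Fin k) ℝ)
    (hrank : A.rank = R)
    (hA : A = U * S * Vᵀ)
    (hU : Uᵀ * U = 1) (hV : Vᵀ * V = 1)
    (hS : IsUnit S)
    (hΩ : (Vᵀ * Ω).rank = R) :
    LinearMap.range (A * Ω).mulVecLin = LinearMap.range A.mulVecLin ∧
      LinearMap.range A.mulVecLin = LinearMap.range U.mulVecLin := by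
  obtain ⟨T, hST⟩ := hS.exists_right_inv
  have hAU : LinearMap.range A.mulVecLin = LinearMap.range U.mulVecLin := by
    rw [hA, range_mulVecLin_mul_of_range_eq_top _ (range_mulVecLin_eq_top_of_mul_eq_one hV),
      range_mulVecLin_mul_of_range_eq_top _ (range_mulVecLin_eq_top_of_mul_eq_one hST)]
  refine ⟨?_, hAU⟩
  rw [hAU, hA, Matrix.mul_assoc,
    range_mulVecLin_mul_of_range_eq_top _
      (range_mulVecLin_eq_top_of_rank_eq_card (by rw [hΩ, Fintype.card_fin])),
    range_mulVecLin_mul_of_range_eq_top _ (range_mulVecLin_eq_top_of_mul_eq_one hST)]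
end

section
/- Fix integers r ≥ 1, p ≥ 0 and a stepsize h > 0. Let A : [0, h] → ℝ^{m×n} be differentiable with rank(A(h)) ≤ r + p. Let Ω be an n×(r+p) random matrix with independent standard Gaussian N(0,1) entries, and let B : [0, h] → ℝ^{m×(r+p)} be the (random) curve defined by B′(t) = A′(t) Ω, B(0) = A(0) Ω. Then almost surely the column space of B(h) equals the column space of A(h); consequently, almost surely, if P denotes the orthogonal projection of ℝᵐ onto the column space of B(h), then ‖A(h) − P A(h)‖₂ = 0. -/
open Matrix MeasureTheory ProbabilityTheory

attribute [local instance] Matrix.frobeniusNormedAddCommGroup Matrix.frobeniusNormedSpace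

/-- The zero set of a nonzero real polynomial in finitely many variables is null for any
product of σ-finite measures without atoms. -/
theorem MvPolynomial.ae_pi_eval_ne_zero_fin {N : ℕ} (μ : Fin N → Measure ℝ)
    [∀ i, SigmaFinite (μ i)] [∀ i, NullSingletonClass (μ i)]
    {f : MvPolynomial (Fin N) ℝ} (hf : f ≠ 0) :
    ∀ᵐ x ∂Measure.pi μ, MvPolynomial.eval x f ≠ 0 := by
  induction N with
  | zero =>
    refine Filter.Eventually.of_forall fun x hx => hf ?_
    obtain ⟨c, rfl⟩ := MvPolynomial.C_surjective (R := ℝ) (Fin 0) f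
    simpa using hx
  | succ N ih =>
    have hmp := (measurePreserving_piFinSuccAbove μ 0).symm
    rw [← hmp.map_eq, (MeasurableEquiv.measurableEmbedding _).ae_map_iff]
    have hcons : ∀ z : ℝ × (Fin N → ℝ),
        (MeasurableEquiv.piFinSuccAbove (fun _ : Fin (N + 1) => ℝ) 0).symm z
          = Fin.cons z.1 z.2 := fun z => by
      simp [MeasurableEquiv.piFinSuccAbove, Fin.insertNthEquiv, Fin.insertNth_zero']
    simp only [hcons]
    have hmeas : MeasurableSet {z : ℝ × (Fin N → ℝ) |
        MvPolynomial.eval (Fin.cons z.1 z.2 : Fin (N + 1) → ℝ) f ≠ 0} := by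
      have := hmp.measurable
        (isOpen_ne.preimage (MvPolynomial.continuous_eval f) (t := {y | y ≠ 0})).measurableSet
      simpa only [Set.preimage, hcons, Set.mem_ofPred_eq] using this
    rw [Measure.ae_prod_iff_ae_ae hmeas, Measure.ae_ae_comm hmeas]
    have hg : MvPolynomial.finSuccEquiv ℝ N f ≠ 0 := by simpa using hf
    obtain ⟨k, hk⟩ : ∃ k, (MvPolynomial.finSuccEquiv ℝ N f).coeff k ≠ 0 := by
      by_contra! h0
      exact hg (Polynomial.ext h0)
    filter_upwards [ih (fun j => μ ((0 : Fin (N + 1)).succAbove j)) hk] with s hs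
    have hp : Polynomial.map (MvPolynomial.eval s) (MvPolynomial.finSuccEquiv ℝ N f) ≠ 0 := by
      intro h0
      apply hs
      rw [← Polynomial.coeff_map, h0, Polynomial.coeff_zero]
    filter_upwards [compl_mem_ae_iff.2
      ((Polynomial.finite_setOfPred_isRoot hp).measure_zero (μ 0))] with y hy
    rw [MvPolynomial.eval_eq_eval_mv_eval']
    exact hy

theorem MvPolynomial.ae_pi_eval_ne_zero {ι : Type*} [Fintype ι] (μ : ι → Measure ℝ)
    [∀ i, SigmaFinite (μ i)] [∀ i, NullSingletonClass (μ i)]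
    {f : MvPolynomial ι ℝ} (hf : f ≠ 0) :
    ∀ᵐ x ∂Measure.pi μ, MvPolynomial.eval x f ≠ 0 := by
  let e : Fin (Fintype.card ι) ≃ ι := (Fintype.equivFin ι).symm
  have hmp := measurePreserving_piCongrLeft μ e
  rw [← hmp.map_eq, (MeasurableEquiv.measurableEmbedding _).ae_map_iff]
  have hf' : MvPolynomial.rename e.symm f ≠ 0 := by
    rwa [Ne, map_eq_zero_iff _ (MvPolynomial.rename_injective _ e.symm.injective)]
  filter_upwards [MvPolynomial.ae_pi_eval_ne_zero_fin (fun i => μ (e i)) hf'] with x hx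
  rw [MvPolynomial.eval_rename] at hx
  convert hx using 3
  ext i
  simp [MeasurableEquiv.coe_piCongrLeft, Equiv.piCongrLeft_apply]

theorem MvPolynomial.ae_pi_pi_eval_ne_zero {ι κ : Type*} [Fintype ι] [Fintype κ]
    (μ : Measure ℝ) [IsProbabilityMeasure μ] [NullSingletonClass μ]
    {f : MvPolynomial (ι × κ) ℝ} (hf : f ≠ 0) :
    ∀ᵐ x ∂(Measure.pi fun _ : ι => Measure.pi fun _ : κ => μ),
      MvPolynomial.eval (fun ij : ι × κ => x ij.1 ij.2) f ≠ 0 := by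
  have hmap := Measure.infinitePi_map_curry (fun (_ : ι) (_ : κ) => μ)
  simp only [Measure.infinitePi_eq_pi] at hmap
  rw [← hmap, (MeasurableEquiv.measurableEmbedding _).ae_map_iff]
  exact MvPolynomial.ae_pi_eval_ne_zero (fun _ => μ) hf

/-- A rank factorization of a real matrix. -/
theorem Matrix.exists_rank_factorization {m n : ℕ} (M : Matrix (Fin m) (Fin n) ℝ) :
    ∃ (C : Matrix (Fin m) (Fin M.rank) ℝ) (F : Matrix (Fin M.rank) (Fin n) ℝ)
      (G : Matrix (Fin n) (Fin M.rank) ℝ), M = C * F ∧ F * G = 1 := by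
  let b := Module.finBasis ℝ (LinearMap.range M.mulVecLin)
  let e : LinearMap.range M.mulVecLin ≃ₗ[ℝ] (Fin M.rank → ℝ) := b.equivFun
  let f : (Fin n → ℝ) →ₗ[ℝ] (Fin M.rank → ℝ) := e.toLinearMap ∘ₗ M.mulVecLin.rangeRestrict
  have hf : LinearMap.range f = ⊤ := LinearMap.range_eq_top.2
    (e.surjective.comp M.mulVecLin.surjective_rangeRestrict)
  obtain ⟨g, hg⟩ := f.exists_rightInverse_of_surjective hf
  refine ⟨LinearMap.toMatrix' ((LinearMap.range M.mulVecLin).subtype ∘ₗ e.symm.toLinearMap),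
    LinearMap.toMatrix' f, LinearMap.toMatrix' g, ?_, ?_⟩
  · rw [← LinearMap.toMatrix'_comp]
    apply Matrix.toLin'.injective
    rw [Matrix.toLin'_toMatrix']
    ext1 i
    ext
    simp [f]
  · rw [← LinearMap.toMatrix'_comp, hg, LinearMap.toMatrix'_id]

/-- Multiplying by a random matrix with i.i.d. atomless entries and at least `M.rank` columns
almost surely preserves the column space of `M`. -/
theorem Matrix.ae_range_mul_eq {m n s : ℕ} (M : Matrix (Fin m) (Fin n) ℝ)
    (hs : M.rank ≤ s) (μ : Measure ℝ) [IsProbabilityMeasure μ] [NullSingletonClass μ] :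
    ∀ᵐ Ω : Matrix (Fin n) (Fin s) ℝ
      ∂(Measure.pi fun _ : Fin n => Measure.pi fun _ : Fin s => μ),
      LinearMap.range (M * Ω).mulVecLin = LinearMap.range M.mulVecLin := by
  obtain ⟨C, F, G, hM, hFG⟩ := M.exists_rank_factorization
  let E : Matrix (Fin s) (Fin M.rank) ℝ := (1 : Matrix (Fin s) (Fin s) ℝ).submatrix id
    (Fin.castLE hs)
  have hE : Eᵀ * E = 1 := by
    ext i j
    simp [E, Matrix.mul_apply, Matrix.one_apply, eq_comm]
  let f : MvPolynomial (Fin n × Fin s) ℝ :=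
    Matrix.det ((F.map MvPolynomial.C : Matrix _ _ (MvPolynomial (Fin n × Fin s) ℝ)) *
      Matrix.mvPolynomialX (Fin n) (Fin s) ℝ *
      (E.map MvPolynomial.C : Matrix _ _ (MvPolynomial (Fin n × Fin s) ℝ)))
  have heval : ∀ Ω : Matrix (Fin n) (Fin s) ℝ,
      MvPolynomial.eval (fun ij => Ω ij.1 ij.2) f = (F * Ω * E).det := fun Ω => by
    rw [RingHom.map_det]
    congr 1
    ext i j
    simp [Matrix.mul_apply, Matrix.mvPolynomialX]
  have hf : f ≠ 0 := by
    intro h0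
    have h1 := heval (G * Eᵀ)
    rw [h0, map_zero, ← Matrix.mul_assoc F, hFG, Matrix.one_mul, hE, Matrix.det_one] at h1
    exact zero_ne_one h1
  filter_upwards [MvPolynomial.ae_pi_pi_eval_ne_zero μ hf] with Ω hΩ
  replace hΩ : (F * Ω * E).det ≠ 0 := by
    rw [← heval]
    exact hΩ
  refine le_antisymm ?_ ?_
  · rw [Matrix.mulVecLin_mul]
    exact LinearMap.range_comp_le_range _ _
  · rintro _ ⟨v, rfl⟩
    refine ⟨(E * (F * Ω * E)⁻¹ * F) *ᵥ v, ?_⟩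
    have h1 : M * Ω * (E * (F * Ω * E)⁻¹ * F) = M := by
      calc _ = C * ((F * Ω * E) * (F * Ω * E)⁻¹) * F := by
            nth_rewrite 1 [hM]
            simp only [Matrix.mul_assoc]
        _ = M := by
            rw [Matrix.mul_nonsing_inv _ (Ne.isUnit hΩ), Matrix.mul_one, ← hM]
    rw [Matrix.mulVecLin_apply, Matrix.mulVecLin_apply, Matrix.mulVec_mulVec, h1]

/-- A curve solving `B' = A' Ω`, `B 0 = A 0 Ω` is `A Ω`. -/
theorem Matrix.eq_mul_of_hasDerivAt {m n s : ℕ} {h : ℝ} (hh : 0 ≤ h)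
    {A A' : ℝ → Matrix (Fin m) (Fin n) ℝ} {B : ℝ → Matrix (Fin m) (Fin s) ℝ}
    {Ω : Matrix (Fin n) (Fin s) ℝ}
    (hA : ∀ t ∈ Set.Icc (0 : ℝ) h, HasDerivAt A (A' t) t)
    (hB : ∀ t ∈ Set.Icc (0 : ℝ) h, HasDerivAt B (A' t * Ω) t) (hB0 : B 0 = A 0 * Ω) :
    B h = A h * Ω := by
  let L : Matrix (Fin m) (Fin n) ℝ →L[ℝ] Matrix (Fin m) (Fin s) ℝ :=
    LinearMap.toContinuousLinearMap
      { toFun := fun X => X * Ω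
        map_add' := fun X Y => Matrix.add_mul X Y Ω
        map_smul' := fun c X => Matrix.smul_mul c X Ω }
  have hd : ∀ t ∈ Set.Icc (0 : ℝ) h, HasDerivAt (fun t => B t - L (A t)) 0 t := by
    intro t ht
    have h1 := (hB t ht).sub (L.hasFDerivAt.comp_hasDerivAt t (hA t ht))
    exact (sub_self (A' t * Ω)) ▸ h1
  have hc := constant_of_has_deriv_right_zero
    (fun t ht => (hd t ht).continuousAt.continuousWithinAt)
    (fun t ht => (hd t ⟨ht.1, ht.2.le⟩).hasDerivWithinAt) h ⟨hh, le_rfl⟩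
  have h0 : B 0 - L (A 0) = 0 := sub_eq_zero.2 hB0
  rw [h0] at hc
  exact sub_eq_zero.1 hc

theorem Matrix.mul_eq_of_range_le {m n : ℕ} {P : Matrix (Fin m) (Fin m) ℝ}
    {M : Matrix (Fin m) (Fin n) ℝ} (hP : P * P = P)
    (hr : LinearMap.range M.mulVecLin ≤ LinearMap.range P.mulVecLin) : P * M = M := by
  apply Matrix.mulVec_injective
  ext1 v
  obtain ⟨w, hw⟩ := hr ⟨v, rfl⟩
  simp only [Matrix.mulVecLin_apply] at hw
  rw [← Matrix.mulVec_mulVec, ← hw, Matrix.mulVec_mulVec, hP]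

/-- Exact range property of the idealized dynamical rangefinder: if
`rank (A h) ≤ r + p`, `Ω` is an `n × (r+p)` standard Gaussian random matrix, and for
each `Ω` the curve `B Ω` solves `B′(t) = A′(t) Ω` on `[0, h]` with `B(0) = A(0) Ω`,
then almost surely the column space of `B Ω h` equals the column space of `A h`;
consequently, almost surely, for every orthogonal projection `P` onto the column space
of `B Ω h` one has `‖A h − P (A h)‖₂ = 0`. -/
theorem stmt_5 {m n : ℕ} (r p : ℕ) (hr : 1 ≤ r) {h : ℝ} (hh : 0 < h)
    (A : ℝ → Matrix (Fin m) (Fin n) ℝ) (A' : ℝ → Matrix (Fin m) (Fin n) ℝ)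
    (hA : ∀ t ∈ Set.Icc (0 : ℝ) h, HasDerivAt A (A' t) t)
    (hrank : (A h).rank ≤ r + p)
    (B : Matrix (Fin n) (Fin (r + p)) ℝ → ℝ → Matrix (Fin m) (Fin (r + p)) ℝ)
    (hB : ∀ Ω, ∀ t ∈ Set.Icc (0 : ℝ) h, HasDerivAt (B Ω) (A' t * Ω) t)
    (hB0 : ∀ Ω, B Ω 0 = A 0 * Ω) :
    ∀ᵐ Ω : Matrix (Fin n) (Fin (r + p)) ℝ
      ∂(Measure.pi fun _ : Fin n => Measure.pi fun _ : Fin (r + p) => gaussianReal 0 1),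
      LinearMap.range (B Ω h).mulVecLin = LinearMap.range (A h).mulVecLin ∧
        ∀ P : Matrix (Fin m) (Fin m) ℝ,
          P * P = P → Pᵀ = P →
          LinearMap.range P.mulVecLin = LinearMap.range (B Ω h).mulVecLin →
          specNorm (A h - P * A h) = 0 := by
  have : NullSingletonClass (gaussianReal 0 1) := nullSingletonClass_gaussianReal one_ne_zero
  filter_upwards [(A h).ae_range_mul_eq hrank (gaussianReal 0 1)] with Ω hΩ
  rw [Matrix.eq_mul_of_hasDerivAt hh.le hA (hB Ω) (hB0 Ω)]
  refine ⟨hΩ, fun P hP _ hr => ?_⟩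
  rw [Matrix.mul_eq_of_range_le hP (hΩ.symm.trans hr.symm).le, sub_self]
  simp [specNorm]
end

section
/- Let A : [0, h] → ℝ^{m×n} be differentiable and let Q ∈ ℝ^{m×k} have orthonormal columns (QᵀQ = I_k). Suppose C : [0, h] → ℝ^{n×k} is differentiable with C′(t) = A′(t)ᵀ Q for all t ∈ [0, h] and C(0) = A(0)ᵀ Q. If the column space of A(h) is contained in the column space of Q, then Q C(h)ᵀ = A(h). -/
open Matrix

attribute [local instance] Matrix.frobeniusNormedAddCommGroup Matrix.frobeniusNormedSpace

/-- If the columns of `M` lie in the column space of `Q`, and `Q` has orthonormal columns, then the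
projection `Q * Qᵀ` fixes `M`. -/
theorem mul_transpose_mul_eq_self_of_range_le {R l m n : Type*} [CommRing R]
    [Fintype l] [Fintype m] [Fintype n] [DecidableEq l] [DecidableEq n]
    {M : Matrix m n R} {Q : Matrix m l R} (hQ : Qᵀ * Q = 1)
    (hrange : LinearMap.range M.mulVecLin ≤ LinearMap.range Q.mulVecLin) :
    Q * (Qᵀ * M) = M := by
  refine Matrix.ext_of_mulVec_single fun j => ?_
  obtain ⟨w, hw⟩ := hrange (LinearMap.mem_range_self M.mulVecLin (Pi.single j 1))
  simp only [Matrix.mulVecLin_apply] at hw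
  rw [← Matrix.mulVec_mulVec, ← Matrix.mulVec_mulVec, ← hw, Matrix.mulVec_mulVec w, hQ,
    Matrix.one_mulVec]

/-- Over an interval, a linear image of a curve is determined by its initial value and its
derivative. -/
theorem eq_linearMap_of_hasDerivAt {E F : Type*} [NormedAddCommGroup E] [NormedSpace ℝ E]
    [NormedAddCommGroup F] [NormedSpace ℝ F] [FiniteDimensional ℝ E] (L : E →ₗ[ℝ] F)
    {a b : ℝ} {f f' : ℝ → E} {g : ℝ → F}
    (hf : ∀ t ∈ Set.Icc a b, HasDerivAt f (f' t) t)
    (hg : ∀ t ∈ Set.Icc a b, HasDerivAt g (L (f' t)) t) (ha : g a = L (f a)) :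
    ∀ t ∈ Set.Icc a b, g t = L (f t) := by
  have hd : ∀ t ∈ Set.Icc a b, HasDerivAt (fun s => g s - L (f s)) 0 t := fun t ht => by
    rw [← sub_self (L (f' t))]
    exact (hg t ht).sub
      ((LinearMap.toContinuousLinearMap L).hasFDerivAt.comp_hasDerivAt t (hf t ht))
  intro t ht
  have := constant_of_has_deriv_right_zero
    (fun s hs => (hd s hs).continuousAt.continuousWithinAt)
    (fun s hs => (hd s (Set.Ico_subset_Icc_self hs)).hasDerivWithinAt) t ht
  rwa [ha, sub_self, sub_eq_zero] at this

/-- Exactness property of the idealized dynamical randomized SVD: if `C′(t) = A′(t)ᵀ Q`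
on `[0, h]` with `C(0) = A(0)ᵀ Q`, `Q` has orthonormal columns, and the column space of
`A(h)` is contained in the column space of `Q`, then `Q C(h)ᵀ = A(h)`. -/
theorem stmt_9 {m n k : ℕ} {h : ℝ} (hh : 0 ≤ h)
    (A : ℝ → Matrix (Fin m) (Fin n) ℝ) (A' : ℝ → Matrix (Fin m) (Fin n) ℝ)
    (Q : Matrix (Fin m) (Fin k) ℝ) (hQ : Qᵀ * Q = 1)
    (C : ℝ → Matrix (Fin n) (Fin k) ℝ)
    (hA : ∀ t ∈ Set.Icc (0 : ℝ) h, HasDerivAt A (A' t) t)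
    (hC : ∀ t ∈ Set.Icc (0 : ℝ) h, HasDerivAt C ((A' t)ᵀ * Q) t)
    (hC0 : C 0 = (A 0)ᵀ * Q)
    (hrange : LinearMap.range (A h).mulVecLin ≤ LinearMap.range Q.mulVecLin) :
    Q * (C h)ᵀ = A h := by
  let L : Matrix (Fin m) (Fin n) ℝ →ₗ[ℝ] Matrix (Fin n) (Fin k) ℝ :=
    { toFun := fun X => Xᵀ * Q
      map_add' := fun X Y => by rw [Matrix.transpose_add, Matrix.add_mul]
      map_smul' := fun c X => by
        rw [Matrix.transpose_smul, Matrix.smul_mul, RingHom.id_apply] }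
  have hCh : C h = (A h)ᵀ * Q :=
    eq_linearMap_of_hasDerivAt L hA hC hC0 h (Set.right_mem_Icc.mpr hh)
  rw [hCh, Matrix.transpose_mul, Matrix.transpose_transpose]
  exact mul_transpose_mul_eq_self_of_range_le hQ hrange
end

section
/- Let F : ℝ^{m×n} → ℝ^{m×n} be Lipschitz continuous (with respect to the Frobenius norm). Let A : [0, h] → ℝ^{m×n} be differentiable with A′(t) = F(A(t)) for all t ∈ [0, h], and let Q ∈ ℝ^{m×k} have orthonormal columns (QᵀQ = I_k). Assume that for every t ∈ [0, h] the column space of A(t) is contained in the column space of Q. Let C : [0, h] → ℝ^{n×k} be any differentiable curve with C′(t) = F(Q C(t)ᵀ)ᵀ Q for all t ∈ [0, h] and C(0) = A(0)ᵀ Q. Then C(t) = A(t)ᵀ Q for all t ∈ [0, h], and in particular Q C(h)ᵀ = A(h). -/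
open Matrix

attribute [local instance] Matrix.frobeniusNormedAddCommGroup Matrix.frobeniusNormedSpace

/-- If the columns of `Q` are orthonormal, then `Q * Qᵀ` fixes every matrix whose column space
is contained in that of `Q`. -/
theorem mul_transpose_mul_of_range_le {m n k : ℕ} {A : Matrix (Fin m) (Fin n) ℝ}
    {Q : Matrix (Fin m) (Fin k) ℝ} (hQ : Qᵀ * Q = 1)
    (hA : LinearMap.range A.mulVecLin ≤ LinearMap.range Q.mulVecLin) :
    Q * (Qᵀ * A) = A := by
  refine Matrix.ext_of_mulVec_single fun i => ?_
  obtain ⟨w, hw⟩ := hA ⟨Pi.single i 1, rfl⟩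
  simp only [Matrix.mulVecLin_apply] at hw
  rw [← Matrix.mulVec_mulVec, ← Matrix.mulVec_mulVec, ← hw, Matrix.mulVec_mulVec w Qᵀ Q, hQ,
    Matrix.one_mulVec]

/-- The continuous linear map `X ↦ Xᵀ * Q`. -/
noncomputable def transposeMulCLM {m n k : ℕ} (Q : Matrix (Fin m) (Fin k) ℝ) :
    Matrix (Fin m) (Fin n) ℝ →L[ℝ] Matrix (Fin n) (Fin k) ℝ :=
  LinearMap.toContinuousLinearMap
    { toFun := fun X => Xᵀ * Q
      map_add' := fun X Y => by rw [Matrix.transpose_add, Matrix.add_mul]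
      map_smul' := fun c X => by simp }

/-- The right-hand side of the C-step is Lipschitz. -/
theorem exists_lipschitzWith_cStep {m n k : ℕ}
    {F : Matrix (Fin m) (Fin n) ℝ → Matrix (Fin m) (Fin n) ℝ} {Λ : ℝ} (hΛ : 0 ≤ Λ)
    (hF : ∀ X Y : Matrix (Fin m) (Fin n) ℝ, ‖F X - F Y‖ ≤ Λ * ‖X - Y‖)
    (Q : Matrix (Fin m) (Fin k) ℝ) :
    ∃ K, LipschitzWith K
      fun X : Matrix (Fin n) (Fin k) ℝ => (F (Q * Xᵀ))ᵀ * Q := by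
  have hF' : LipschitzWith ⟨Λ, hΛ⟩ F :=
    LipschitzWith.of_dist_le_mul fun X Y => by
      rw [dist_eq_norm, dist_eq_norm]
      exact hF X Y
  have hlift : LipschitzWith ‖Q‖₊ fun X : Matrix (Fin n) (Fin k) ℝ => Q * Xᵀ :=
    LipschitzWith.of_dist_le_mul fun X Y => by
      rw [dist_eq_norm, dist_eq_norm, ← Matrix.mul_sub, ← Matrix.transpose_sub,
        ← Matrix.frobenius_norm_transpose (X - Y)]
      exact Matrix.frobenius_norm_mul _ _
  have hproj : LipschitzWith ‖Q‖₊ fun X : Matrix (Fin m) (Fin n) ℝ => Xᵀ * Q :=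
    LipschitzWith.of_dist_le_mul fun X Y => by
      rw [dist_eq_norm, dist_eq_norm, ← Matrix.sub_mul, ← Matrix.transpose_sub,
        ← Matrix.frobenius_norm_transpose (X - Y), mul_comm]
      exact Matrix.frobenius_norm_mul _ _
  exact ⟨_, hproj.comp (hF'.comp hlift)⟩

/-- Exactness property of the dynamical randomized SVD: if `F` is Lipschitz (Frobenius
norm), `A′(t) = F(A(t))` on `[0, h]`, `Q` has orthonormal columns, the column space of
`A(t)` is contained in the column space of `Q` for all `t ∈ [0, h]`, and `C` solves the
C-step `C′(t) = F(Q C(t)ᵀ)ᵀ Q` with `C(0) = A(0)ᵀ Q`, then `C(t) = A(t)ᵀ Q` on `[0, h]`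
and in particular `Q C(h)ᵀ = A(h)`. -/
theorem stmt_11 {m n k : ℕ} {h : ℝ} (hh : 0 ≤ h)
    (F : Matrix (Fin m) (Fin n) ℝ → Matrix (Fin m) (Fin n) ℝ)
    (Λ : ℝ) (hΛ : 0 ≤ Λ)
    (hF : ∀ X Y : Matrix (Fin m) (Fin n) ℝ, ‖F X - F Y‖ ≤ Λ * ‖X - Y‖)
    (A : ℝ → Matrix (Fin m) (Fin n) ℝ)
    (Q : Matrix (Fin m) (Fin k) ℝ) (hQ : Qᵀ * Q = 1)
    (hA : ∀ t ∈ Set.Icc (0 : ℝ) h, HasDerivAt A (F (A t)) t)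
    (hrange : ∀ t ∈ Set.Icc (0 : ℝ) h,
      LinearMap.range (A t).mulVecLin ≤ LinearMap.range Q.mulVecLin)
    (C : ℝ → Matrix (Fin n) (Fin k) ℝ)
    (hC : ∀ t ∈ Set.Icc (0 : ℝ) h, HasDerivAt C ((F (Q * (C t)ᵀ))ᵀ * Q) t)
    (hC0 : C 0 = (A 0)ᵀ * Q) :
    (∀ t ∈ Set.Icc (0 : ℝ) h, C t = (A t)ᵀ * Q) ∧ Q * (C h)ᵀ = A h := by
  have hproj : ∀ t ∈ Set.Icc (0 : ℝ) h, Q * ((A t)ᵀ * Q)ᵀ = A t := fun t ht => by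
    rw [Matrix.transpose_mul, Matrix.transpose_transpose]
    exact mul_transpose_mul_of_range_le hQ (hrange t ht)
  have hAQ : ∀ t ∈ Set.Icc (0 : ℝ) h,
      HasDerivAt (fun s => (A s)ᵀ * Q) ((F (Q * ((A t)ᵀ * Q)ᵀ))ᵀ * Q) t := fun t ht => by
    rw [hproj t ht]
    exact (transposeMulCLM Q).hasFDerivAt.comp_hasDerivAt t (hA t ht)
  obtain ⟨K, hK⟩ := exists_lipschitzWith_cStep hΛ hF Q
  have heq : Set.EqOn C (fun s => (A s)ᵀ * Q) (Set.Icc 0 h) :=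
    ODE_solution_unique (v := fun _ X => (F (Q * Xᵀ))ᵀ * Q) (fun _ => hK)
      (fun t ht => (hC t ht).continuousAt.continuousWithinAt)
      (fun t ht => (hC t (Set.Ico_subset_Icc_self ht)).hasDerivWithinAt)
      (fun t ht => (hAQ t ht).continuousAt.continuousWithinAt)
      (fun t ht => (hAQ t (Set.Ico_subset_Icc_self ht)).hasDerivWithinAt)
      hC0
  have hh' : h ∈ Set.Icc (0 : ℝ) h := ⟨hh, le_rfl⟩
  refine ⟨fun t ht => heq ht, ?_⟩
  rw [show C h = (A h)ᵀ * Q from heq hh']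
  exact hproj h hh'
end

section
/- Let F : ℝ^{m×n} → ℝ^{m×n}, let A : [0, h] → ℝ^{m×n} be differentiable with A′(t) = F(A(t)) for all t ∈ [0, h], and let W ∈ ℝ^{n×k} have orthonormal columns (WᵀW = I_k). Assume that for every t ∈ [0, h] the column space of A(t)ᵀ (the row space of A(t)) is contained in the column space of W. Then the curve B : [0, h] → ℝ^{m×k} defined by B(t) = A(t) W satisfies B(0) = A(0) W and B′(t) = F(B(t) Wᵀ) W for all t ∈ [0, h]; that is, B is a solution of the B-step differential equation of the dynamical generalized Nyström method. -/
open Matrix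

attribute [local instance] Matrix.frobeniusNormedAddCommGroup Matrix.frobeniusNormedSpace

/-- If `W` has orthonormal columns, then `W * Wᵀ` fixes every matrix whose row space lies in the
column space of `W`. -/
theorem mul_mul_transpose_eq_self_of_range_le {m n k : ℕ} {M : Matrix (Fin m) (Fin n) ℝ}
    {W : Matrix (Fin n) (Fin k) ℝ} (hW : Wᵀ * W = 1)
    (hM : LinearMap.range Mᵀ.mulVecLin ≤ LinearMap.range W.mulVecLin) :
    M * W * Wᵀ = M := by
  apply Matrix.transpose_injective
  apply Matrix.ext_of_mulVec_single
  intro i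
  obtain ⟨y, hy⟩ := hM ⟨Pi.single i 1, rfl⟩
  simp only [Matrix.mulVecLin_apply] at hy
  rw [Matrix.transpose_mul, Matrix.transpose_mul, Matrix.transpose_transpose,
    ← Matrix.mulVec_mulVec, ← Matrix.mulVec_mulVec, ← hy, Matrix.mulVec_mulVec y, hW,
    Matrix.one_mulVec]

/-- Right multiplication by a constant matrix commutes with differentiation. -/
theorem hasDerivAt_matrix_mul_const {m n k : ℕ} {A : ℝ → Matrix (Fin m) (Fin n) ℝ}
    {A' : Matrix (Fin m) (Fin n) ℝ} {t : ℝ} (hA : HasDerivAt A A' t)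
    (W : Matrix (Fin n) (Fin k) ℝ) : HasDerivAt (fun s => A s * W) (A' * W) t :=
  (LinearMap.toContinuousLinearMap
    (mulRightLinearMap (Fin m) ℝ W)).hasFDerivAt.comp_hasDerivAt t hA

/-- If `A′(t) = F(A(t))` on `[0, h]`, `W` has orthonormal columns, and the row space
of `A(t)` (column space of `A(t)ᵀ`) is contained in the column space of `W` for all
`t ∈ [0, h]`, then `B(t) = A(t) W` satisfies `B(0) = A(0) W` and
`B′(t) = F(B(t) Wᵀ) W`, i.e. `B` solves the B-step differential equation of the
dynamical generalized Nyström method. -/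
theorem stmt_12 {m n k : ℕ} {h : ℝ}
    (F : Matrix (Fin m) (Fin n) ℝ → Matrix (Fin m) (Fin n) ℝ)
    (A : ℝ → Matrix (Fin m) (Fin n) ℝ)
    (W : Matrix (Fin n) (Fin k) ℝ) (hW : Wᵀ * W = 1)
    (hA : ∀ t ∈ Set.Icc (0 : ℝ) h, HasDerivAt A (F (A t)) t)
    (hcorange : ∀ t ∈ Set.Icc (0 : ℝ) h,
      LinearMap.range (A t)ᵀ.mulVecLin ≤ LinearMap.range W.mulVecLin) :
    (fun t => A t * W) 0 = A 0 * W ∧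
      ∀ t ∈ Set.Icc (0 : ℝ) h,
        HasDerivAt (fun t => A t * W) (F ((A t * W) * Wᵀ) * W) t := by
  refine ⟨rfl, fun t ht => ?_⟩
  rw [mul_mul_transpose_eq_self_of_range_le hW (hcorange t ht)]
  exact hasDerivAt_matrix_mul_const (hA t ht) W
end

section
/- Let A ∈ ℝ^{m×n}, let Q ∈ ℝ^{m×k₁} and W ∈ ℝ^{n×k₂} have orthonormal columns (QᵀQ = I, WᵀW = I), and assume the column space of A is contained in the column space of Q and the column space of Aᵀ is contained in the column space of W. Set X = Qᵀ A W ∈ ℝ^{k₁×k₂} and let Y ∈ ℝ^{k₂×k₁} be any matrix satisfying X Y X = X. Then (A W) Y (Qᵀ A) = A. -/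
open Matrix

/-- If `Q` has orthonormal columns, `Q * Qᵀ` fixes every matrix whose column space is contained
in that of `Q`. -/
theorem Matrix.mul_transpose_mul_eq_of_range_le {R m n k : Type*} [CommSemiring R]
    [Fintype m] [Fintype n] [Fintype k] [DecidableEq n] [DecidableEq k] {A : Matrix m n R} {Q : Matrix m k R}
    (hQ : Qᵀ * Q = 1) (h : LinearMap.range A.mulVecLin ≤ LinearMap.range Q.mulVecLin) :
    Q * (Qᵀ * A) = A := by
  refine Matrix.ext_of_mulVec_single fun j => ?_
  obtain ⟨v, hv⟩ := h (LinearMap.mem_range_self A.mulVecLin (Pi.single j 1))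
  simp only [Matrix.mulVecLin_apply] at hv
  rw [← Matrix.mulVec_mulVec, ← Matrix.mulVec_mulVec, ← hv, Matrix.mulVec_mulVec v Qᵀ, hQ,
    Matrix.one_mulVec]

/-- Algebraic reconstruction identity underlying the generalized Nyström formula:
if `Q, W` have orthonormal columns, the column space of `A` is contained in that of `Q`,
the column space of `Aᵀ` is contained in that of `W`, and `Y` is an inner generalized
inverse of `X = Qᵀ A W`, then `(A W) Y (Qᵀ A) = A`. -/
theorem stmt_14 {m n k₁ k₂ : ℕ}
    (A : Matrix (Fin m) (Fin n) ℝ)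
    (Q : Matrix (Fin m) (Fin k₁) ℝ) (W : Matrix (Fin n) (Fin k₂) ℝ)
    (hQ : Qᵀ * Q = 1) (hW : Wᵀ * W = 1)
    (hrange : LinearMap.range A.mulVecLin ≤ LinearMap.range Q.mulVecLin)
    (hcorange : LinearMap.range Aᵀ.mulVecLin ≤ LinearMap.range W.mulVecLin)
    (Y : Matrix (Fin k₂) (Fin k₁) ℝ)
    (hY : (Qᵀ * A * W) * Y * (Qᵀ * A * W) = Qᵀ * A * W) :
    (A * W) * Y * (Qᵀ * A) = A := by
  have hQA : Q * (Qᵀ * A) = A := Matrix.mul_transpose_mul_eq_of_range_le hQ hrange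
  have hAW : A * W * Wᵀ = A := by
    simpa [Matrix.mul_assoc] using
      congrArg transpose (Matrix.mul_transpose_mul_eq_of_range_le hW hcorange)
  calc
    A * W * Y * (Qᵀ * A) = Q * (Qᵀ * A) * W * Y * (Qᵀ * (A * W * Wᵀ)) := by rw [hQA, hAW]
    _ = Q * (Qᵀ * A * W * Y * (Qᵀ * A * W)) * Wᵀ := by simp only [Matrix.mul_assoc]
    _ = Q * (Qᵀ * (A * W * Wᵀ)) := by rw [hY]; simp only [Matrix.mul_assoc]
    _ = A := by rw [hAW, hQA]
end
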